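/- Let m ≥ 3, n ≥ 1 and N ≥ 1. For all m-admissible pairs (q,r) and (q̃,r̃), every index 1 ≤ α ≤ N and every space–time function F, the retarded (inhomogeneous) estimate ‖∫_0^t e^{i(t−s)Δ_x} F(s) ds‖_{L^q_t L^{r,2}_{y_α} L^2_{z_α} L^2_{x̂_α}} ≲ ‖F‖_{L^{q̃'}_t L^{r̃',2}_{y_α} L^2_{z_α} L^2_{x̂_α}} holds, where q̃', r̃' are the Hölder conjugates of q̃, r̃. -/

import Mathlib

/-!
Setting of Z. Zhao, "On Strichartz estimate for many body Schrödinger equations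
in the waveguide setting": the waveguide manifold `ℝ^m × 𝕋^n`, the `N`-body
configuration space `(ℝ^m × 𝕋^n)^N`, the many body Schrödinger operator
`H_N = Δ_x - ∑_{α<β} V(x_α - x_β)`, its propagator (characterized weakly),
iterated mixed Lebesgue/Lorentz norms, and Koch–Tataru `V^p`-spaces adapted to
the free propagator.
-/

noncomputable section
open MeasureTheory
open scoped ENNReal NNReal

namespace ManyBodyWaveguide

instance : Fact ((0:ℝ) < 1) := ⟨one_pos⟩

/-- The `n`-dimensional torus `𝕋^n`. -/
abbrev Torus (n : ℕ) := Fin n → AddCircle (1 : ℝ)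

/-- The waveguide manifold `ℝ^m × 𝕋^n`, a point being `(y, z)`. -/
abbrev Wg (m n : ℕ) := (Fin m → ℝ) × Torus n

/-- The configuration space `(ℝ^m × 𝕋^n)^N` of `N` particles. -/
abbrev Cfg (m n N : ℕ) := Fin N → Wg m n

/-- `L²_x = L²((ℝ^m × 𝕋^n)^N)`. -/
abbrev L2 (m n N : ℕ) := Lp ℂ 2 (volume : Measure (Cfg m n N))

/-- The unfolded (periodic) configuration space `(ℝ^m × ℝ^n)^N`. -/
abbrev CfgE (m n N : ℕ) := Fin N → ((Fin m → ℝ) × (Fin n → ℝ))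

/-- Projection of the unfolded configuration space onto `(ℝ^m × 𝕋^n)^N`. -/
def fold (m n N : ℕ) : CfgE m n N → Cfg m n N :=
  fun x α => ((x α).1, fun j => (((x α).2 j : ℝ) : AddCircle (1:ℝ)))

/-- The canonical lift of a configuration, using representatives in `[0,1)`. -/
def liftCfg (m n N : ℕ) : Cfg m n N → CfgE m n N :=
  fun x α => ((x α).1, fun j => (AddCircle.equivIco 1 0 ((x α).2 j)).1)

/-- Second directional derivative of `f` at `x` in direction `v`. -/
def secondDeriv {E F : Type*} [NormedAddCommGroup E] [NormedSpace ℝ E]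
    [NormedAddCommGroup F] [NormedSpace ℝ F] (f : E → F) (x v : E) : F :=
  fderiv ℝ (fun y => fderiv ℝ f y v) x v

/-- Coordinate vector in the Euclidean direction `i` of particle `α`. -/
def eY (m n N : ℕ) (α : Fin N) (i : Fin m) : CfgE m n N :=
  Pi.single α (Pi.single i (1:ℝ), 0)

/-- Coordinate vector in the periodic direction `j` of particle `α`. -/
def eZ (m n N : ℕ) (α : Fin N) (j : Fin n) : CfgE m n N :=
  Pi.single α (0, Pi.single j (1:ℝ))

/-- The Laplacian `Δ_x = ∑_α Δ_{x_α}` on the unfolded configuration space. -/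
def laplacianE (m n N : ℕ) (f : CfgE m n N → ℂ) (x : CfgE m n N) : ℂ :=
  ∑ α : Fin N, ((∑ i : Fin m, secondDeriv f x (eY m n N α i)) +
    (∑ j : Fin n, secondDeriv f x (eZ m n N α j)))

/-- The Laplacian `Δ_x` on `(ℝ^m × 𝕋^n)^N`, computed on the periodic unfolding. -/
def lap (m n N : ℕ) (φ : Cfg m n N → ℂ) : Cfg m n N → ℂ :=
  fun x => laplacianE m n N (φ ∘ fold m n N) (liftCfg m n N x)

/-- Test functions on `(ℝ^m × 𝕋^n)^N`: smooth (periodically unfolded) and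
compactly supported. -/
def IsTest (m n N : ℕ) (φ : Cfg m n N → ℂ) : Prop :=
  ContDiff ℝ (⊤ : ℕ∞) (φ ∘ fold m n N) ∧ HasCompactSupport φ

/-- `U` is the propagator `e^{-itH}` of `i∂_t u + H u = 0`, `H = Δ_x - W`, i.e.
a unitary group solving the equation in the weak (distributional) sense. -/
structure IsPropagator (m n N : ℕ) (W : Cfg m n N → ℝ)
    (U : ℝ → L2 m n N →L[ℂ] L2 m n N) : Prop where
  unitary : ∀ (t : ℝ) (f : L2 m n N), ‖U t f‖ = ‖f‖
  init : U 0 = ContinuousLinearMap.id ℂ (L2 m n N)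
  group : ∀ s t : ℝ, U (s + t) = (U s).comp (U t)
  weak : ∀ (u0 : L2 m n N) (φ : Cfg m n N → ℂ), IsTest m n N φ → ∀ t : ℝ,
    HasDerivAt (fun s : ℝ => ∫ x : Cfg m n N, φ x * (U s u0) x)
      (Complex.I * ∫ x : Cfg m n N,
        (lap m n N φ x - (W x : ℂ) * φ x) * (U t u0) x) t

/-- The total interaction potential `∑_{α<β} V(x_α - x_β)`. -/
def pairPot (m n N : ℕ) (V : Wg m n → ℝ) : Cfg m n N → ℝ :=
  fun x => ∑ p ∈ Finset.univ.filter (fun p : Fin N × Fin N => p.1 < p.2),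
    V (x p.1 - x p.2)

/-- The `L^p` functional (`p = ∞` included) of an `ℝ≥0∞`-valued function. -/
def eN {α : Type*} [MeasurableSpace α] (p : ℝ≥0∞) (μ : Measure α)
    (f : α → ℝ≥0∞) : ℝ≥0∞ :=
  if p = ∞ then essSup f μ else (∫⁻ a, f a ^ p.toReal ∂μ) ^ (1 / p.toReal)

/-- The decreasing rearrangement of an `ℝ≥0∞`-valued function. -/
def rearr {α : Type*} [MeasurableSpace α] (μ : Measure α) (f : α → ℝ≥0∞)
    (t : ℝ≥0∞) : ℝ≥0∞ :=
  sInf {lam : ℝ≥0∞ | μ {x | lam < f x} ≤ t}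

/-- The Lorentz `L^{r,s}` (quasi-)norm of an `ℝ≥0∞`-valued function. -/
def lorentz {α : Type*} [MeasurableSpace α] (r s : ℝ≥0∞) (μ : Measure α)
    (f : α → ℝ≥0∞) : ℝ≥0∞ :=
  if s = ∞ then ⨆ t : ℝ≥0∞, t ^ (1 / r.toReal) * rearr μ f t
  else (∫⁻ t in Set.Ioi (0:ℝ),
      (ENNReal.ofReal t ^ (1 / r.toReal) * rearr μ f (ENNReal.ofReal t)) ^ s.toReal /
        ENNReal.ofReal t) ^ (1 / s.toReal)

/-- `‖V‖_{L^{r,∞}_y L^2_z}` of a potential `V` on `ℝ^m × 𝕋^n`. -/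
def potNorm (m n : ℕ) (r : ℝ≥0∞) (V : Wg m n → ℝ) : ℝ≥0∞ :=
  lorentz r ∞ volume (fun y : Fin m → ℝ =>
    eLpNorm (fun z : Torus n => V (y, z)) 2 volume)

/-- The space of the remaining `N-1` particles `x̂_α`. -/
abbrev Hat (m n N : ℕ) (α : Fin N) := {β : Fin N // β ≠ α} → Wg m n

/-- Reassembling a configuration from the `α`-th particle and the others. -/
def glue (m n N : ℕ) (α : Fin N) (w : Wg m n) (h : Hat m n N α) : Cfg m n N :=
  fun β => if hβ : β = α then w else h ⟨β, hβ⟩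

/-- The mixed norm `L^q_t L^{r,s}_{y_α} L^2_{z_α} L^2_{x̂_α}` (Lorentz in `y_α`). -/
def frozenNormL {m n N : ℕ} (q r s : ℝ≥0∞) (α : Fin N)
    (u : ℝ → Cfg m n N → ℂ) : ℝ≥0∞ :=
  eN q volume fun t =>
    lorentz r s volume fun yα : Fin m → ℝ =>
      eN 2 volume fun zα : Torus n =>
        eLpNorm (fun h : Hat m n N α => u t (glue m n N α (yα, zα) h)) 2 volume

/-- The mixed norm `L^q_t L^r_{y_α} L^2_{z_α} L^2_{x̂_α}`. -/
def frozenNorm {m n N : ℕ} (q r : ℝ≥0∞) (α : Fin N)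
    (u : ℝ → Cfg m n N → ℂ) : ℝ≥0∞ :=
  eN q volume fun t =>
    eN r volume fun yα : Fin m → ℝ =>
      eN 2 volume fun zα : Torus n =>
        eLpNorm (fun h : Hat m n N α => u t (glue m n N α (yα, zα) h)) 2 volume

/-- The spatial mixed norm `L^r_{y_α} L^2_{z_α} L^2_{x̂_α}`. -/
def frozenSpatial {m n N : ℕ} (r : ℝ≥0∞) (α : Fin N)
    (u : Cfg m n N → ℂ) : ℝ≥0∞ :=
  eN r volume fun yα : Fin m → ℝ =>
    eN 2 volume fun zα : Torus n =>
      eLpNorm (fun h : Hat m n N α => u (glue m n N α (yα, zα) h)) 2 volume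

/-- The mixed norm `L^q_t L^r_y L^2_z`, `y ∈ ℝ^{mN}` and `z ∈ 𝕋^{nN}` being the
full Euclidean resp. torus variables. -/
def fullNorm {m n N : ℕ} (q r : ℝ≥0∞) (u : ℝ → Cfg m n N → ℂ) : ℝ≥0∞ :=
  eN q volume fun t =>
    eN r volume fun Y : Fin N → Fin m → ℝ =>
      eLpNorm (fun Z : Fin N → Torus n => u t (fun β => (Y β, Z β))) 2 volume

/-- `(q, r)` is a `k`-dimensional (Strichartz) admissible pair. -/
def Admissible (k : ℕ) (q r : ℝ≥0∞) : Prop :=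
  2 ≤ q ∧ 2 ≤ r ∧ 2 / q + (k : ℝ≥0∞) / r = (k : ℝ≥0∞) / 2 ∧
    ¬(q = 2 ∧ r = ∞ ∧ k = 2)

/-- The Koch–Tataru `V^p`-norm of a curve `u : ℝ → L²_x`, adapted to the free
propagator `U0 = e^{itΔ_x}`: the supremum over all finite increasing sequences
`t_0 < ⋯ < t_J` of `(∑_j ‖e^{-it_jΔ}u(t_j) - e^{-it_{j-1}Δ}u(t_{j-1})‖^p)^{1/p}`. -/
def vpNorm {m n N : ℕ} (p : ℝ) (U0 : ℝ → L2 m n N →L[ℂ] L2 m n N)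
    (u : ℝ → L2 m n N) : ℝ≥0∞ :=
  ⨆ (J : ℕ) (t : Fin (J + 1) → ℝ) (_ : StrictMono t),
    (∑ j : Fin J,
      (‖U0 (-(t j.succ)) (u (t j.succ)) -
        U0 (-(t j.castSucc)) (u (t j.castSucc))‖₊ : ℝ≥0∞) ^ p) ^ (1 / p)

/-- The Duhamel (retarded) integral `∫_0^t U(t-s) F(s) ds`, as a space-time
function. -/
def duhamel {m n N : ℕ} (U0 : ℝ → L2 m n N →L[ℂ] L2 m n N)
    (F : ℝ → L2 m n N) : ℝ → Cfg m n N → ℂ :=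
  fun t x => (∫ s in (0:ℝ)..t, U0 (t - s) (F s)) x

end ManyBodyWaveguide

namespace KT
set_option linter.unusedSectionVars false
open Set

/-- Cauchy-Schwarz for lower integrals. -/
lemma lintegral_mul_cs {α : Type*} [MeasurableSpace α] (μ : Measure α) {f g : α → ℝ≥0∞}
    (hf : AEMeasurable f μ) (hg : AEMeasurable g μ) :
    ∫⁻ a, f a * g a ∂μ ≤
      (∫⁻ a, f a ^ 2 ∂μ) ^ (1 / 2 : ℝ) * (∫⁻ a, g a ^ 2 ∂μ) ^ (1 / 2 : ℝ) := by
  have h := ENNReal.lintegral_mul_le_Lp_mul_Lq μ Real.HolderConjugate.two_two hf hg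
  simpa [Pi.mul_apply] using h

lemma lintegral_conv_left (c w : ℝ → ℝ≥0∞) (hc : Measurable c) (hw : Measurable w) :
    ∫⁻ p : ℝ × ℝ, c p.1 * w (p.2 - p.1) = (∫⁻ s, c s) * ∫⁻ s, w s := by
  rw [Measure.volume_eq_prod, lintegral_prod _ (by fun_prop)]
  have h0 : ∀ x : ℝ, ∫⁻ y : ℝ, c x * w (y - x) = c x * ∫⁻ y : ℝ, w (y - x) := fun x =>
    lintegral_const_mul _ (hw.comp (measurable_id.sub_const _))
  simp_rw [h0]
  have : ∀ x : ℝ, ∫⁻ y : ℝ, w (y - x) = ∫⁻ y, w y := fun x =>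
    lintegral_sub_right_eq_self (fun y => w y) x
  simp_rw [this]
  rw [lintegral_mul_const _ hc]

lemma lintegral_conv_right (d w : ℝ → ℝ≥0∞) (hd : Measurable d) (hw : Measurable w) :
    ∫⁻ p : ℝ × ℝ, d p.2 * w (p.2 - p.1) = (∫⁻ s, d s) * ∫⁻ s, w s := by
  rw [Measure.volume_eq_prod, lintegral_prod_symm _ (by fun_prop)]
  have h0 : ∀ x : ℝ, ∫⁻ y : ℝ, d x * w (x - y) = d x * ∫⁻ y : ℝ, w (x - y) := fun x =>
    lintegral_const_mul _ (hw.comp (measurable_id.const_sub _))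
  simp_rw [h0]
  have : ∀ x : ℝ, ∫⁻ y : ℝ, w (x - y) = ∫⁻ y, w y := fun x =>
    lintegral_sub_left_eq_self (fun y => w y) x
  simp_rw [this]
  rw [lintegral_mul_const _ hd]

/-- Schur test for convolution kernels. -/
lemma schur (c d w : ℝ → ℝ≥0∞) (hc : Measurable c) (hd : Measurable d) (hw : Measurable w) :
    ∫⁻ t, ∫⁻ s, c s * d t * w (t - s) ≤
      (∫⁻ s, w s) * ((∫⁻ s, c s ^ 2) ^ (1 / 2 : ℝ) * (∫⁻ s, d s ^ 2) ^ (1 / 2 : ℝ)) := by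
  have e1 : ∫⁻ t, ∫⁻ s, c s * d t * w (t - s) =
      ∫⁻ p : ℝ × ℝ, (c p.1 * w (p.2 - p.1) ^ (1 / 2 : ℝ)) *
        (d p.2 * w (p.2 - p.1) ^ (1 / 2 : ℝ)) := by
    rw [Measure.volume_eq_prod, lintegral_prod_symm _ (by fun_prop)]
    refine lintegral_congr fun t => lintegral_congr fun s => ?_
    have : w (t - s) = w (t - s) ^ (1 / 2 : ℝ) * w (t - s) ^ (1 / 2 : ℝ) := by
      rw [← ENNReal.rpow_add_of_nonneg _ _ (by norm_num) (by norm_num)]; norm_num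
    conv_lhs => rw [this]
    ring
  have sq : ∀ x : ℝ≥0∞, (x ^ (1 / 2 : ℝ)) ^ 2 = x := fun x => by
    rw [← ENNReal.rpow_natCast, ← ENNReal.rpow_mul]; norm_num
  rw [e1]
  refine (lintegral_mul_cs _ (by fun_prop) (by fun_prop)).trans (le_of_eq ?_)
  simp_rw [mul_pow, sq]
  rw [lintegral_conv_left (fun s => c s ^ 2) w (by fun_prop) hw,
    lintegral_conv_right (fun s => d s ^ 2) w (by fun_prop) hw,
    ENNReal.mul_rpow_of_nonneg _ _ (by norm_num), ENNReal.mul_rpow_of_nonneg _ _ (by norm_num)]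
  have : (∫⁻ s, w s) = (∫⁻ s, w s) ^ (1 / 2 : ℝ) * (∫⁻ s, w s) ^ (1 / 2 : ℝ) := by
    rw [← ENNReal.rpow_add_of_nonneg _ _ (by norm_num) (by norm_num)]; norm_num
  conv_rhs => rw [this]
  ring

variable {E : Type*} [NormedAddCommGroup E] [InnerProductSpace ℂ E] [CompleteSpace E]

open scoped InnerProductSpace

lemma inner_integral_left {f : ℝ → E} {μ : Measure ℝ} (hf : Integrable f μ) (x : E) :
    ⟪∫ s, f s ∂μ, x⟫_ℂ = ∫ s, ⟪f s, x⟫_ℂ ∂μ := by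
  rw [← inner_conj_symm, ← integral_inner hf, ← integral_conj]
  simp

lemma inner_integral_enorm_le {f : ℝ → E} {μ : Measure ℝ} (x : E) :
    ‖⟪∫ s, f s ∂μ, x⟫_ℂ‖ₑ ≤ ∫⁻ s, ‖⟪f s, x⟫_ℂ‖ₑ ∂μ := by
  by_cases hf : Integrable f μ
  · rw [inner_integral_left hf]
    exact enorm_integral_le_lintegral_enorm _
  · rw [integral_undef hf]; simp

lemma inner_integral_enorm_le' {f : ℝ → E} {μ : Measure ℝ} (x : E) :
    ‖⟪x, ∫ s, f s ∂μ⟫_ℂ‖ₑ ≤ ∫⁻ s, ‖⟪x, f s⟫_ℂ‖ₑ ∂μ := by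
  by_cases hf : Integrable f μ
  · rw [← integral_inner hf]
    exact enorm_integral_le_lintegral_enorm _
  · rw [integral_undef hf]; simp

lemma enorm_sq_eq (x : E) : ‖x‖ₑ ^ 2 = ‖⟪x, x⟫_ℂ‖ₑ := by
  have h : ‖⟪x, x⟫_ℂ‖ = ‖x‖ ^ 2 := by
    rw [inner_self_eq_norm_sq_to_K]; simp
  rw [← ofReal_norm, ← ofReal_norm, h, ENNReal.ofReal_pow (norm_nonneg _)]

/-- Energy estimate through the `TT*` kernel. -/
lemma energy (f : ℝ → E) (c w : ℝ → ℝ≥0∞) (hc : Measurable c) (hw : Measurable w)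
    (hb : ∀ s t, s ≠ t → ‖⟪f s, f t⟫_ℂ‖ₑ ≤ c s * c t * w (t - s)) (J : Set ℝ)
    (hJ : MeasurableSet J) :
    ‖∫ s in J, f s‖ₑ ^ 2 ≤ (∫⁻ s, w s) * ∫⁻ s in J, c s ^ 2 := by
  rw [enorm_sq_eq]
  calc ‖⟪∫ s in J, f s, ∫ s in J, f s⟫_ℂ‖ₑ
      ≤ ∫⁻ t in J, ‖⟪∫ s in J, f s, f t⟫_ℂ‖ₑ := inner_integral_enorm_le' _
    _ ≤ ∫⁻ t in J, ∫⁻ s in J, ‖⟪f s, f t⟫_ℂ‖ₑ := lintegral_mono fun t => inner_integral_enorm_le _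
    _ ≤ ∫⁻ t in J, ∫⁻ s in J, c s * c t * w (t - s) := by
        refine lintegral_mono fun t => lintegral_mono_ae ?_
        have : ∀ᵐ s ∂(volume.restrict J), s ≠ t :=
          ae_restrict_of_ae (by simp [ae_iff])
        filter_upwards [this] with s hs using hb s t hs
    _ = ∫⁻ t, ∫⁻ s, J.indicator c s * J.indicator c t * w (t - s) := by
        rw [← lintegral_indicator hJ]
        refine lintegral_congr fun t => ?_
        by_cases ht : t ∈ J
        · simp only [indicator_of_mem ht]
          rw [← lintegral_indicator hJ]
          refine lintegral_congr fun s => ?_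
          by_cases hs : s ∈ J <;> simp [hs]
        · simp [ht]
    _ ≤ _ := by
        refine (schur _ _ _ (hc.indicator hJ) (hc.indicator hJ) hw).trans (le_of_eq ?_)
        rw [← ENNReal.rpow_add_of_nonneg _ _ (by norm_num) (by norm_num)]
        norm_num
        congr 1
        rw [← lintegral_indicator hJ]
        refine lintegral_congr fun s => ?_
        by_cases hs : s ∈ J <;> simp [hs]

lemma aem_window (T : ℝ) (c : ℝ → ℝ≥0∞) (hc : Measurable c) :
    Measurable fun t : ℝ => ∫⁻ s in Ioo (t - T) t, c s := by
  have : (fun t : ℝ => ∫⁻ s in Ioo (t - T) t, c s) =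
      fun t => ∫⁻ s, c s * (Ioo (0:ℝ) T).indicator 1 (t - s) := by
    funext t
    rw [← lintegral_indicator measurableSet_Ioo]
    refine lintegral_congr fun s => ?_
    by_cases h : s ∈ Ioo (t - T) t
    · rw [indicator_of_mem h, indicator_of_mem]
      · simp
      · simp only [mem_Ioo] at h ⊢; constructor <;> linarith
    · rw [indicator_of_notMem h, indicator_of_notMem]
      · simp
      · simp only [mem_Ioo] at h ⊢; intro h2; apply h; constructor <;> linarith
  rw [this]
  have hi : Measurable ((Ioo (0:ℝ) T).indicator (1 : ℝ → ℝ≥0∞)) :=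
    measurable_one.indicator measurableSet_Ioo
  refine Measurable.lintegral_prod_right' (f := fun p : ℝ × ℝ =>
    c p.2 * (Ioo (0:ℝ) T).indicator 1 (p.1 - p.2)) ?_
  exact (hc.comp measurable_snd).mul (hi.comp (measurable_fst.sub measurable_snd))

lemma window_total (T : ℝ) (c : ℝ → ℝ≥0∞) (hc : Measurable c) :
    ∫⁻ t, ∫⁻ s in Ioo (t - T) t, c s = (∫⁻ s, c s) * ENNReal.ofReal T := by
  have hi : Measurable ((Ioo (0:ℝ) T).indicator (1 : ℝ → ℝ≥0∞)) :=
    measurable_one.indicator measurableSet_Ioo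
  have h := lintegral_conv_left c _ hc hi
  have hm : Measurable fun p : ℝ × ℝ => c p.1 * (Ioo (0:ℝ) T).indicator 1 (p.2 - p.1) :=
    (hc.comp measurable_fst).mul (hi.comp (measurable_snd.sub measurable_fst))
  rw [Measure.volume_eq_prod, lintegral_prod_symm _ hm.aemeasurable] at h
  have e : ∫⁻ s, (Ioo (0:ℝ) T).indicator (1 : ℝ → ℝ≥0∞) s = ENNReal.ofReal T := by
    rw [lintegral_indicator_one measurableSet_Ioo]; simp
  rw [e] at h
  rw [← h]
  refine lintegral_congr fun t => ?_
  rw [← lintegral_indicator measurableSet_Ioo]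
  refine lintegral_congr fun s => ?_
  by_cases h : s ∈ Ioo (t - T) t
  · rw [indicator_of_mem h, indicator_of_mem]
    · simp
    · simp only [mem_Ioo] at h ⊢; constructor <;> linarith
  · rw [indicator_of_notMem h, indicator_of_notMem]
    · simp
    · simp only [mem_Ioo] at h ⊢; intro h2; apply h; constructor <;> linarith

/-- The near-diagonal part of the retarded form. -/
lemma near_part (f g : ℝ → E) (c d : ℝ → ℝ≥0∞) (hc : Measurable c) (hd : Measurable d)
    (W b : ℝ≥0∞) (T : ℝ)
    (hen : ∀ J : Set ℝ, MeasurableSet J → ‖∫ s in J, f s‖ₑ ^ 2 ≤ W * ∫⁻ s in J, c s ^ 2)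
    (hg : ∀ t, ‖g t‖ₑ ≤ b * d t) :
    ∫⁻ t, ‖⟪∫ s in Ioo (t - T) t, f s, g t⟫_ℂ‖ₑ ≤
      (W ^ (1 / 2 : ℝ) * b * ENNReal.ofReal T ^ (1 / 2 : ℝ)) *
        ((∫⁻ s, c s ^ 2) ^ (1 / 2 : ℝ) * (∫⁻ s, d s ^ 2) ^ (1 / 2 : ℝ)) := by
  have hwin := aem_window T (fun s => c s ^ 2) (by fun_prop)
  have sq : ∀ x : ℝ≥0∞, (x ^ (1 / 2 : ℝ)) ^ 2 = x := fun x => by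
    rw [← ENNReal.rpow_natCast, ← ENNReal.rpow_mul]; norm_num
  have sq' : ∀ x : ℝ≥0∞, (x ^ 2) ^ (1 / 2 : ℝ) = x := fun x => by
    rw [← ENNReal.rpow_natCast, ← ENNReal.rpow_mul]; norm_num
  calc ∫⁻ t, ‖⟪∫ s in Ioo (t - T) t, f s, g t⟫_ℂ‖ₑ
      ≤ ∫⁻ t, (W ^ (1 / 2 : ℝ) * b) *
          ((∫⁻ s in Ioo (t - T) t, c s ^ 2) ^ (1 / 2 : ℝ) * d t) := by
        refine lintegral_mono fun t => ?_
        have h1 : ‖∫ s in Ioo (t - T) t, f s‖ₑ ≤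
            W ^ (1 / 2 : ℝ) * (∫⁻ s in Ioo (t - T) t, c s ^ 2) ^ (1 / 2 : ℝ) := by
          rw [← ENNReal.mul_rpow_of_nonneg _ _ (by norm_num), ← sq' ‖_‖ₑ]
          exact ENNReal.rpow_le_rpow (hen _ measurableSet_Ioo) (by norm_num)
        have h2 : ‖⟪∫ s in Ioo (t - T) t, f s, g t⟫_ℂ‖ₑ ≤
            ‖∫ s in Ioo (t - T) t, f s‖ₑ * ‖g t‖ₑ := by
          simp only [← ofReal_norm]
          rw [← ENNReal.ofReal_mul (norm_nonneg _)]
          exact ENNReal.ofReal_le_ofReal (norm_inner_le_norm _ _)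
        refine h2.trans ((mul_le_mul' h1 (hg t)).trans (le_of_eq ?_))
        ring
    _ = (W ^ (1 / 2 : ℝ) * b) * ∫⁻ t,
          ((∫⁻ s in Ioo (t - T) t, c s ^ 2) ^ (1 / 2 : ℝ) * d t) := by
        rw [lintegral_const_mul _ (by fun_prop)]
    _ ≤ (W ^ (1 / 2 : ℝ) * b) *
          (((∫⁻ s, c s ^ 2) * ENNReal.ofReal T) ^ (1 / 2 : ℝ) *
            (∫⁻ s, d s ^ 2) ^ (1 / 2 : ℝ)) := by
        gcongr
        refine (lintegral_mul_cs _ (hwin.pow_const _).aemeasurable hd.aemeasurable).trans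
          (le_of_eq ?_)
        simp_rw [sq]
        rw [window_total _ _ (by fun_prop)]
    _ = _ := by
        rw [ENNReal.mul_rpow_of_nonneg _ _ (by norm_num)]
        ring

/-- The far part of the retarded form. -/
lemma far_part (f g : ℝ → E) (c d w : ℝ → ℝ≥0∞) (hc : Measurable c) (hd : Measurable d)
    (hw : Measurable w) (T : ℝ) (hT : 0 < T)
    (hb : ∀ s t, s ≠ t → ‖⟪f s, g t⟫_ℂ‖ₑ ≤ c s * d t * w (t - s)) :
    ∫⁻ t, ‖⟪∫ s in Iic (t - T), f s, g t⟫_ℂ‖ₑ ≤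
      (∫⁻ s in Ici T, w s) *
        ((∫⁻ s, c s ^ 2) ^ (1 / 2 : ℝ) * (∫⁻ s, d s ^ 2) ^ (1 / 2 : ℝ)) := by
  rw [← lintegral_indicator measurableSet_Ici]
  refine le_trans ?_ (schur c d _ hc hd (hw.indicator measurableSet_Ici))
  refine lintegral_mono fun t => (inner_integral_enorm_le _).trans ?_
  rw [← lintegral_indicator measurableSet_Iic]
  refine lintegral_mono fun s => ?_
  by_cases h : s ∈ Iic (t - T)
  · have h' : t - s ∈ Ici T := by simp only [mem_Iic, mem_Ici] at h ⊢; linarith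
    rw [indicator_of_mem h, indicator_of_mem h']
    refine hb s t ?_
    simp only [mem_Iic] at h
    intro h2; linarith
  · rw [indicator_of_notMem h]; exact zero_le

/-- ordered Fubini -/
lemma ordered_fubini {f g : ℝ → E} (hf : Integrable f) (hg : Integrable g) :
    ∫ t, ⟪∫ s in Iio t, f s, g t⟫_ℂ = ∫ s, ⟪f s, ∫ t in Ioi s, g t⟫_ℂ := by
  have hS : MeasurableSet {p : ℝ × ℝ | p.1 < p.2} := measurableSet_lt measurable_fst measurable_snd
  have hInt : Integrable (Function.uncurry fun s t : ℝ =>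
      {p : ℝ × ℝ | p.1 < p.2}.indicator (fun p : ℝ × ℝ => ⟪f p.1, g p.2⟫_ℂ) (s, t))
      (volume.prod volume) := by
    refine Integrable.indicator (f := fun p : ℝ × ℝ => ⟪f p.1, g p.2⟫_ℂ) ?_ hS
    refine Integrable.mono' (hf.norm.mul_prod hg.norm) ?_ ?_
    · exact hf.aestronglyMeasurable.comp_fst.inner hg.aestronglyMeasurable.comp_snd
    · exact Filter.Eventually.of_forall fun p => norm_inner_le_norm _ _
  have key := integral_integral_swap hInt
  have e1 : ∀ t, ⟪∫ s in Iio t, f s, g t⟫_ℂ = ∫ s,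
      {p : ℝ × ℝ | p.1 < p.2}.indicator (fun p : ℝ × ℝ => ⟪f p.1, g p.2⟫_ℂ) (s, t) := by
    intro t
    rw [inner_integral_left hf.restrict, ← integral_indicator measurableSet_Iio]
    refine integral_congr_ae (Filter.Eventually.of_forall fun s => ?_)
    simp [indicator]
  have e2 : ∀ s, ⟪f s, ∫ t in Ioi s, g t⟫_ℂ = ∫ t,
      {p : ℝ × ℝ | p.1 < p.2}.indicator (fun p : ℝ × ℝ => ⟪f p.1, g p.2⟫_ℂ) (s, t) := by
    intro s
    rw [← integral_inner hg.restrict, ← integral_indicator measurableSet_Ioi]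
    refine integral_congr_ae (Filter.Eventually.of_forall fun t => ?_)
    simp [indicator]
  simp_rw [e1, e2]
  exact key.symm

/-- The retarded bilinear form. -/
def ret (f g : ℝ → E) : ℂ := ∫ t, ⟪∫ s in Iio t, f s, g t⟫_ℂ

lemma ret_bound (f g : ℝ → E) (hf : Integrable f) (hgi : Integrable g) (c d w : ℝ → ℝ≥0∞) (hc : Measurable c)
    (hd : Measurable d)
    (hw : Measurable w) (T : ℝ) (hT : 0 < T) (W b : ℝ≥0∞)
    (hen : ∀ J : Set ℝ, MeasurableSet J → ‖∫ s in J, f s‖ₑ ^ 2 ≤ W * ∫⁻ s in J, c s ^ 2)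
    (hg : ∀ t, ‖g t‖ₑ ≤ b * d t)
    (hb : ∀ s t, s ≠ t → ‖⟪f s, g t⟫_ℂ‖ₑ ≤ c s * d t * w (t - s)) :
    ‖ret f g‖ₑ ≤ (W ^ (1 / 2 : ℝ) * b * ENNReal.ofReal T ^ (1 / 2 : ℝ) + ∫⁻ s in Ici T, w s) *
        ((∫⁻ s, c s ^ 2) ^ (1 / 2 : ℝ) * (∫⁻ s, d s ^ 2) ^ (1 / 2 : ℝ)) := by
  rw [add_mul]
  refine le_trans ?_ (add_le_add (near_part f g c d hc hd W b T hen hg)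
    (far_part f g c d w hc hd hw T hT hb))
  unfold ret
  have hsplit : ∀ t, ⟪∫ s in Iio t, f s, g t⟫_ℂ =
      ⟪∫ s in Ioo (t - T) t, f s, g t⟫_ℂ + ⟪∫ s in Iic (t - T), f s, g t⟫_ℂ := by
    intro t
    rw [← inner_add_left, ← setIntegral_union ?_ measurableSet_Iic hf.integrableOn hf.integrableOn]
    · congr 3
      ext x
      simp only [mem_Iio, mem_union, mem_Ioo, mem_Iic]
      constructor
      · intro h; by_cases h2 : t - T < x
        · exact Or.inl ⟨h2, h⟩
        · exact Or.inr (not_lt.mp h2)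
      · rintro (h | h)
        · exact h.2
        · linarith
    · rw [Set.disjoint_left]; intro x hx hx'; simp at hx hx'; linarith
  refine (enorm_integral_le_lintegral_enorm _).trans ?_
  have : ∀ t, ‖⟪∫ s in Iio t, f s, g t⟫_ℂ‖ₑ ≤
      ‖⟪∫ s in Ioo (t - T) t, f s, g t⟫_ℂ‖ₑ + ‖⟪∫ s in Iic (t - T), f s, g t⟫_ℂ‖ₑ := by
    intro t; rw [hsplit t]; exact enorm_add_le _ _
  refine (lintegral_mono this).trans ?_
  have hcont : Continuous fun t => ∫ s in Ioo (t - T) t, f s := by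
    have e : (fun t => ∫ s in Ioo (t - T) t, f s) =
        fun t => (∫ s in (0:ℝ)..t, f s) - ∫ s in (0:ℝ)..(t - T), f s := by
      funext t
      rw [intervalIntegral.integral_interval_sub_left hf.intervalIntegrable hf.intervalIntegrable,
        intervalIntegral.integral_of_le (by linarith), integral_Ioc_eq_integral_Ioo]
    rw [e]
    have h0 := intervalIntegral.continuous_primitive (fun a b => hf.intervalIntegrable (a := a)
      (b := b)) 0
    exact h0.sub (h0.comp (continuous_id.sub continuous_const))
  have hm : AEMeasurable (fun t => ‖⟪∫ s in Ioo (t - T) t, f s, g t⟫_ℂ‖ₑ) volume :=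
    (hcont.aestronglyMeasurable.inner hgi.aestronglyMeasurable).enorm
  exact le_of_eq (lintegral_add_left' hm _)

end KT

namespace KT
set_option linter.unusedSectionVars false
open Set

variable {E : Type*} [NormedAddCommGroup E] [InnerProductSpace ℂ E] [CompleteSpace E]

lemma ret_reverse {f g : ℝ → E} (hf : Integrable f) (hg : Integrable g) :
    ret f g = (starRingEnd ℂ) (ret (fun s => g (-s)) (fun s => f (-s))) := by
  unfold ret
  rw [ordered_fubini hf hg, ← integral_conj]
  rw [← integral_neg_eq_self]
  refine integral_congr_ae (Filter.Eventually.of_forall fun t => ?_)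
  simp only
  rw [inner_conj_symm]
  congr 1
  rw [← integral_Iic_eq_integral_Iio, integral_comp_neg_Iic t g]

lemma lintegral_tail (μ T : ℝ) (hμ : 1 < μ) (hT : 0 < T) :
    ∫⁻ s in Ici T, ENNReal.ofReal (|s| ^ (-μ)) = ENNReal.ofReal (T ^ (1 - μ) / (μ - 1)) := by
  have e : ∫⁻ s in Ici T, ENNReal.ofReal (|s| ^ (-μ)) = ∫⁻ s in Ioi T, ENNReal.ofReal (s ^ (-μ)) := by
    rw [setLIntegral_congr Ioi_ae_eq_Ici.symm]
    refine setLIntegral_congr_fun measurableSet_Ioi fun s hs => ?_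
    rw [abs_of_pos (hT.trans hs)]
  rw [e, ← ofReal_integral_eq_lintegral_ofReal (integrableOn_Ioi_rpow_of_lt (by linarith) hT),
    integral_Ioi_rpow_of_lt (by linarith) hT]
  · congr 1
    have : -μ + 1 = -(μ - 1) := by ring
    rw [this, show 1 - μ = -(μ - 1) by ring, neg_div_neg_eq]
  · refine (ae_restrict_iff' measurableSet_Ioi).2 (Filter.Eventually.of_forall fun s hs => ?_)
    exact Real.rpow_nonneg (hT.trans hs).le _

lemma lintegral_tail_neg (μ T : ℝ) (hμ : 1 < μ) (hT : 0 < T) :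
    ∫⁻ s in Iic (-T), ENNReal.ofReal (|s| ^ (-μ)) = ENNReal.ofReal (T ^ (1 - μ) / (μ - 1)) := by
  rw [← lintegral_tail μ T hμ hT, ← lintegral_indicator measurableSet_Iic,
    ← lintegral_indicator measurableSet_Ici, ← lintegral_neg_eq_self]
  refine lintegral_congr fun s => ?_
  simp only [indicator, mem_Iic, mem_Ici, neg_le_neg_iff, abs_neg]

/-- energy kernel at level `k` -/
def enKer (K μ k : ℝ) (s : ℝ) : ℝ≥0∞ :=
  if |s| < 2 ^ k then ENNReal.ofReal ((2:ℝ) ^ (-k))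
  else ENNReal.ofReal (K * (2:ℝ) ^ ((μ - 1) * k)) * ENNReal.ofReal (|s| ^ (-μ))

lemma enKer_meas (K μ k : ℝ) : Measurable (enKer K μ k) := by
  unfold enKer
  refine Measurable.ite ?_ (by fun_prop) (by fun_prop)
  exact measurableSet_lt (by fun_prop) (by fun_prop)

lemma enKer_int (K μ k : ℝ) (hμ : 1 < μ) (hK : 0 ≤ K) :
    ∫⁻ s, enKer K μ k s ≤ ENNReal.ofReal (2 * (1 + K / (μ - 1))) := by
  have h2 : (0:ℝ) < 2 ^ k := by positivity
  set A : ℝ≥0∞ := ENNReal.ofReal (K * (2:ℝ) ^ ((μ - 1) * k)) with hA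
  have hle : ∀ s, enKer K μ k s ≤ (Ioo (-(2:ℝ) ^ k) (2 ^ k)).indicator
      (fun _ => ENNReal.ofReal ((2:ℝ) ^ (-k))) s +
      ((Ici ((2:ℝ) ^ k)).indicator (fun s => A * ENNReal.ofReal (|s| ^ (-μ))) s +
       (Iic (-(2:ℝ) ^ k)).indicator (fun s => A * ENNReal.ofReal (|s| ^ (-μ))) s) := by
    intro s
    unfold enKer
    split_ifs with h
    · rw [indicator_of_mem (by rw [mem_Ioo]; exact abs_lt.mp h)]
      exact le_self_add
    · rw [not_lt, le_abs] at h
      rcases h with h | h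
      · rw [indicator_of_mem (s := Ici _) (by exact h)]
        exact le_add_left le_self_add
      · rw [indicator_of_mem (s := Iic _) (by rw [mem_Iic]; linarith)]
        exact le_add_left (le_add_left le_rfl)
  refine (lintegral_mono hle).trans ?_
  rw [lintegral_add_left (measurable_const.indicator measurableSet_Ioo),
    lintegral_add_left (by apply Measurable.indicator (by fun_prop) measurableSet_Ici),
    lintegral_indicator measurableSet_Ioo, lintegral_indicator measurableSet_Ici,
    lintegral_indicator measurableSet_Iic, lintegral_const_mul _ (by fun_prop),
    lintegral_const_mul _ (by fun_prop), lintegral_tail _ _ hμ h2, lintegral_tail_neg _ _ hμ h2,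
    setLIntegral_const, Real.volume_Ioo, hA, ← ENNReal.ofReal_mul (by positivity),
    ← ENNReal.ofReal_mul (by positivity)]
  have hp : 0 < μ - 1 := by linarith
  rw [← ENNReal.ofReal_add (by positivity) (by positivity),
    ← ENNReal.ofReal_add ?_ (by positivity)]
  swap
  · have : (0:ℝ) ≤ 2 ^ k - -2 ^ k := by linarith
    positivity
  apply ENNReal.ofReal_le_ofReal
  have e1 : (2:ℝ) ^ (-k) * (2 ^ k - -2 ^ k) = 2 := by
    rw [Real.rpow_neg (by norm_num)]; field_simp; ring
  have e2 : (2:ℝ) ^ ((μ - 1) * k) * ((2:ℝ) ^ k) ^ (1 - μ) = 1 := by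
    rw [← Real.rpow_mul (by norm_num), ← Real.rpow_add (by norm_num)]
    ring_nf; simp
  rw [e1]
  have e3 : K * (2:ℝ) ^ ((μ - 1) * k) * (((2:ℝ) ^ k) ^ (1 - μ) / (μ - 1)) = K / (μ - 1) := by
    rw [show K * (2:ℝ) ^ ((μ - 1) * k) * (((2:ℝ) ^ k) ^ (1 - μ) / (μ - 1)) =
      K * ((2:ℝ) ^ ((μ - 1) * k) * ((2:ℝ) ^ k) ^ (1 - μ)) / (μ - 1) by ring, e2, mul_one]
  rw [e3]; linarith

/-- pair hypothesis -/
def PB (K μ k l : ℝ) (f g : ℝ → E) (c d : ℝ → ℝ≥0∞) : Prop :=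
  ∀ s t, s ≠ t → ‖inner ℂ (f s) (g t)‖ₑ ≤ c s * d t *
    (ENNReal.ofReal (K * (2:ℝ) ^ ((μ - 1) / 2 * (k + l))) * ENNReal.ofReal (|t - s| ^ (-μ)))

def LB (k : ℝ) (f : ℝ → E) (c : ℝ → ℝ≥0∞) : Prop :=
  ∀ s, ‖f s‖ₑ ≤ ENNReal.ofReal ((2:ℝ) ^ (-k / 2)) * c s

def pairC (K μ : ℝ) : ℝ := 2 * (1 + K / (μ - 1)) + K / (μ - 1)

lemma inner_enorm_le (x y : E) : ‖inner ℂ x y‖ₑ ≤ ‖x‖ₑ * ‖y‖ₑ := by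
  simp only [← ofReal_norm]
  rw [← ENNReal.ofReal_mul (norm_nonneg _)]
  exact ENNReal.ofReal_le_ofReal (norm_inner_le_norm _ _)

lemma pair_energy (K μ k : ℝ) (hμ : 1 < μ) (hK : 0 ≤ K) {f : ℝ → E} {c : ℝ → ℝ≥0∞}
    (hc : Measurable c) (h1 : LB k f c) (h2 : PB K μ k k f f c c) (J : Set ℝ)
    (hJ : MeasurableSet J) :
    ‖∫ s in J, f s‖ₑ ^ 2 ≤ ENNReal.ofReal (2 * (1 + K / (μ - 1))) * ∫⁻ s in J, c s ^ 2 := by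
  refine (energy f c (enKer K μ k) hc (enKer_meas _ _ _) ?_ J hJ).trans ?_
  · intro s t hst
    unfold enKer
    split_ifs with h
    · refine (inner_enorm_le _ _).trans ((mul_le_mul' (h1 s) (h1 t)).trans (le_of_eq ?_))
      have : ENNReal.ofReal ((2:ℝ) ^ (-k)) = ENNReal.ofReal ((2:ℝ) ^ (-k / 2)) *
          ENNReal.ofReal ((2:ℝ) ^ (-k / 2)) := by
        rw [← ENNReal.ofReal_mul (by positivity), ← Real.rpow_add (by norm_num)]
        congr 2; ring
      rw [this]; ring
    · refine (h2 s t hst).trans (le_of_eq ?_)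
      congr 5; ring
  · gcongr; exact enKer_int K μ k hμ hK

lemma pair_le (K μ k l : ℝ) (hμ : 3 / 2 ≤ μ) (hK : 0 ≤ K) (hkl : k ≤ l)
    {f g : ℝ → E} (hf : Integrable f) (hg : Integrable g) {c d : ℝ → ℝ≥0∞}
    (hc : Measurable c) (hd : Measurable d) (h1 : LB k f c) (h2 : LB l g d)
    (h3 : PB K μ k k f f c c) (h4 : PB K μ k l f g c d) :
    ‖ret f g‖ₑ ≤ ENNReal.ofReal (pairC K μ * (2:ℝ) ^ (-|k - l| / 8)) *
      ((∫⁻ s, c s ^ 2) ^ (1 / 2 : ℝ) * (∫⁻ s, d s ^ 2) ^ (1 / 2 : ℝ)) := by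
  have hμ1 : 0 < μ - 1 := by linarith
  have hT : (0:ℝ) < 2 ^ ((k + 3 * l) / 4) := by positivity
  refine (ret_bound f g hf hg c d (fun s => ENNReal.ofReal (K * (2:ℝ) ^ ((μ - 1) / 2 * (k + l))) *
    ENNReal.ofReal (|s| ^ (-μ))) hc hd (by fun_prop) _ hT
    (ENNReal.ofReal (2 * (1 + K / (μ - 1)))) (ENNReal.ofReal ((2:ℝ) ^ (-l / 2)))
    (pair_energy K μ k (by linarith) hK hc h1 h3) h2 h4).trans ?_
  gcongr
  have hQ : 0 ≤ K / (μ - 1) := by positivity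
  rw [lintegral_const_mul _ (by fun_prop), lintegral_tail _ _ (by linarith) hT,
    ENNReal.ofReal_rpow_of_pos (by positivity), ENNReal.ofReal_rpow_of_pos (by positivity),
    ← ENNReal.ofReal_mul (by positivity), ← ENNReal.ofReal_mul (by positivity),
    ← ENNReal.ofReal_mul (by positivity), ← ENNReal.ofReal_add (by positivity) (by positivity)]
  apply ENNReal.ofReal_le_ofReal
  rw [abs_of_nonpos (by linarith), pairC, add_mul]
  apply add_le_add
  · rw [← Real.rpow_mul (by norm_num), mul_assoc, ← Real.rpow_add (by norm_num)]
    apply mul_le_mul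
    · apply (Real.rpow_le_rpow_of_exponent_le (by linarith) (by norm_num : (1/2:ℝ) ≤ 1)).trans
      rw [Real.rpow_one]
    · apply Real.rpow_le_rpow_of_exponent_le (by norm_num)
      linarith
    · positivity
    · positivity
  · rw [show K * (2:ℝ) ^ ((μ - 1) / 2 * (k + l)) * (((2:ℝ) ^ ((k + 3 * l) / 4)) ^ (1 - μ) / (μ - 1)) =
      K / (μ - 1) * ((2:ℝ) ^ ((μ - 1) / 2 * (k + l)) * ((2:ℝ) ^ ((k + 3 * l) / 4)) ^ (1 - μ)) by ring]
    gcongr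
    rw [← Real.rpow_mul (by norm_num), ← Real.rpow_add (by norm_num)]
    apply Real.rpow_le_rpow_of_exponent_le (by norm_num)
    nlinarith

lemma pair_bound (K μ k l : ℝ) (hμ : 3 / 2 ≤ μ) (hK : 0 ≤ K)
    {f g : ℝ → E} (hf : Integrable f) (hg : Integrable g) {c d : ℝ → ℝ≥0∞}
    (hc : Measurable c) (hd : Measurable d) (h1 : LB k f c) (h2 : LB l g d)
    (h3 : PB K μ k k f f c c) (h3' : PB K μ l l g g d d) (h4 : PB K μ k l f g c d) :
    ‖ret f g‖ₑ ≤ ENNReal.ofReal (pairC K μ * (2:ℝ) ^ (-|k - l| / 8)) *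
      ((∫⁻ s, c s ^ 2) ^ (1 / 2 : ℝ) * (∫⁻ s, d s ^ 2) ^ (1 / 2 : ℝ)) := by
  rcases le_total k l with hkl | hkl
  · exact pair_le K μ k l hμ hK hkl hf hg hc hd h1 h2 h3 h4
  · rw [ret_reverse hf hg, RCLike.enorm_conj]
    have := pair_le (E := E) K μ l k hμ hK hkl hg.comp_neg hf.comp_neg
      (hd.comp measurable_neg) (hc.comp measurable_neg) (fun s => h2 (-s)) (fun s => h1 (-s))
      (fun s t hst => ?_) (fun s t hst => ?_)
    · refine this.trans (le_of_eq ?_)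
      simp only [Function.comp]
      rw [abs_sub_comm, lintegral_neg_eq_self (fun s => c s ^ 2), lintegral_neg_eq_self (fun s => d s ^ 2),
        mul_comm ((∫⁻ s, c s ^ 2) ^ (1 / 2 : ℝ))]
    · refine (h3' (-s) (-t) (by simpa using hst)).trans (le_of_eq ?_)
      simp only [Function.comp]
      rw [show -t - -s = s - t by ring, abs_sub_comm]
    · have e := h4 (-t) (-s) (by simpa using hst.symm)
      rw [← inner_conj_symm, RCLike.enorm_conj]
      refine e.trans (le_of_eq ?_)
      simp only [Function.comp]
      rw [show -s - -t = t - s by ring, add_comm k l, mul_comm (c (-t))]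

end KT

namespace KT
set_option linter.unusedSectionVars false
open Set

variable {E : Type*} [NormedAddCommGroup E] [InnerProductSpace ℂ E] [CompleteSpace E]

/-- An abstract unitary group with a dispersive estimate. -/
structure Disp (U : ℝ → E →L[ℂ] E) (N1 : E → ℝ≥0∞) (K μ : ℝ) : Prop where
  norm : ∀ t f, ‖U t f‖ = ‖f‖
  zero : ∀ f, U 0 f = f
  add : ∀ s t f, U (s + t) f = U s (U t f)
  cont : ∀ f, Continuous fun t => U t f
  smul : ∀ (z : ℂ) f, ‖z‖ ≤ 1 → N1 (z • f) ≤ N1 f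
  zeroN : N1 0 = 0
  K0 : 0 ≤ K
  mu : 3 / 2 ≤ μ
  disp : ∀ t f g, t ≠ 0 → N1 f ≠ ∞ → N1 g ≠ ∞ →
    ‖inner ℂ (U t f) g‖ₑ ≤ ENNReal.ofReal (K * |t| ^ (-μ)) * (N1 f * N1 g)

variable {U : ℝ → E →L[ℂ] E} {N1 : E → ℝ≥0∞} {K μ : ℝ}

lemma Disp.innerEq (hU : Disp U N1 K μ) (t : ℝ) (f g : E) :
    inner ℂ (U t f) (U t g) = inner ℂ f g := by
  let L : E →ₗᵢ[ℂ] E := ⟨(U t).toLinearMap, hU.norm t⟩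
  exact L.inner_map_map f g

lemma Disp.neg_apply (hU : Disp U N1 K μ) (t : ℝ) (f : E) : U t (U (-t) f) = f := by
  rw [← hU.add]; simp [hU.zero]

lemma Disp.inner_shift (hU : Disp U N1 K μ) (t : ℝ) (f g : E) :
    inner ℂ f (U (-t) g) = inner ℂ (U t f) g := by
  rw [← hU.innerEq t, hU.neg_apply]

lemma Disp.inner_shift' (hU : Disp U N1 K μ) (t : ℝ) (f g : E) :
    inner ℂ (U (-t) f) g = inner ℂ f (U t g) := by
  rw [← hU.innerEq t, hU.neg_apply]

lemma Disp.jointCont (hU : Disp U N1 K μ) : Continuous fun p : ℝ × E => U p.1 p.2 := by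
  rw [continuous_iff_continuousAt]
  rintro ⟨t, f⟩
  have h1 : Filter.Tendsto (fun p : ℝ × E => U p.1 f) (nhds (t, f)) (nhds (U t f)) :=
    ((hU.cont f).comp continuous_fst).continuousAt
  have h2 : Filter.Tendsto (fun p : ℝ × E => U p.1 (p.2 - f)) (nhds (t, f)) (nhds 0) := by
    rw [tendsto_zero_iff_norm_tendsto_zero]
    simp_rw [hU.norm]
    have : Continuous fun p : ℝ × E => ‖p.2 - f‖ := by fun_prop
    have := this.tendsto (t, f)
    simpa using this
  have := h1.add h2
  simp only [map_sub, add_sub_cancel, add_zero] at this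
  exact this

lemma Disp.aesm (hU : Disp U N1 K μ) {F : ℝ → E} {ν : Measure ℝ} (hF : AEStronglyMeasurable F ν)
    (φ : ℝ → ℝ) (hφ : Continuous φ) : AEStronglyMeasurable (fun s => U (φ s) (F s)) ν :=
  hU.jointCont.comp_aestronglyMeasurable (hφ.aestronglyMeasurable.prodMk hF)

/-- atoms at level `k` -/
def IsAtom (N1 : E → ℝ≥0∞) (μ : ℝ) (k : ℤ) (a : E) : Prop :=
  ‖a‖ ≤ (2:ℝ) ^ (-(k:ℝ) / 2) ∧ N1 a ≤ ENNReal.ofReal ((2:ℝ) ^ ((μ - 1) / 2 * k))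

/-- time dependent superpositions of atoms -/
def Rep (N1 : E → ℝ≥0∞) (μ : ℝ) (G : ℝ → E) (h : ℝ → ℝ≥0∞) : Prop :=
  ∃ (S : Finset ℤ) (C : ℤ → ℝ → ℝ) (a : ℤ → ℝ → E),
    (∀ k, Measurable (C k)) ∧ (∀ k, Integrable (C k)) ∧ (∀ k, StronglyMeasurable (a k)) ∧
    (∀ k t, IsAtom N1 μ k (a k t)) ∧ (∀ t, G t = ∑ k ∈ S, C k t • a k t) ∧
    (∀ t, ∑ k ∈ S, ‖C k t‖ₑ ^ 2 ≤ h t ^ 2)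

/-- interaction picture -/
def tw (U : ℝ → E →L[ℂ] E) (G : ℝ → E) : ℝ → E := fun s => U (-s) (G s)

lemma Disp.tw_pb (hU : Disp U N1 K μ) {k l : ℤ} {C D : ℝ → ℝ} {a b : ℝ → E}
    (ha : ∀ t, IsAtom N1 μ k (a t)) (hb : ∀ t, IsAtom N1 μ l (b t)) :
    PB K μ k l (tw U fun t => C t • a t) (tw U fun t => D t • b t) (fun t => ‖C t‖ₑ)
      (fun t => ‖D t‖ₑ) := by
  intro s t hst
  have e : inner ℂ (tw U (fun t => C t • a t) s) (tw U (fun t => D t • b t) t) =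
      (C s : ℂ) * (D t : ℂ) * inner ℂ (U (t - s) (a s)) (b t) := by
    unfold tw
    rw [hU.inner_shift, ← hU.add, show t + -s = t - s by ring]
    beta_reduce
    rw [← Complex.coe_smul, ← Complex.coe_smul, map_smul, inner_smul_left, inner_smul_right]
    simp; ring
  rw [e, enorm_mul, enorm_mul]
  have e1 : ‖(C s : ℂ)‖ₑ = ‖C s‖ₑ := by rw [← ofReal_norm, ← ofReal_norm]; simp
  have e2 : ‖(D t : ℂ)‖ₑ = ‖D t‖ₑ := by rw [← ofReal_norm, ← ofReal_norm]; simp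
  rw [e1, e2]
  gcongr
  refine (hU.disp (t - s) (a s) (b t) (sub_ne_zero.2 hst.symm)
    (ne_top_of_le_ne_top ENNReal.ofReal_ne_top (ha s).2)
    (ne_top_of_le_ne_top ENNReal.ofReal_ne_top (hb t).2)).trans ?_
  refine (mul_le_mul' le_rfl (mul_le_mul' (ha s).2 (hb t).2)).trans (le_of_eq ?_)
  have := hU.K0
  rw [← ENNReal.ofReal_mul (by positivity), ← ENNReal.ofReal_mul (by positivity),
    ← ENNReal.ofReal_mul (by positivity), ← Real.rpow_add (by norm_num), mul_add]
  congr 1; ring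

lemma Disp.tw_lb (hU : Disp U N1 K μ) {k : ℤ} {C : ℝ → ℝ} {a : ℝ → E}
    (ha : ∀ t, IsAtom N1 μ k (a t)) :
    LB k (tw U fun t => C t • a t) (fun t => ‖C t‖ₑ) := by
  intro s
  have : ‖tw U (fun t => C t • a t) s‖ = ‖C s‖ * ‖a s‖ := by
    unfold tw; rw [hU.norm, norm_smul]
  rw [← ofReal_norm, this, ENNReal.ofReal_mul (norm_nonneg _), mul_comm, ofReal_norm (C s)]
  gcongr
  exact (ha s).1

lemma Disp.tw_int (hU : Disp U N1 K μ) {k : ℤ} {C : ℝ → ℝ} {a : ℝ → E}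
    (ha : ∀ t, IsAtom N1 μ k (a t)) (hC : Integrable C) (hm : StronglyMeasurable a) :
    Integrable (tw U fun t => C t • a t) := by
  refine Integrable.mono' (hC.norm.mul_const ((2:ℝ) ^ (-(k:ℝ) / 2))) ?_ ?_
  · exact hU.aesm (hC.aestronglyMeasurable.smul hm.aestronglyMeasurable) _ continuous_neg
  · refine Filter.Eventually.of_forall fun s => ?_
    unfold tw; rw [hU.norm, norm_smul]
    gcongr
    exact (ha s).1

lemma tw_sum (S : Finset ℤ) (C : ℤ → ℝ → ℝ) (a : ℤ → ℝ → E) {G : ℝ → E}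
    (hG : ∀ t, G t = ∑ k ∈ S, C k t • a k t) :
    tw U G = fun t => ∑ k ∈ S, tw U (fun t => C k t • a k t) t := by
  funext t
  unfold tw
  rw [hG, map_sum]

lemma ret_int {f g : ℝ → E} (hf : Integrable f) (hg : Integrable g) :
    Integrable fun t => inner ℂ (∫ s in Iio t, f s) (g t) := by
  have hcont : Continuous fun t => ∫ s in Iio t, f s := by
    have e : (fun t => ∫ s in Iio t, f s) =
        fun t => (∫ s in Iic (0:ℝ), f s) + ∫ s in (0:ℝ)..t, f s := by
      funext t
      rw [← integral_Iic_eq_integral_Iio, ← intervalIntegral.integral_Iic_sub_Iic hf.integrableOn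
        hf.integrableOn]
      abel
    rw [e]
    exact continuous_const.add (intervalIntegral.continuous_primitive
      (fun a b => hf.intervalIntegrable (a := a) (b := b)) 0)
  refine Integrable.mono' (hg.norm.const_mul (∫ s, ‖f s‖))
    (hcont.aestronglyMeasurable.inner hg.aestronglyMeasurable)
    (Filter.Eventually.of_forall fun t => ?_)
  refine (norm_inner_le_norm _ _).trans ?_
  gcongr
  exact (norm_integral_le_integral_norm _).trans (setIntegral_le_integral hf.norm
    (Filter.Eventually.of_forall fun _ => norm_nonneg _))

lemma ret_sum (S T : Finset ℤ) (f g : ℤ → ℝ → E) (hf : ∀ k, Integrable (f k))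
    (hg : ∀ k, Integrable (g k)) :
    ret (fun t => ∑ k ∈ S, f k t) (fun t => ∑ l ∈ T, g l t) =
      ∑ k ∈ S, ∑ l ∈ T, ret (f k) (g l) := by
  unfold ret
  have : ∀ t, inner ℂ (∫ s in Iio t, ∑ k ∈ S, f k s) (∑ l ∈ T, g l t) =
      ∑ k ∈ S, ∑ l ∈ T, inner ℂ (∫ s in Iio t, f k s) (g l t) := by
    intro t
    rw [integral_finsetSum _ (fun k _ => (hf k).integrableOn), sum_inner]
    refine Finset.sum_congr rfl fun k _ => ?_
    rw [inner_sum]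
  simp_rw [this]
  rw [integral_finsetSum _ (fun k _ => integrable_finsetSum _ fun l _ => ret_int (hf k) (hg l))]
  refine Finset.sum_congr rfl fun k _ => ?_
  rw [integral_finsetSum _ (fun l _ => ret_int (hf k) (hg l))]

/-- the Schur sum -/
def schurS : ℝ≥0∞ := ∑' j : ℤ, ENNReal.ofReal ((2:ℝ) ^ (-|(j:ℝ)| / 8))

lemma schurS_lt : schurS ≠ ∞ := by
  unfold schurS
  have hs : Summable fun j : ℤ => (2:ℝ) ^ (-|(j:ℝ)| / 8) := by
    have hn : Summable fun j : ℕ => ((2:ℝ) ^ (-(1:ℝ) / 8)) ^ j :=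
      summable_geometric_of_lt_one (by positivity)
        (Real.rpow_lt_one_of_one_lt_of_neg (by norm_num) (by norm_num))
    refine Summable.of_nat_of_neg ?_ ?_
    · refine hn.congr fun j => ?_
      rw [← Real.rpow_natCast, ← Real.rpow_mul (by norm_num)]
      congr 1
      simp; ring
    · refine hn.congr fun j => ?_
      rw [← Real.rpow_natCast, ← Real.rpow_mul (by norm_num)]
      congr 1
      simp; ring
  rw [← ENNReal.ofReal_tsum_of_nonneg (fun j => by positivity) hs]
  exact ENNReal.ofReal_ne_top

lemma sum_le_schurS (S : Finset ℤ) (k : ℤ) :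
    ∑ l ∈ S, ENNReal.ofReal ((2:ℝ) ^ (-|(k:ℝ) - l| / 8)) ≤ schurS := by
  refine (ENNReal.sum_le_tsum S).trans (le_of_eq ?_)
  unfold schurS
  rw [← (Equiv.subLeft k).tsum_eq (fun j : ℤ => ENNReal.ofReal ((2:ℝ) ^ (-|(j:ℝ)| / 8)))]
  refine tsum_congr fun l => ?_
  simp

lemma discrete_schur (S T : Finset ℤ) (x y : ℤ → ℝ≥0∞) :
    ∑ k ∈ S, ∑ l ∈ T, ENNReal.ofReal ((2:ℝ) ^ (-|(k:ℝ) - l| / 8)) * (x k * y l) ≤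
      schurS * ((∑ k ∈ S, x k ^ 2) ^ (1 / 2 : ℝ) * (∑ l ∈ T, y l ^ 2) ^ (1 / 2 : ℝ)) := by
  set w : ℤ → ℤ → ℝ≥0∞ := fun k l => ENNReal.ofReal ((2:ℝ) ^ (-|(k:ℝ) - l| / 8)) with hw
  have hws : ∀ k l, w k l = w l k := fun k l => by simp only [hw, abs_sub_comm]
  have h2 : ∀ x : ℝ≥0∞, (x ^ (1 / 2 : ℝ)) ^ (2:ℝ) = x := fun x => by
    rw [← ENNReal.rpow_mul]; norm_num
  rw [← Finset.sum_product']
  have := ENNReal.inner_le_Lp_mul_Lq (S ×ˢ T) (fun p => w p.1 p.2 ^ (1 / 2 : ℝ) * x p.1)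
    (fun p => w p.1 p.2 ^ (1 / 2 : ℝ) * y p.2) Real.HolderConjugate.two_two
  simp only [ENNReal.mul_rpow_of_nonneg _ _ (zero_le_two : (0:ℝ) ≤ 2), h2] at this
  have hA : ∑ p ∈ S ×ˢ T, w p.1 p.2 * x p.1 ^ (2:ℝ) ≤ schurS * ∑ k ∈ S, x k ^ 2 := by
    rw [Finset.sum_product, Finset.mul_sum]
    refine Finset.sum_le_sum fun k _ => ?_
    simp only
    rw [← Finset.sum_mul, ENNReal.rpow_two]
    gcongr
    exact sum_le_schurS T k
  have hB : ∑ p ∈ S ×ˢ T, w p.1 p.2 * y p.2 ^ (2:ℝ) ≤ schurS * ∑ l ∈ T, y l ^ 2 := by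
    rw [Finset.sum_product_right, Finset.mul_sum]
    refine Finset.sum_le_sum fun k _ => ?_
    simp only
    rw [← Finset.sum_mul, ENNReal.rpow_two]
    gcongr
    simp_rw [fun i => hws i k]
    exact sum_le_schurS S k
  calc ∑ p ∈ S ×ˢ T, w p.1 p.2 * (x p.1 * y p.2)
      = ∑ p ∈ S ×ˢ T, w p.1 p.2 ^ (1 / 2 : ℝ) * x p.1 * (w p.1 p.2 ^ (1 / 2 : ℝ) * y p.2) := by
        refine Finset.sum_congr rfl fun p _ => ?_
        have : w p.1 p.2 = w p.1 p.2 ^ (1 / 2 : ℝ) * w p.1 p.2 ^ (1 / 2 : ℝ) := by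
          rw [← ENNReal.rpow_add_of_nonneg _ _ (by norm_num) (by norm_num)]; norm_num
        conv_lhs => rw [this]
        ring
    _ ≤ _ := this
    _ ≤ (schurS * ∑ k ∈ S, x k ^ 2) ^ (1 / 2 : ℝ) * (schurS * ∑ l ∈ T, y l ^ 2) ^ (1 / 2 : ℝ) := by
        gcongr
    _ = _ := by
        rw [ENNReal.mul_rpow_of_nonneg _ _ (by norm_num), ENNReal.mul_rpow_of_nonneg _ _ (by norm_num)]
        have : schurS = schurS ^ (1 / 2 : ℝ) * schurS ^ (1 / 2 : ℝ) := by
          rw [← ENNReal.rpow_add_of_nonneg _ _ (by norm_num) (by norm_num)]; norm_num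
        conv_rhs => rw [this]
        ring

/-- the constant of the bilinear estimate -/
def C1 (K μ : ℝ) : ℝ≥0∞ := ENNReal.ofReal (pairC K μ) * schurS

lemma C1_ne_top : C1 K μ ≠ ∞ := ENNReal.mul_ne_top ENNReal.ofReal_ne_top schurS_lt

lemma Disp.rep_int (hU : Disp U N1 K μ) {G : ℝ → E} {h : ℝ → ℝ≥0∞} (hG : Rep N1 μ G h) :
    Integrable (tw U G) := by
  obtain ⟨S, C, a, hCm, hCi, ham, ha, hGe, hh⟩ := hG
  rw [tw_sum S C a hGe]
  exact integrable_finsetSum _ fun k _ => hU.tw_int (ha k) (hCi k) (ham k)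

lemma Disp.K1 (hU : Disp U N1 K μ) {F G : ℝ → E} {h h' : ℝ → ℝ≥0∞} (hF : Rep N1 μ F h)
    (hG : Rep N1 μ G h') :
    ‖ret (tw U F) (tw U G)‖ₑ ≤ C1 K μ * ((∫⁻ s, h s ^ 2) ^ (1 / 2 : ℝ) *
      (∫⁻ s, h' s ^ 2) ^ (1 / 2 : ℝ)) := by
  obtain ⟨S, C, a, hCm, hCi, ham, ha, hGe, hh⟩ := hF
  obtain ⟨T, D, b, hDm, hDi, hbm, hb, hGe', hh'⟩ := hG
  rw [tw_sum S C a hGe, tw_sum T D b hGe', ret_sum _ _ _ _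
    (fun k => hU.tw_int (ha k) (hCi k) (ham k)) (fun k => hU.tw_int (hb k) (hDi k) (hbm k))]
  have sq : ∀ x : ℝ≥0∞, (x ^ (1 / 2 : ℝ)) ^ 2 = x := fun x => by
    rw [← ENNReal.rpow_natCast, ← ENNReal.rpow_mul]; norm_num
  have hp : 0 ≤ pairC K μ := by
    have := hU.mu
    have := hU.K0
    have : 0 < μ - 1 := by linarith
    unfold pairC; positivity
  calc ‖∑ k ∈ S, ∑ l ∈ T, ret (tw U fun t => C k t • a k t) (tw U fun t => D l t • b l t)‖ₑ
      ≤ ∑ k ∈ S, ∑ l ∈ T, ‖ret (tw U fun t => C k t • a k t) (tw U fun t => D l t • b l t)‖ₑ := by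
        refine (enorm_sum_le _ _).trans (Finset.sum_le_sum fun k _ => enorm_sum_le _ _)
    _ ≤ ∑ k ∈ S, ∑ l ∈ T, ENNReal.ofReal (pairC K μ) *
          (ENNReal.ofReal ((2:ℝ) ^ (-|(k:ℝ) - l| / 8)) *
          ((∫⁻ s, ‖C k s‖ₑ ^ 2) ^ (1 / 2 : ℝ) * (∫⁻ s, ‖D l s‖ₑ ^ 2) ^ (1 / 2 : ℝ))) := by
        refine Finset.sum_le_sum fun k _ => Finset.sum_le_sum fun l _ => ?_
        rw [← mul_assoc, ← ENNReal.ofReal_mul hp]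
        exact pair_bound K μ k l hU.mu hU.K0 (hU.tw_int (ha k) (hCi k) (ham k))
          (hU.tw_int (hb l) (hDi l) (hbm l)) (hCm k).enorm (hDm l).enorm
          (hU.tw_lb (ha k)) (hU.tw_lb (hb l)) (hU.tw_pb (ha k) (ha k)) (hU.tw_pb (hb l) (hb l))
          (hU.tw_pb (ha k) (hb l))
    _ ≤ ENNReal.ofReal (pairC K μ) * (schurS *
          ((∑ k ∈ S, ∫⁻ s, ‖C k s‖ₑ ^ 2) ^ (1 / 2 : ℝ) *
            (∑ l ∈ T, ∫⁻ s, ‖D l s‖ₑ ^ 2) ^ (1 / 2 : ℝ))) := by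
        simp_rw [← Finset.mul_sum]
        gcongr
        refine (discrete_schur S T (fun k => (∫⁻ s, ‖C k s‖ₑ ^ 2) ^ (1 / 2 : ℝ))
          (fun l => (∫⁻ s, ‖D l s‖ₑ ^ 2) ^ (1 / 2 : ℝ))).trans (le_of_eq ?_)
        simp_rw [sq]
    _ ≤ _ := by
        rw [C1, mul_assoc, ← lintegral_finsetSum _ (fun k _ => (hCm k).enorm.pow_const 2),
          ← lintegral_finsetSum _ (fun k _ => (hDm k).enorm.pow_const 2)]
        gcongr with s s
        · exact hh s
        · exact hh' s

lemma sq_norm_integral_le {g : ℝ → E} (hg : Integrable g) :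
    ‖∫ s, g s‖ₑ ^ 2 ≤ 2 * ‖ret g g‖ₑ := by
  have key : inner ℂ (∫ s, g s) (∫ s, g s) = ret g g + (starRingEnd ℂ) (ret g g) := by
    have e1 : inner ℂ (∫ s, g s) (∫ s, g s) = ∫ t, inner ℂ (∫ s, g s) (g t) :=
      (integral_inner hg _).symm
    have e2 : ∀ t, inner ℂ (∫ s, g s) (g t) = inner ℂ (∫ s in Iio t, g s) (g t) +
        (starRingEnd ℂ) (inner ℂ (g t) (∫ s in Ioi t, g s)) := by
      intro t
      rw [inner_conj_symm, ← inner_add_left, ← integral_Ici_eq_integral_Ioi,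
        ← compl_Iio, integral_add_compl measurableSet_Iio hg]
    have i2 : Integrable fun t => (starRingEnd ℂ) (inner ℂ (g t) (∫ s in Ioi t, g s)) := by
      simp_rw [inner_conj_symm]
      have := (hg.inner_const (𝕜 := ℂ) (∫ s, g s))
      have i3 : Integrable fun t => inner ℂ (∫ s, g s) (g t) := hg.const_inner _
      refine (i3.sub (ret_int hg hg)).congr (Filter.Eventually.of_forall fun t => ?_)
      have := e2 t
      rw [inner_conj_symm] at this
      simp [this]
    rw [e1]
    simp_rw [e2]
    rw [integral_add (ret_int hg hg) i2, integral_conj, ← ordered_fubini hg hg]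
    rfl
  rw [enorm_sq_eq, key]
  refine (enorm_add_le _ _).trans (le_of_eq ?_)
  rw [RCLike.enorm_conj, two_mul]

lemma Disp.K2 (hU : Disp U N1 K μ) {G : ℝ → E} {h : ℝ → ℝ≥0∞} (hG : Rep N1 μ G h) :
    ‖∫ s, tw U G s‖ₑ ≤ (2 * C1 K μ) ^ (1 / 2 : ℝ) * (∫⁻ s, h s ^ 2) ^ (1 / 2 : ℝ) := by
  have h1 := (sq_norm_integral_le (hU.rep_int hG)).trans (mul_le_mul' le_rfl (hU.K1 hG hG))
  rw [← ENNReal.rpow_add_of_nonneg _ _ (by norm_num) (by norm_num)] at h1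
  norm_num at h1
  rw [← ENNReal.mul_rpow_of_nonneg _ _ (by norm_num)]
  have h2 := ENNReal.rpow_le_rpow h1 (by norm_num : (0:ℝ) ≤ 1 / 2)
  rw [← ENNReal.rpow_natCast, ← ENNReal.rpow_mul] at h2
  norm_num at h2
  rw [mul_assoc]
  simpa using h2

lemma Rep.indicator {G : ℝ → E} {h : ℝ → ℝ≥0∞} (hG : Rep N1 μ G h) {J : Set ℝ} (hJ : MeasurableSet J) :
    Rep N1 μ (J.indicator G) h := by
  obtain ⟨S, C, a, hCm, hCi, ham, ha, hGe, hh⟩ := hG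
  refine ⟨S, fun k => J.indicator (C k), a, fun k => (hCm k).indicator hJ,
    fun k => (hCi k).indicator hJ, ham, ha, fun t => ?_, fun t => ?_⟩
  · by_cases ht : t ∈ J <;> simp [ht, hGe]
  · by_cases ht : t ∈ J
    · simpa [ht] using hh t
    · simp [ht]

lemma Disp.K2' (hU : Disp U N1 K μ) {G : ℝ → E} {h : ℝ → ℝ≥0∞} (hG : Rep N1 μ G h)
    {J : Set ℝ} (hJ : MeasurableSet J) :
    ‖∫ s in J, tw U G s‖ₑ ≤ (2 * C1 K μ) ^ (1 / 2 : ℝ) * (∫⁻ s, h s ^ 2) ^ (1 / 2 : ℝ) := by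
  have := hU.K2 (hG.indicator hJ)
  rw [← integral_indicator hJ]
  have e : J.indicator (tw U G) = tw U (J.indicator G) := by
    funext s
    by_cases hs : s ∈ J <;> simp [tw, hs]
  rw [e]
  exact this

end KT

namespace KT
set_option linter.unusedSectionVars false
open Set

variable {E : Type*} [NormedAddCommGroup E] [InnerProductSpace ℂ E] [CompleteSpace E]
variable {U : ℝ → E →L[ℂ] E} {N1 : E → ℝ≥0∞} {K μ : ℝ}

/-- unit superpositions of atoms -/
def GG (N1 : E → ℝ≥0∞) (μ : ℝ) : Set E :=
  {g | ∃ (S : Finset ℤ) (c : ℤ → ℝ) (a : ℤ → E), (∀ k, IsAtom N1 μ k (a k)) ∧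
    g = ∑ k ∈ S, c k • a k ∧ ∑ k ∈ S, ‖c k‖ₑ ^ 2 ≤ 1}

/-- the maximal dual functional -/
def MM (N1 : E → ℝ≥0∞) (μ : ℝ) (v : E) : ℝ≥0∞ := ⨆ g ∈ GG N1 μ, ‖inner ℂ v g‖ₑ

lemma Disp.atom_zero (hU : Disp U N1 K μ) (k : ℤ) : IsAtom N1 μ k (0 : E) :=
  ⟨by rw [norm_zero]; positivity, by rw [hU.zeroN]; exact zero_le⟩

lemma Disp.zero_GG (hU : Disp U N1 K μ) : (0 : E) ∈ GG N1 μ :=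
  ⟨∅, 0, 0, hU.atom_zero, by simp, by simp⟩

lemma MM_neg (v : E) : MM N1 μ (-v) = MM N1 μ v := by
  unfold MM; simp

lemma MM_zero : MM N1 μ (0 : E) = 0 := by
  unfold MM; simp

lemma Disp.exists_seq [SecondCountableTopology E] (hU : Disp U N1 K μ) :
    ∃ d : ℕ → E, (∀ n, d n ∈ GG N1 μ) ∧ ∀ v, MM N1 μ v = ⨆ n, ‖inner ℂ v (d n)‖ₑ := by
  have : Nonempty (GG N1 μ) := ⟨⟨0, hU.zero_GG⟩⟩
  obtain ⟨u, hu⟩ := TopologicalSpace.exists_dense_seq (GG N1 μ)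
  refine ⟨fun n => u n, fun n => (u n).2, fun v => le_antisymm ?_ ?_⟩
  · unfold MM
    refine iSup₂_le fun g hg => ?_
    set B := ⨆ n, ‖inner ℂ v (u n : E)‖ₑ
    have hcl : IsClosed {g : GG N1 μ | ‖inner ℂ v (g : E)‖ₑ ≤ B} :=
      isClosed_le (by fun_prop) continuous_const
    have hsub : Set.range u ⊆ {g : GG N1 μ | ‖inner ℂ v (g : E)‖ₑ ≤ B} := by
      rintro _ ⟨n, rfl⟩
      exact le_iSup (fun n => ‖inner ℂ v (u n : E)‖ₑ) n
    have := closure_minimal hsub hcl (hu.closure_eq ▸ mem_univ (⟨g, hg⟩ : GG N1 μ))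
    exact this
  · exact iSup_le fun n => le_iSup₂ (f := fun g (_ : g ∈ GG N1 μ) => ‖inner ℂ v g‖ₑ) _ (u n).2

lemma sq_le_of_le_mul {I B : ℝ≥0∞} (hI : I ≠ ∞) (h : I ≤ B * I ^ (1 / 2 : ℝ)) : I ≤ B ^ 2 := by
  rcases eq_or_ne I 0 with h0 | h0
  · simp [h0]
  have hs : I = I ^ (1 / 2 : ℝ) * I ^ (1 / 2 : ℝ) := by
    rw [← ENNReal.rpow_add_of_nonneg _ _ (by norm_num) (by norm_num)]; norm_num
  have hp : I ^ (1 / 2 : ℝ) ≠ 0 := by simp [h0]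
  have ht : I ^ (1 / 2 : ℝ) ≠ ∞ := ENNReal.rpow_ne_top_of_nonneg (by norm_num) hI
  have h1 : I ^ (1 / 2 : ℝ) ≤ B := by
    exact (ENNReal.mul_le_mul_iff_left hp ht).1 (hs ▸ h)
  rw [hs, sq]
  exact mul_le_mul' h1 h1

open Classical in
/-- duality lemma, for strongly measurable bounded `v`. -/
lemma Disp.dualitySM [SecondCountableTopology E] (hU : Disp U N1 K μ) {v : ℝ → E}
    (hv : StronglyMeasurable v)
    {V : ℝ} (hV : ∀ t, ‖v t‖ ≤ V) (B : ℝ≥0∞)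
    (hB : ∀ G h, Rep N1 μ G h → ∫⁻ t, h t ^ 2 ≠ ∞ → ‖∫ t, inner ℂ (v t) (G t)‖ₑ ≤ B * (∫⁻ t, h t ^ 2) ^ (1 / 2 : ℝ)) :
    ∫⁻ t, MM N1 μ (v t) ^ 2 ≤ B ^ 2 := by
  obtain ⟨d, hd, hM⟩ := hU.exists_seq
  choose S c a ha hda hc using hd
  have hmz : ∀ j, Measurable fun t => inner ℂ (v t) (d j) := fun j =>
    (hv.inner stronglyMeasurable_const).measurable
  let p : ℕ → ℝ → ℕ → Prop := fun n t i =>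
    i ≤ n ∧ ∀ j ≤ n, ‖inner ℂ (v t) (d j)‖ ≤ ‖inner ℂ (v t) (d i)‖
  have hp : ∀ n t, ∃ i, p n t i := by
    intro n t
    obtain ⟨i, hi, hi2⟩ := Finset.exists_max_image (Finset.range (n + 1))
      (fun j => ‖inner ℂ (v t) (d j)‖) ⟨0, by simp⟩
    refine ⟨i, by simpa [Nat.lt_succ_iff] using hi, fun j hj => hi2 j (by simpa [Nat.lt_succ_iff] using hj)⟩
  have hpm : ∀ n k, MeasurableSet {t | p n t k} := by
    intro n k
    have : {t | p n t k} = {t | k ≤ n} ∩ ⋂ j, {t | j ≤ n → ‖inner ℂ (v t) (d j)‖ ≤ ‖inner ℂ (v t) (d k)‖} := by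
      ext t; simp [p]
    rw [this]
    refine (MeasurableSet.const _).inter (MeasurableSet.iInter fun j => ?_)
    by_cases hj : j ≤ n
    · simp only [hj, true_imp_iff]
      exact measurableSet_le (hmz j).norm (hmz k).norm
    · simp [hj]
  let ι : ℕ → ℝ → ℕ := fun n t => Nat.find (hp n t)
  have hι : ∀ n, Measurable (ι n) := fun n => measurable_find (hp n) (hpm n)
  have hιs : ∀ n t, p n t (ι n t) := fun n t => Nat.find_spec (hp n t)
  let z : ℕ → ℝ → ℂ := fun n t => inner ℂ (v t) (d (ι n t))
  have hdm : ∀ n, StronglyMeasurable fun t => d (ι n t) := fun n =>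
    (StronglyMeasurable.of_discrete (f := d)).comp_measurable (hι n)
  have hz : ∀ n, Measurable (z n) := fun n => (hv.inner (hdm n)).measurable
  let φ : ℕ → ℝ → ℝ≥0∞ := fun n => (Icc (-(n:ℝ)) n).indicator fun t => ‖z n t‖ₑ ^ 2
  have hφm : ∀ n, Measurable (φ n) := fun n => ((hz n).enorm.pow_const 2).indicator measurableSet_Icc
  have henle : ∀ {n m : ℕ} (t : ℝ), n ≤ m → ‖z n t‖ₑ ≤ ‖z m t‖ₑ := by
    intro n m t hnm
    rw [← ofReal_norm, ← ofReal_norm]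
    exact ENNReal.ofReal_le_ofReal ((hιs m t).2 _ ((hιs n t).1.trans hnm))
  have hmono : Monotone φ := by
    intro n m hnm t
    have hnm' : (n:ℝ) ≤ m := by exact_mod_cast hnm
    by_cases h1 : t ∈ Icc (-(n:ℝ)) n
    · have h2 : t ∈ Icc (-(m:ℝ)) m := ⟨by linarith [h1.1], by linarith [h1.2]⟩
      simp only [φ, indicator_of_mem h1, indicator_of_mem h2]
      gcongr; exact henle t hnm
    · simp only [φ, indicator_of_notMem h1]; exact zero_le
  have hle : ∀ t, MM N1 μ (v t) ^ 2 ≤ ⨆ n, φ n t := by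
    intro t
    rw [hM]
    have : (⨆ n, ‖inner ℂ (v t) (d n)‖ₑ) ^ 2 = ⨆ n, ‖inner ℂ (v t) (d n)‖ₑ ^ 2 := by
      have := (ENNReal.orderIsoRpow 2 (by norm_num)).map_iSup fun n => ‖inner ℂ (v t) (d n)‖ₑ
      simp only [ENNReal.orderIsoRpow_apply, ENNReal.rpow_two] at this
      exact this
    rw [this]
    refine iSup_le fun n => ?_
    obtain ⟨k, hk⟩ := exists_nat_ge |t|
    refine le_trans ?_ (le_iSup _ (max n k))
    have h1 : t ∈ Icc (-((max n k : ℕ):ℝ)) (max n k : ℕ) := by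
      have : (k:ℝ) ≤ (max n k : ℕ) := by exact_mod_cast le_max_right n k
      exact ⟨by linarith [neg_abs_le t], by linarith [le_abs_self t]⟩
    simp only [φ, indicator_of_mem h1]
    gcongr
    rw [← ofReal_norm, ← ofReal_norm]
    exact ENNReal.ofReal_le_ofReal ((hιs _ t).2 _ (le_max_left n k))
  refine (lintegral_mono hle).trans ?_
  rw [lintegral_iSup hφm hmono]
  refine iSup_le fun n => ?_
  -- the test function
  let hh : ℝ → ℝ := (Icc (-(n:ℝ)) n).indicator fun t => ‖z n t‖
  have hhm : Measurable hh := (hz n).norm.indicator measurableSet_Icc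
  let lam : ℝ → ℂ := fun t => (starRingEnd ℂ) (z n t) / ‖z n t‖
  have hlam : ∀ t, ‖lam t‖ ≤ 1 := by
    intro t; simp only [lam, norm_div, RCLike.norm_conj, Complex.norm_real, norm_norm]
    exact div_self_le_one _
  have hlamz : ∀ t, lam t * z n t = (‖z n t‖ : ℂ) := by
    intro t
    simp only [lam]
    by_cases h0 : z n t = 0
    · simp [h0]
    · have : (‖z n t‖ : ℂ) ≠ 0 := by simpa using h0
      rw [div_mul_eq_mul_div, Complex.conj_mul', sq]
      field_simp
  have hlm : Measurable lam := by
    have := hz n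
    exact ((Complex.continuous_conj.measurable.comp this)).div
      (Complex.measurable_ofReal.comp this.norm)
  let Sn : Finset ℤ := (Finset.range (n + 1)).biUnion S
  let cc : ℕ → ℤ → ℝ := fun i k => if k ∈ S i then c i k else 0
  have hzb : ∃ Z : ℝ, ∀ t, ‖z n t‖ ≤ Z := by
    refine ⟨V * ∑ i ∈ Finset.range (n + 1), ‖d i‖, fun t => ?_⟩
    refine (norm_inner_le_norm _ _).trans ?_
    refine mul_le_mul (hV t) ?_ (norm_nonneg _) ((norm_nonneg _).trans (hV t))
    exact Finset.single_le_sum (f := fun i => ‖d i‖) (fun _ _ => norm_nonneg _)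
      (Finset.mem_range.2 (Nat.lt_succ_of_le (hιs n t).1))
  obtain ⟨Z, hZ⟩ := hzb
  have hccb : ∀ k, ∃ Q : ℝ, ∀ i ≤ n, |cc i k| ≤ Q := by
    intro k
    refine ⟨∑ i ∈ Finset.range (n + 1), |cc i k|, fun i hi => ?_⟩
    exact Finset.single_le_sum (f := fun i => |cc i k|) (fun _ _ => abs_nonneg _)
      (Finset.mem_range.2 (Nat.lt_succ_of_le hi))
  let G : ℝ → E := fun t => (hh t : ℂ) • lam t • d (ι n t)
  have hrep : Rep N1 μ G (fun t => ENNReal.ofReal (hh t)) := by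
    have hCm : ∀ k, Measurable fun t => hh t * cc (ι n t) k := fun k =>
      hhm.mul ((measurable_from_nat (f := fun i => cc i k)).comp (hι n))
    refine ⟨Sn, fun k t => hh t * cc (ι n t) k, fun k t => lam t • a (ι n t) k, hCm, ?_, ?_, ?_, ?_, ?_⟩
    · intro k
      obtain ⟨Q, hQ⟩ := hccb k
      have hcst : Integrable ((Icc (-(n:ℝ)) n).indicator fun _ => Z * Q) :=
        (integrable_indicator_iff measurableSet_Icc).2 (integrableOn_const (by simp))
      refine Integrable.mono' hcst (hCm k).aestronglyMeasurable
        (Filter.Eventually.of_forall fun t => ?_)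
      by_cases h1 : t ∈ Icc (-(n:ℝ)) n
      · simp only [hh, indicator_of_mem h1, norm_mul, Real.norm_eq_abs]
        exact mul_le_mul (by simpa using hZ t) (hQ _ (hιs n t).1) (abs_nonneg _) ((norm_nonneg _).trans (hZ t))
      · simp [hh, indicator_of_notMem h1]
    · intro k
      exact hlm.stronglyMeasurable.smul
        ((StronglyMeasurable.of_discrete (f := fun i => a i k)).comp_measurable (hι n))
    · intro k t
      refine ⟨?_, (hU.smul _ _ (hlam t)).trans (ha _ k).2⟩
      rw [norm_smul]
      refine le_trans ?_ (ha (ι n t) k).1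
      exact mul_le_of_le_one_left (norm_nonneg _) (hlam t)
    · intro t
      have hsub : S (ι n t) ⊆ Sn := Finset.subset_biUnion_of_mem S
        (Finset.mem_range.2 (Nat.lt_succ_of_le (hιs n t).1))
      simp only [G]
      conv_lhs => rw [hda (ι n t)]
      rw [Finset.smul_sum, Finset.smul_sum, ← Finset.sum_subset hsub]
      · refine Finset.sum_congr rfl fun k hk => ?_
        simp only [cc, hk, if_true]
        rw [mul_smul, Complex.coe_smul, smul_comm (lam t)]
      · intro k _ hk
        simp [cc, hk]
    · intro t
      have hsub : S (ι n t) ⊆ Sn := Finset.subset_biUnion_of_mem S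
        (Finset.mem_range.2 (Nat.lt_succ_of_le (hιs n t).1))
      have hh0 : 0 ≤ hh t := indicator_nonneg (fun _ _ => norm_nonneg _) _
      rw [← Finset.sum_subset hsub]
      · have : ∀ k ∈ S (ι n t), ‖hh t * cc (ι n t) k‖ₑ ^ 2 =
            ENNReal.ofReal (hh t) ^ 2 * ‖c (ι n t) k‖ₑ ^ 2 := by
          intro k hk
          simp only [cc, hk, if_true, enorm_mul, mul_pow, Real.enorm_of_nonneg hh0]
        rw [Finset.sum_congr rfl this, ← Finset.mul_sum]
        exact mul_le_of_le_one_right zero_le (hc _)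
      · intro k _ hk
        simp [cc, hk]
  have hval : ∀ t, inner ℂ (v t) (G t) = ((hh t ^ 2 : ℝ) : ℂ) := by
    intro t
    simp only [G, inner_smul_right]
    by_cases h1 : t ∈ Icc (-(n:ℝ)) n
    · have : lam t * inner ℂ (v t) (d (ι n t)) = (‖z n t‖ : ℂ) := hlamz t
      rw [this]
      simp only [hh, indicator_of_mem h1]
      push_cast; ring
    · simp [hh, indicator_of_notMem h1]
  have hφe : ∀ t, φ n t = ENNReal.ofReal (hh t) ^ 2 := by
    intro t
    by_cases h1 : t ∈ Icc (-(n:ℝ)) n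
    · simp only [φ, hh, indicator_of_mem h1, ofReal_norm]
    · simp [φ, hh, indicator_of_notMem h1]
  have hI : ∫⁻ t, φ n t ≠ ∞ := by
    refine ne_top_of_le_ne_top ?_ (lintegral_mono (g := (Icc (-(n:ℝ)) n).indicator fun _ => ENNReal.ofReal Z ^ 2) ?_)
    · rw [lintegral_indicator measurableSet_Icc, setLIntegral_const]
      exact ENNReal.mul_ne_top (by simp) (by simp)
    · intro t
      by_cases h1 : t ∈ Icc (-(n:ℝ)) n
      · simp only [φ, indicator_of_mem h1, ← ofReal_norm]
        gcongr; exact hZ t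
      · simp [φ, indicator_of_notMem h1]
  refine sq_le_of_le_mul hI ?_
  have hfin := hB G _ hrep (by simp_rw [← hφe]; exact hI)
  simp_rw [← hφe] at hfin
  refine le_trans (le_of_eq ?_) hfin
  simp_rw [hval]
  rw [integral_complex_ofReal]
  have h0 : 0 ≤ ∫ t, hh t ^ 2 := integral_nonneg fun t => sq_nonneg _
  rw [← ofReal_norm, Complex.norm_real, Real.norm_of_nonneg h0,
    integral_eq_lintegral_of_nonneg_ae (Filter.Eventually.of_forall fun t => sq_nonneg _)
    (hhm.pow_const 2).aestronglyMeasurable]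
  have e : ∀ t, ENNReal.ofReal (hh t ^ 2) = φ n t := fun t => by
    rw [hφe, ENNReal.ofReal_pow (indicator_nonneg (fun _ _ => norm_nonneg _) _)]
  simp_rw [e]
  rw [ENNReal.ofReal_toReal hI]

lemma Disp.duality [SecondCountableTopology E] (hU : Disp U N1 K μ) {v : ℝ → E}
    (hv : AEStronglyMeasurable v)
    {V : ℝ} (hV : ∀ t, ‖v t‖ ≤ V) (B : ℝ≥0∞)
    (hB : ∀ G h, Rep N1 μ G h → ∫⁻ t, h t ^ 2 ≠ ∞ → ‖∫ t, inner ℂ (v t) (G t)‖ₑ ≤ B * (∫⁻ t, h t ^ 2) ^ (1 / 2 : ℝ)) :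
    ∫⁻ t, MM N1 μ (v t) ^ 2 ≤ B ^ 2 := by
  have hV0 : 0 ≤ V := (norm_nonneg _).trans (hV 0)
  set w := hv.mk v with hw
  set w' : ℝ → E := {t | ‖w t‖ ≤ V}.indicator w with hw'
  have hwm : StronglyMeasurable w := hv.stronglyMeasurable_mk
  have hS : MeasurableSet {t | ‖w t‖ ≤ V} := measurableSet_le hwm.norm.measurable measurable_const
  have hae : v =ᵐ[volume] w' := by
    filter_upwards [hv.ae_eq_mk] with t ht
    have : t ∈ {t | ‖w t‖ ≤ V} := by
      simp only [mem_ofPred_eq, hw, ← ht]; exact hV t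
    rw [hw', indicator_of_mem this, ht]
  have h1 := hU.dualitySM (v := w') (hwm.indicator hS) (V := V) (fun t => ?_) B (fun G h hG hfin => ?_)
  · refine le_trans (le_of_eq (lintegral_congr_ae ?_)) h1
    filter_upwards [hae] with t ht
    rw [ht]
  · by_cases h : t ∈ {t | ‖w t‖ ≤ V}
    · rw [hw', indicator_of_mem h]; exact h
    · rw [hw', indicator_of_notMem h]; simpa using hV0
  · refine le_trans (le_of_eq ?_) (hB G h hG hfin)
    congr 1
    refine integral_congr_ae ?_
    filter_upwards [hae] with t ht
    rw [ht]

end KT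

namespace KT
set_option linter.unusedSectionVars false
open Set

variable {E : Type*} [NormedAddCommGroup E] [InnerProductSpace ℂ E] [CompleteSpace E]
variable {U : ℝ → E →L[ℂ] E} {N1 : E → ℝ≥0∞} {K μ : ℝ}

/-- energy constant -/
def b1 (K μ : ℝ) : ℝ≥0∞ := (2 * C1 K μ) ^ (1 / 2 : ℝ)

lemma b1_ne_top : b1 K μ ≠ ∞ :=
  ENNReal.rpow_ne_top_of_nonneg (by norm_num) (ENNReal.mul_ne_top (by norm_num) C1_ne_top)

lemma Disp.enorm (hU : Disp U N1 K μ) (t : ℝ) (f : E) : ‖U t f‖ₑ = ‖f‖ₑ := by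
  rw [← ofReal_norm, ← ofReal_norm, hU.norm]

lemma Disp.T1 [SecondCountableTopology E] (hU : Disp U N1 K μ) (g : E) :
    ∫⁻ s, MM N1 μ (U s g) ^ 2 ≤ (b1 K μ * ‖g‖ₑ) ^ 2 := by
  refine hU.duality (hU.cont g).aestronglyMeasurable (V := ‖g‖) (fun t => (hU.norm t g).le) _
    fun G h hG _ => ?_
  have e : ∀ t, inner ℂ (U t g) (G t) = inner ℂ g (tw U G t) := fun t =>
    (hU.inner_shift t g (G t)).symm
  simp_rw [e]
  rw [integral_inner (hU.rep_int hG)]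
  refine (inner_enorm_le _ _).trans ((mul_le_mul' le_rfl (hU.K2 hG)).trans (le_of_eq ?_))
  rw [b1]; ring

lemma cont_Iio {f : ℝ → E} (hf : Integrable f) : Continuous fun t => ∫ s in Iio t, f s := by
  have e : (fun t => ∫ s in Iio t, f s) =
      fun t => (∫ s in Iic (0:ℝ), f s) + ∫ s in (0:ℝ)..t, f s := by
    funext t
    rw [← integral_Iic_eq_integral_Iio, ← intervalIntegral.integral_Iic_sub_Iic hf.integrableOn
      hf.integrableOn]
    abel
  rw [e]
  exact continuous_const.add (intervalIntegral.continuous_primitive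
    (fun a b => hf.intervalIntegrable (a := a) (b := b)) 0)

lemma cont_Ioi {f : ℝ → E} (hf : Integrable f) : Continuous fun t => ∫ s in Ioi t, f s := by
  have e : (fun t => ∫ s in Ioi t, f s) = fun t => (∫ s, f s) - ∫ s in Iio t, f s := by
    funext t
    rw [← integral_Ici_eq_integral_Ioi, ← compl_Iio,
      ← integral_add_compl measurableSet_Iio hf, add_sub_cancel_left]
  rw [e]
  exact continuous_const.sub (cont_Iio hf)

/-- backward Duhamel integral -/
def bw (U : ℝ → E →L[ℂ] E) (G : ℝ → E) (s : ℝ) : E := U s (∫ t in Ioi s, tw U G t)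

lemma Disp.bw_cont (hU : Disp U N1 K μ) {G : ℝ → E} {h : ℝ → ℝ≥0∞} (hG : Rep N1 μ G h) :
    Continuous (bw U G) :=
  hU.jointCont.comp (continuous_id.prodMk (cont_Ioi (hU.rep_int hG)))

lemma Disp.T2 [SecondCountableTopology E] (hU : Disp U N1 K μ) {G : ℝ → E} {h : ℝ → ℝ≥0∞}
    (hG : Rep N1 μ G h) :
    ∫⁻ s, MM N1 μ (bw U G s) ^ 2 ≤ (C1 K μ * (∫⁻ s, h s ^ 2) ^ (1 / 2 : ℝ)) ^ 2 := by
  refine hU.duality (hU.bw_cont hG).aestronglyMeasurable (V := ∫ s, ‖tw U G s‖) (fun t => ?_) _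
    fun H h' hH _ => ?_
  · rw [bw, hU.norm]
    exact (norm_integral_le_integral_norm _).trans (setIntegral_le_integral (hU.rep_int hG).norm
      (Filter.Eventually.of_forall fun _ => norm_nonneg _))
  · have e : ∀ t, inner ℂ (bw U G t) (H t) =
        (starRingEnd ℂ) (inner ℂ (tw U H t) (∫ s in Ioi t, tw U G s)) := fun t => by
      rw [inner_conj_symm, bw]
      exact (hU.inner_shift t _ _).symm
    simp_rw [e]
    rw [integral_conj, RCLike.enorm_conj, ← ordered_fubini (hU.rep_int hH) (hU.rep_int hG)]
    refine (hU.K1 hH hG).trans (le_of_eq ?_)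
    ring

lemma Disp.MM_aem [SecondCountableTopology E] (hU : Disp U N1 K μ) {w : ℝ → E}
    (hw : AEStronglyMeasurable w) : AEMeasurable fun s => MM N1 μ (w s) := by
  obtain ⟨d, -, hM⟩ := hU.exists_seq
  simp_rw [hM]
  exact AEMeasurable.iSup fun n => (hw.inner aestronglyMeasurable_const).enorm

/-- Hölder in time. -/
lemma Disp.time_holder [SecondCountableTopology E] (hU : Disp U N1 K μ) {X : E → ℝ≥0∞} {θ : ℝ}
    (h0 : 0 ≤ θ) (hθ : θ ≤ 1) {C2 : ℝ≥0∞} (hC2 : C2 ≠ ∞)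
    (hX : ∀ v w, ‖inner ℂ v w‖ₑ ≤ C2 * (X v * (‖w‖ₑ ^ (1 - θ) * MM N1 μ w ^ θ)))
    {p : ℝ} (hp : p = (1 - θ / 2)⁻¹) {F w : ℝ → E} (hF : AEStronglyMeasurable F)
    (hw : AEStronglyMeasurable w) {b B : ℝ≥0∞} (hb : b ≠ ∞) (hB : B ≠ ∞) (hwb : ∀ s, ‖w s‖ₑ ≤ b)
    (hwB : ∫⁻ s, MM N1 μ (w s) ^ 2 ≤ B ^ 2) :
    ∫⁻ s, ‖inner ℂ (F s) (w s)‖ₑ ≤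
      C2 * ((∫⁻ s, X (F s) ^ p) ^ (1 / p) * (b ^ (1 - θ) * B ^ θ)) := by
  have hMm := hU.MM_aem hw
  set g : ℝ → ℝ≥0∞ := fun s => C2 * b ^ (1 - θ) * MM N1 μ (w s) ^ θ with hg
  have hgm : AEMeasurable g := (hMm.pow_const θ).const_mul _
  have hhm : AEMeasurable fun s => ‖inner ℂ (F s) (w s)‖ₑ := (hF.inner hw).enorm
  have hle : ∀ s, ‖inner ℂ (F s) (w s)‖ₑ ≤ X (F s) * g s := fun s => by
    refine (hX _ _).trans ?_
    calc C2 * (X (F s) * (‖w s‖ₑ ^ (1 - θ) * MM N1 μ (w s) ^ θ))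
        ≤ C2 * (X (F s) * (b ^ (1 - θ) * MM N1 μ (w s) ^ θ)) := by
          gcongr
          exact hwb s
      _ = _ := by rw [hg]; ring
  have hfin : ∀ᵐ s, MM N1 μ (w s) < ∞ := by
    have := ae_lt_top' (hMm.pow_const 2) (ne_top_of_le_ne_top (ENNReal.pow_ne_top hB) hwB)
    filter_upwards [this] with s hs
    by_contra h
    rw [not_lt, top_le_iff] at h
    rw [h] at hs
    simp at hs
  set f0 : ℝ → ℝ≥0∞ := fun s => ‖inner ℂ (F s) (w s)‖ₑ / g s with hf0
  have hf0m : AEMeasurable f0 := hhm.div hgm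
  have hf0X : ∀ s, f0 s ≤ X (F s) := fun s => ENNReal.div_le_of_le_mul (hle s)
  have hfg : ∀ᵐ s, ‖inner ℂ (F s) (w s)‖ₑ ≤ f0 s * g s := by
    filter_upwards [hfin] with s hs
    by_cases hz : g s = 0
    · have := hle s
      rw [hz, mul_zero] at this
      rw [hz, mul_zero]; exact this
    · have ht : g s ≠ ∞ := by
        simp only [hg]
        exact ENNReal.mul_ne_top (ENNReal.mul_ne_top hC2
          (ENNReal.rpow_ne_top_of_nonneg (by linarith) hb))
          (ENNReal.rpow_ne_top_of_nonneg h0 hs.ne)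
      rw [hf0]
      simp only
      rw [ENNReal.div_mul_cancel hz ht]
  have hp0 : 0 < p := by rw [hp]; apply inv_pos.2; linarith
  calc ∫⁻ s, ‖inner ℂ (F s) (w s)‖ₑ ≤ ∫⁻ s, f0 s * g s := lintegral_mono_ae hfg
    _ = ∫⁻ s, (C2 * b ^ (1 - θ)) * ((f0 s ^ p) ^ (1 / p) * (MM N1 μ (w s) ^ 2) ^ (θ / 2)) := by
        refine lintegral_congr fun s => ?_
        rw [← ENNReal.rpow_mul, mul_one_div_cancel hp0.ne', ENNReal.rpow_one, ← ENNReal.rpow_two,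
          ← ENNReal.rpow_mul, mul_div_cancel₀ θ (two_ne_zero), hg]
        simp only; ring
    _ = (C2 * b ^ (1 - θ)) * ∫⁻ s, ((f0 s ^ p) ^ (1 / p) * (MM N1 μ (w s) ^ 2) ^ (θ / 2)) :=
        lintegral_const_mul'' _ (((hf0m.pow_const p).pow_const _).mul ((hMm.pow_const 2).pow_const _))
    _ ≤ (C2 * b ^ (1 - θ)) * ((∫⁻ s, f0 s ^ p) ^ (1 / p) *
          (∫⁻ s, MM N1 μ (w s) ^ 2) ^ (θ / 2)) := by
        gcongr
        refine ENNReal.lintegral_mul_norm_pow_le (hf0m.pow_const p) (hMm.pow_const 2)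
          (by positivity) (by positivity) ?_
        rw [hp]; simp
    _ ≤ (C2 * b ^ (1 - θ)) * ((∫⁻ s, X (F s) ^ p) ^ (1 / p) * (B ^ 2) ^ (θ / 2)) := by
        gcongr with s
        exact hf0X s
    _ = _ := by
        rw [← ENNReal.rpow_two, ← ENNReal.rpow_mul, mul_div_cancel₀ θ (two_ne_zero)]
        ring

/-- the Duhamel integral -/
def duh (U : ℝ → E →L[ℂ] E) (F : ℝ → E) (t : ℝ) : E := ∫ s in (0:ℝ)..t, U (t - s) (F s)

lemma Disp.duh_eq (hU : Disp U N1 K μ) (F : ℝ → E) (t : ℝ) :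
    duh U F t = U t (∫ s in (0:ℝ)..t, tw U F s) := by
  let L : E →ₗᵢ[ℂ] E := ⟨(U t).toLinearMap, hU.norm t⟩
  have h1 : ∀ J : Set ℝ, ∫ s in J, U (t - s) (F s) = U t (∫ s in J, tw U F s) := by
    intro J
    have := L.integral_comp_comm (μ := volume.restrict J) (tw U F)
    refine Eq.trans ?_ this
    refine integral_congr_ae (Filter.Eventually.of_forall fun s => ?_)
    change U (t - s) (F s) = U t (U (-s) (F s))
    rw [← hU.add, sub_eq_add_neg]
  simp only [duh, intervalIntegral, h1, map_sub]

section main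
variable [SecondCountableTopology E] {X : E → ℝ≥0∞} {θ : ℝ} {C2 : ℝ≥0∞} {p : ℝ}

lemma scale_pow (x y z : ℝ≥0∞) (h0 : 0 ≤ θ) (hθ : θ ≤ 1) :
    (x * z) ^ (1 - θ) * (y * z) ^ θ = x ^ (1 - θ) * y ^ θ * z := by
  rw [ENNReal.mul_rpow_of_nonneg _ _ (by linarith), ENNReal.mul_rpow_of_nonneg _ _ h0]
  have : z = z ^ (1 - θ) * z ^ θ := by
    rw [← ENNReal.rpow_add_of_nonneg _ _ (by linarith) h0]; simp
  conv_rhs => rw [this]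
  ring

lemma Disp.sup_set (hU : Disp U N1 K μ) (h0 : 0 ≤ θ) (hθ : θ ≤ 1) (hC2 : C2 ≠ ∞)
    (hX : ∀ v w, ‖inner ℂ v w‖ₑ ≤ C2 * (X v * (‖w‖ₑ ^ (1 - θ) * MM N1 μ w ^ θ)))
    (hp : p = (1 - θ / 2)⁻¹) {F : ℝ → E} (hF : AEStronglyMeasurable F) (J : Set ℝ) :
    ‖∫ s in J, tw U F s‖ₑ ≤ C2 * b1 K μ ^ θ * (∫⁻ s, X (F s) ^ p) ^ (1 / p) := by
  set Y := ∫ s in J, tw U F s with hY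
  by_cases hY0 : Y = 0
  · simp [hY0]
  have h1 : ‖Y‖ₑ ^ 2 ≤ (C2 * b1 K μ ^ θ * (∫⁻ s, X (F s) ^ p) ^ (1 / p)) * ‖Y‖ₑ := by
    rw [enorm_sq_eq]
    calc ‖inner ℂ Y Y‖ₑ ≤ ∫⁻ s in J, ‖inner ℂ (tw U F s) Y‖ₑ := inner_integral_enorm_le _
      _ ≤ ∫⁻ s, ‖inner ℂ (tw U F s) Y‖ₑ := setLIntegral_le_lintegral _ _
      _ = ∫⁻ s, ‖inner ℂ (F s) (U s Y)‖ₑ := by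
          refine lintegral_congr fun s => ?_
          rw [tw, hU.inner_shift']
      _ ≤ _ := hU.time_holder h0 hθ hC2 hX hp hF (hU.cont Y).aestronglyMeasurable
            (b := 1 * ‖Y‖ₑ) (B := b1 K μ * ‖Y‖ₑ) (by simp)
            (ENNReal.mul_ne_top b1_ne_top (by simp)) (fun s => by rw [hU.enorm, one_mul]) (hU.T1 Y)
      _ = _ := by
          rw [scale_pow _ _ _ h0 hθ, ENNReal.one_rpow]
          ring
  rw [sq] at h1
  exact (ENNReal.mul_le_mul_iff_left (by simpa using hY0) (by simp)).1 h1

lemma Disp.sup_bound (hU : Disp U N1 K μ) (h0 : 0 ≤ θ) (hθ : θ ≤ 1) (hC2 : C2 ≠ ∞)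
    (hX : ∀ v w, ‖inner ℂ v w‖ₑ ≤ C2 * (X v * (‖w‖ₑ ^ (1 - θ) * MM N1 μ w ^ θ)))
    (hp : p = (1 - θ / 2)⁻¹) {F : ℝ → E} (hF : AEStronglyMeasurable F) (t : ℝ) :
    ‖duh U F t‖ₑ ≤ C2 * b1 K μ ^ θ * (∫⁻ s, X (F s) ^ p) ^ (1 / p) := by
  rw [hU.duh_eq, hU.enorm]
  rcases le_total 0 t with ht | ht
  · rw [intervalIntegral.integral_of_le ht]
    exact hU.sup_set h0 hθ hC2 hX hp hF _
  · rw [intervalIntegral.integral_of_ge ht, enorm_neg]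
    exact hU.sup_set h0 hθ hC2 hX hp hF _

lemma Disp.MM_fin (hU : Disp U N1 K μ) (h0 : 0 ≤ θ) (hθ : θ ≤ 1) (hC2 : C2 ≠ ∞)
    (hX : ∀ v w, ‖inner ℂ v w‖ₑ ≤ C2 * (X v * (‖w‖ₑ ^ (1 - θ) * MM N1 μ w ^ θ)))
    (hp : p = (1 - θ / 2)⁻¹) {F : ℝ → E} (hF : AEStronglyMeasurable F) (T : ℝ)
    (hT : IntegrableOn (tw U F) (Ioc 0 T)) :
    ∫⁻ t in Ioc 0 T, MM N1 μ (duh U F t) ^ 2 ≤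
      (C2 * (b1 K μ ^ (1 - θ) * C1 K μ ^ θ) * (∫⁻ s, X (F s) ^ p) ^ (1 / p)) ^ 2 := by
  set FT : ℝ → E := (Ioc 0 T).indicator (tw U F) with hFT
  have hFTi : Integrable FT := (integrable_indicator_iff measurableSet_Ioc).2 hT
  set v : ℝ → E := (Ioc 0 T).indicator fun t => U t (∫ s in Iio t, FT s) with hv
  have hvd : ∀ t ∈ Ioc 0 T, v t = duh U F t := by
    intro t ht
    rw [hv, indicator_of_mem ht, hU.duh_eq, intervalIntegral.integral_of_le ht.1.le]
    congr 1
    rw [← integral_Iic_eq_integral_Iio, hFT, setIntegral_indicator measurableSet_Ioc]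
    congr 2
    ext s
    simp only [mem_inter_iff, mem_Iic, mem_Ioc]
    constructor
    · rintro ⟨a, b, c⟩; exact ⟨b, a⟩
    · rintro ⟨a, b⟩; exact ⟨b, a, b.trans ht.2⟩
  have hcont : Continuous fun t => U t (∫ s in Iio t, FT s) :=
    hU.jointCont.comp (continuous_id.prodMk (cont_Iio hFTi))
  have hmain := hU.duality (v := v) (hcont.aestronglyMeasurable.indicator measurableSet_Ioc)
    (V := ∫ s, ‖FT s‖) ?_
    (C2 * (b1 K μ ^ (1 - θ) * C1 K μ ^ θ) * (∫⁻ s, X (F s) ^ p) ^ (1 / p)) ?_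
  · refine le_trans (le_of_eq ?_) ((setLIntegral_le_lintegral (Ioc 0 T) _).trans hmain)
    refine setLIntegral_congr_fun measurableSet_Ioc fun t ht => ?_
    rw [hvd t ht]
  · intro t
    refine (norm_indicator_le_norm_self _ _).trans ?_
    rw [hU.norm]
    exact (norm_integral_le_integral_norm _).trans (setIntegral_le_integral hFTi.norm
      (Filter.Eventually.of_forall fun _ => norm_nonneg _))
  · intro G h hG hh
    have hG' := hG.indicator (J := Ioc 0 T) measurableSet_Ioc
    set G' := (Ioc 0 T).indicator G with hGdef
    have e : ∀ t, inner ℂ (v t) (G t) = inner ℂ (∫ s in Iio t, FT s) (tw U G' t) := by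
      intro t
      rw [tw, hU.inner_shift]
      by_cases ht : t ∈ Ioc 0 T
      · rw [hv, hGdef, indicator_of_mem ht, indicator_of_mem ht]
      · rw [hv, hGdef, indicator_of_notMem ht, indicator_of_notMem ht]; simp
    simp_rw [e]
    rw [ordered_fubini hFTi (hU.rep_int hG')]
    have hn : (∫⁻ t, h t ^ 2) ^ (1 / 2 : ℝ) ≠ ∞ := ENNReal.rpow_ne_top_of_nonneg (by norm_num) hh
    calc ‖∫ s, inner ℂ (FT s) (∫ t in Ioi s, tw U G' t)‖ₑ
        ≤ ∫⁻ s, ‖inner ℂ (FT s) (∫ t in Ioi s, tw U G' t)‖ₑ := enorm_integral_le_lintegral_enorm _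
      _ ≤ ∫⁻ s, ‖inner ℂ (F s) (bw U G' s)‖ₑ := by
          refine lintegral_mono fun s => ?_
          by_cases hs : s ∈ Ioc 0 T
          · rw [hFT, indicator_of_mem hs, tw, hU.inner_shift', bw]
          · rw [hFT, indicator_of_notMem hs]; simp
      _ ≤ _ := hU.time_holder h0 hθ hC2 hX hp hF (hU.bw_cont hG').aestronglyMeasurable
            (b := b1 K μ * (∫⁻ t, h t ^ 2) ^ (1 / 2 : ℝ))
            (B := C1 K μ * (∫⁻ t, h t ^ 2) ^ (1 / 2 : ℝ))
            (ENNReal.mul_ne_top b1_ne_top hn) (ENNReal.mul_ne_top C1_ne_top hn)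
            (fun s => by rw [bw, hU.enorm]; exact hU.K2' hG' measurableSet_Ioi) (hU.T2 hG')
      _ = _ := by
          rw [scale_pow _ _ _ h0 hθ]
          ring

lemma Disp.MM_half (hU : Disp U N1 K μ) (h0 : 0 ≤ θ) (hθ : θ ≤ 1) (hC2 : C2 ≠ ∞)
    (hX : ∀ v w, ‖inner ℂ v w‖ₑ ≤ C2 * (X v * (‖w‖ₑ ^ (1 - θ) * MM N1 μ w ^ θ)))
    (hp : p = (1 - θ / 2)⁻¹) {F : ℝ → E} (hF : AEStronglyMeasurable F) :
    ∫⁻ t in Ioi 0, MM N1 μ (duh U F t) ^ 2 ≤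
      (C2 * (b1 K μ ^ (1 - θ) * C1 K μ ^ θ) * (∫⁻ s, X (F s) ^ p) ^ (1 / p)) ^ 2 := by
  set I : Set ℝ := {T | IntegrableOn (tw U F) (Ioc 0 T)} with hI
  have hdown : ∀ {a b : ℝ}, a ≤ b → b ∈ I → a ∈ I := fun {a b} hab hb =>
    hb.mono_set (Ioc_subset_Ioc_right hab)
  let ι := {r : ℚ // (r : ℝ) ∈ I}
  let J : ι → Set ℝ := fun r => Ioc 0 (r.1 : ℝ)
  have hdir : Directed (· ⊆ ·) J := by
    intro a b
    rcases le_total (a.1:ℝ) b.1 with h | h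
    · exact ⟨b, Ioc_subset_Ioc_right h, le_rfl⟩
    · exact ⟨a, le_rfl, Ioc_subset_Ioc_right h⟩
  have hle : ∫⁻ t in Ioi 0, MM N1 μ (duh U F t) ^ 2 ≤
      ∫⁻ t in ⋃ r, J r, MM N1 μ (duh U F t) ^ 2 := by
    have hss : ((I ∩ Ioi 0) \ (⋃ r, J r)).Subsingleton := by
      have : ∀ x ∈ ((I ∩ Ioi 0) \ (⋃ r, J r)), ∀ y ∈ ((I ∩ Ioi 0) \ (⋃ r, J r)), ¬ x < y := by
        rintro x ⟨⟨hx, hx0⟩, hxJ⟩ y ⟨⟨hy, hy0⟩, hyJ⟩ hxy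
        obtain ⟨r, hr1, hr2⟩ := exists_rat_btwn hxy
        exact hxJ (mem_iUnion.2 ⟨⟨r, hdown hr2.le hy⟩, ⟨hx0, hr1.le⟩⟩)
      intro x hx y hy
      exact le_antisymm (not_lt.1 (this y hy x hx)) (not_lt.1 (this x hx y hy))
    have hnull : volume ((I ∩ Ioi 0) \ (⋃ r, J r)) = 0 := hss.measure_zero _
    have hJm : MeasurableSet (⋃ r, J r) := MeasurableSet.iUnion fun r => measurableSet_Ioc
    rw [← lintegral_indicator measurableSet_Ioi, ← lintegral_indicator hJm]
    refine lintegral_mono_ae ?_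
    have hae : ∀ᵐ t, t ∉ ((I ∩ Ioi 0) \ (⋃ r, J r)) := measure_eq_zero_iff_ae_notMem.1 hnull
    filter_upwards [hae] with t ht
    by_cases h1 : t ∈ Ioi (0:ℝ)
    · rw [indicator_of_mem h1]
      by_cases h2 : t ∈ I
      · have h3 : t ∈ ⋃ r, J r := by
          by_contra h3; exact ht ⟨⟨h2, h1⟩, h3⟩
        rw [indicator_of_mem h3]
      · have : duh U F t = 0 := by
          rw [hU.duh_eq, intervalIntegral.integral_of_le (le_of_lt h1), integral_undef, map_zero]
          exact h2
        rw [this, MM_zero]; simp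
    · rw [indicator_of_notMem h1]; exact zero_le
  refine hle.trans ?_
  rw [setLIntegral_iUnion_of_directed _ hdir]
  exact iSup_le fun r => hU.MM_fin h0 hθ hC2 hX hp hF _ r.2

lemma Disp.reflect (hU : Disp U N1 K μ) : Disp (fun t => U (-t)) N1 K μ where
  norm t f := hU.norm _ f
  zero f := by rw [neg_zero]; exact hU.zero f
  add s t f := by rw [neg_add]; exact hU.add _ _ f
  cont f := (hU.cont f).comp continuous_neg
  smul := hU.smul
  zeroN := hU.zeroN
  K0 := hU.K0
  mu := hU.mu
  disp t f g ht h1 h2 := by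
    have := hU.disp (-t) f g (neg_ne_zero.2 ht) h1 h2
    rwa [abs_neg] at this

lemma duh_reflect (F : ℝ → E) (t : ℝ) :
    duh (fun t => U (-t)) (fun s => F (-s)) t = - duh U F (-t) := by
  unfold duh
  have := intervalIntegral.integral_comp_neg (a := 0) (b := t) (fun s => U (-t - s) (F s))
  rw [neg_zero] at this
  rw [intervalIntegral.integral_symm (-t) 0] at *
  rw [neg_neg, ← this]
  refine intervalIntegral.integral_congr fun s _ => ?_
  simp only
  congr 2; ring

/-- The abstract retarded Strichartz estimate. -/
theorem Disp.main (hU : Disp U N1 K μ) (h0 : 0 ≤ θ) (hθ : θ ≤ 1) (hC2 : C2 ≠ ∞)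
    (hX : ∀ v w, ‖inner ℂ v w‖ₑ ≤ C2 * (X v * (‖w‖ₑ ^ (1 - θ) * MM N1 μ w ^ θ)))
    (hp : p = (1 - θ / 2)⁻¹) {F : ℝ → E} (hF : AEStronglyMeasurable F) :
    ∫⁻ t, MM N1 μ (duh U F t) ^ 2 ≤
      2 * (C2 * (b1 K μ ^ (1 - θ) * C1 K μ ^ θ) * (∫⁻ s, X (F s) ^ p) ^ (1 / p)) ^ 2 := by
  have h1 := hU.MM_half h0 hθ hC2 hX hp hF
  have h2 := hU.reflect.MM_half h0 hθ hC2 hX hp (F := fun s => F (-s))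
    (hF.comp_quasiMeasurePreserving
      (Measure.measurePreserving_neg (volume : Measure ℝ)).quasiMeasurePreserving)
  simp_rw [duh_reflect, MM_neg] at h2
  rw [lintegral_neg_eq_self (fun s => X (F s) ^ p)] at h2
  have e : ∫⁻ t in Ioi 0, MM N1 μ (duh U F (-t)) ^ 2 = ∫⁻ t in Iio 0, MM N1 μ (duh U F t) ^ 2 := by
    rw [← lintegral_indicator measurableSet_Ioi, ← lintegral_indicator measurableSet_Iio,
      ← lintegral_neg_eq_self]
    refine lintegral_congr fun s => ?_
    simp [indicator]
  rw [e] at h2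
  have hsplit := lintegral_add_compl (μ := volume) (fun t => MM N1 μ (duh U F t) ^ 2)
    (measurableSet_Ioi (a := (0:ℝ)))
  rw [compl_Ioi, setLIntegral_congr Iio_ae_eq_Iic.symm] at hsplit
  rw [← hsplit, two_mul]
  exact add_le_add h1 h2

end main
end KT

namespace KT
open Set Filter Topology ManyBodyWaveguide

section rearr
variable {α : Type*} [MeasurableSpace α] {μ : Measure α} {f g : α → ℝ≥0∞}

lemma rearr_mem (μ : Measure α) (f : α → ℝ≥0∞) (t : ℝ≥0∞) :
    μ {x | rearr μ f t < f x} ≤ t := by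
  have hne : ({lam : ℝ≥0∞ | μ {x | lam < f x} ≤ t}).Nonempty := ⟨∞, by simp⟩
  obtain ⟨u, hu, hlim, hmem⟩ := exists_seq_tendsto_sInf hne (OrderBot.bddBelow _)
  have : {x | rearr μ f t < f x} = ⋃ n, {x | u n < f x} := by
    ext x
    simp only [mem_ofPred_eq, mem_iUnion]
    constructor
    · intro h
      exact (hlim.eventually_lt_const h).exists
    · rintro ⟨n, hn⟩
      exact lt_of_le_of_lt (sInf_le (hmem n)) hn
  rw [this, Directed.measure_iUnion]
  · exact iSup_le fun n => hmem n
  · exact directed_of_isDirected_le fun a b hab x (hx : u a < f x) => (hu hab).trans_lt hx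

lemma lt_rearr {lam t : ℝ≥0∞} : lam < rearr μ f t ↔ t < μ {x | lam < f x} := by
  constructor
  · intro h
    by_contra h'
    exact absurd (sInf_le (not_lt.1 h') : rearr μ f t ≤ lam) (not_le.2 h)
  · intro h
    by_contra h'
    refine absurd ((measure_mono fun x hx => ?_).trans (rearr_mem μ f t)) (not_le.2 h)
    exact lt_of_le_of_lt (not_lt.1 h') hx

lemma rearr_anti : Antitone (rearr μ f) := fun _ _ hst =>
  sInf_le_sInf fun _ hl => le_trans hl hst

lemma rearr_congr (h : f =ᵐ[μ] g) : rearr μ f = rearr μ g := by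
  funext t
  unfold rearr
  congr 1
  ext lam
  simp only [mem_ofPred_eq]
  rw [measure_congr]
  filter_upwards [h] with x hx
  simp only [eq_iff_iff]
  show lam < f x ↔ lam < g x
  rw [hx]

/-- the rearrangement as a function on the half line -/
def rs (μ : Measure α) (f : α → ℝ≥0∞) (t : ℝ) : ℝ≥0∞ := rearr μ f (ENNReal.ofReal t)

lemma rs_anti : Antitone (rs μ f) := fun _ _ h => rearr_anti (ENNReal.ofReal_le_ofReal h)

lemma rs_meas : Measurable (rs μ f) := rs_anti.measurable

lemma vol_lt (D : ℝ≥0∞) : (volume.restrict (Ioi (0:ℝ))) {t | ENNReal.ofReal t < D} = D := by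
  rw [Measure.restrict_apply (measurableSet_lt (by fun_prop) (by fun_prop))]
  by_cases hD : D = ∞
  · subst hD
    have : {t : ℝ | ENNReal.ofReal t < ∞} ∩ Ioi 0 = Ioi 0 := by ext; simp
    rw [this, Real.volume_Ioi]
  · have : {t : ℝ | ENNReal.ofReal t < D} ∩ Ioi 0 = Ioo 0 D.toReal := by
      ext t
      simp only [mem_inter_iff, mem_ofPred_eq, mem_Ioi, mem_Ioo]
      constructor
      · rintro ⟨h1, h2⟩
        exact ⟨h2, (ENNReal.ofReal_lt_iff_lt_toReal h2.le hD).1 h1⟩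
      · rintro ⟨h1, h2⟩
        exact ⟨(ENNReal.ofReal_lt_iff_lt_toReal h1.le hD).2 h2, h1⟩
    rw [this, Real.volume_Ioo, sub_zero, ENNReal.ofReal_toReal hD]

lemma prod_cake {β : Type*} [MeasurableSpace β] (ν : Measure β) [SFinite ν] {f g : β → ℝ≥0∞}
    (hf : Measurable f) (hg : Measurable g) :
    ∫⁻ x, f x * g x ∂ν = ∫⁻ a in Ioi (0:ℝ), ∫⁻ b in Ioi (0:ℝ),
      ν ({x | ENNReal.ofReal a < f x} ∩ {x | ENNReal.ofReal b < g x}) := by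
  have hmf : Measurable fun p : β × ℝ => ({p : β × ℝ | ENNReal.ofReal p.2 < f p.1}).indicator
      (1 : β × ℝ → ℝ≥0∞) p :=
    measurable_one.indicator (measurableSet_lt (by fun_prop) (by fun_prop))
  have hmg : Measurable fun p : β × ℝ => ({p : β × ℝ | ENNReal.ofReal p.2 < g p.1}).indicator
      (1 : β × ℝ → ℝ≥0∞) p :=
    measurable_one.indicator (measurableSet_lt (by fun_prop) (by fun_prop))
  have hmf' : Measurable (Function.uncurry fun x a => ({p : β × ℝ | ENNReal.ofReal p.2 < f p.1}).indicator
      (1 : β × ℝ → ℝ≥0∞) (x, a)) := hmf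
  have hmg' : Measurable (Function.uncurry fun x a => ({p : β × ℝ | ENNReal.ofReal p.2 < g p.1}).indicator
      (1 : β × ℝ → ℝ≥0∞) (x, a)) := hmg
  have e : ∀ (D : ℝ≥0∞), D = ∫⁻ a in Ioi (0:ℝ), ({a : ℝ | ENNReal.ofReal a < D}).indicator 1 a := by
    intro D
    rw [lintegral_indicator_one (measurableSet_lt (by fun_prop) (by fun_prop)), vol_lt]
  have e1 : ∀ x, f x * g x = ∫⁻ a in Ioi (0:ℝ), ∫⁻ b in Ioi (0:ℝ),
      ({p : β × ℝ | ENNReal.ofReal p.2 < f p.1}).indicator 1 (x, a) *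
      ({p : β × ℝ | ENNReal.ofReal p.2 < g p.1}).indicator 1 (x, b) := by
    intro x
    have h1 := e (f x)
    have h2 := e (g x)
    conv_lhs => rw [h1, h2]
    rw [← lintegral_mul_const]
    · refine lintegral_congr fun a => ?_
      rw [← lintegral_const_mul]
      · rfl
      · exact measurable_one.indicator (measurableSet_lt (by fun_prop) (by fun_prop))
    · exact measurable_one.indicator (measurableSet_lt (by fun_prop) (by fun_prop))
  simp_rw [e1]
  rw [lintegral_lintegral_swap]
  · refine lintegral_congr fun a => ?_
    rw [lintegral_lintegral_swap]
    · refine lintegral_congr fun b => ?_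
      rw [← lintegral_indicator_one ((measurableSet_lt (by fun_prop) hf).inter
        (measurableSet_lt (by fun_prop) hg))]
      refine lintegral_congr fun x => ?_
      rw [Set.inter_indicator_one]
      rfl
    · refine Measurable.aemeasurable ?_
      exact (hmf.comp (measurable_fst.prodMk measurable_const)).mul
        (hmg.comp (measurable_fst.prodMk measurable_snd))
  · refine Measurable.aemeasurable ?_
    refine Measurable.lintegral_prod_right' (f := fun q : (β × ℝ) × ℝ => 
      ({p : β × ℝ | ENNReal.ofReal p.2 < f p.1}).indicator 1 (q.1.1, q.1.2) *
      ({p : β × ℝ | ENNReal.ofReal p.2 < g p.1}).indicator 1 (q.1.1, q.2)) ?_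
    exact (hmf.comp (by fun_prop : Measurable fun q : (β × ℝ) × ℝ => (q.1.1, q.1.2))).mul
      (hmg.comp (by fun_prop : Measurable fun q : (β × ℝ) × ℝ => (q.1.1, q.2)))

lemma rs_inter (a b : ℝ≥0∞) : (volume.restrict (Ioi (0:ℝ)))
    ({t | a < rs μ f t} ∩ {t | b < rs μ g t}) = min (μ {x | a < f x}) (μ {x | b < g x}) := by
  rw [← vol_lt (min (μ {x | a < f x}) (μ {x | b < g x}))]
  congr 1
  ext t
  simp only [mem_inter_iff, mem_ofPred_eq, rs, lt_rearr, lt_min_iff]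

lemma hardy_littlewood [SFinite μ] (hf : AEMeasurable f μ) (hg : AEMeasurable g μ) :
    ∫⁻ x, f x * g x ∂μ ≤ ∫⁻ t in Ioi (0:ℝ), rs μ f t * rs μ g t := by
  have hf' := hf.ae_eq_mk
  have hg' := hg.ae_eq_mk
  have e1 : rs μ f = rs μ (hf.mk f) := by funext t; rw [rs, rearr_congr hf', rs]
  have e2 : rs μ g = rs μ (hg.mk g) := by funext t; rw [rs, rearr_congr hg', rs]
  rw [e1, e2, prod_cake _ rs_meas rs_meas,
    lintegral_congr_ae (f := fun x => f x * g x) (g := fun x => hf.mk f x * hg.mk g x) (hf'.mul hg')]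
  rw [prod_cake μ hf.measurable_mk hg.measurable_mk]
  refine lintegral_mono fun a => lintegral_mono fun b => ?_
  simp only
  rw [rs_inter]
  exact le_min (measure_mono inter_subset_left) (measure_mono inter_subset_right)

lemma rs_sq [SFinite μ] (hf : AEMeasurable f μ) :
    ∫⁻ t in Ioi (0:ℝ), rs μ f t ^ 2 = ∫⁻ x, f x ^ 2 ∂μ := by
  have hf' := hf.ae_eq_mk
  have e1 : rs μ f = rs μ (hf.mk f) := by funext t; rw [rs, rearr_congr hf', rs]
  have e2 : ∫⁻ x, f x ^ 2 ∂μ = ∫⁻ x, hf.mk f x ^ 2 ∂μ := by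
    refine lintegral_congr_ae ?_
    filter_upwards [hf'] with x hx
    rw [hx]
  rw [e1, e2]
  simp_rw [sq]
  rw [prod_cake _ rs_meas rs_meas, prod_cake μ hf.measurable_mk hf.measurable_mk]
  refine lintegral_congr fun a => lintegral_congr fun b => ?_
  rw [rs_inter]
  rcases le_total (ENNReal.ofReal a) (ENNReal.ofReal b) with h | h
  · have hs : {x | ENNReal.ofReal b < hf.mk f x} ⊆ {x | ENNReal.ofReal a < hf.mk f x} :=
      fun x hx => h.trans_lt hx
    rw [inter_eq_self_of_subset_right hs, min_eq_right (measure_mono hs)]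
  · have hs : {x | ENNReal.ofReal a < hf.mk f x} ⊆ {x | ENNReal.ofReal b < hf.mk f x} :=
      fun x hx => h.trans_lt hx
    rw [inter_eq_self_of_subset_left hs, min_eq_left (measure_mono hs)]

/-- the squared Lorentz norm -/
def LL (a : ℝ) (μ : Measure α) (f : α → ℝ≥0∞) : ℝ≥0∞ :=
  ∫⁻ t in Ioi (0:ℝ), ENNReal.ofReal t ^ (2 * a - 1) * rs μ f t ^ 2

lemma lorentz_eq (r : ℝ≥0∞) : lorentz r 2 μ f = LL (1 / r.toReal) μ f ^ (1 / 2 : ℝ) := by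
  unfold lorentz LL
  rw [if_neg (by simp)]
  simp only [ENNReal.toReal_ofNat]
  congr 1
  refine setLIntegral_congr_fun measurableSet_Ioi fun t ht => ?_
  have ht0 : ENNReal.ofReal t ≠ 0 := by simpa using ht
  rw [ENNReal.mul_rpow_of_nonneg _ _ (by norm_num), ← ENNReal.rpow_mul,
    ENNReal.rpow_sub _ _ ht0 ENNReal.ofReal_ne_top, ENNReal.rpow_one,
    ENNReal.div_eq_inv_mul, ENNReal.div_eq_inv_mul]
  rw [mul_comm (1 / r.toReal) 2, show rs μ f t = rearr μ f (ENNReal.ofReal t) from rfl]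
  rw [show (2:ℝ) = ((2:ℕ):ℝ) by norm_num, ENNReal.rpow_natCast]
  ring

lemma LL_half [SFinite μ] (hf : AEMeasurable f μ) : LL (1 / 2) μ f = ∫⁻ x, f x ^ 2 ∂μ := by
  rw [← rs_sq hf]
  unfold LL
  norm_num

lemma LL_holder [SFinite μ] (hf : AEMeasurable f μ) (hg : AEMeasurable g μ) {a b : ℝ}
    (hab : a + b = 1) :
    ∫⁻ x, f x * g x ∂μ ≤ LL a μ f ^ (1 / 2 : ℝ) * LL b μ g ^ (1 / 2 : ℝ) := by
  refine (hardy_littlewood hf hg).trans ?_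
  have e : ∫⁻ t in Ioi (0:ℝ), rs μ f t * rs μ g t = ∫⁻ t in Ioi (0:ℝ),
      (ENNReal.ofReal t ^ (a - 1 / 2) * rs μ f t) * (ENNReal.ofReal t ^ (b - 1 / 2) * rs μ g t) := by
    refine setLIntegral_congr_fun measurableSet_Ioi fun t ht => ?_
    have ht0 : ENNReal.ofReal t ≠ 0 := by simpa using ht
    have : ENNReal.ofReal t ^ (a - 1 / 2) * ENNReal.ofReal t ^ (b - 1 / 2) = 1 := by
      rw [← ENNReal.rpow_add _ _ ht0 ENNReal.ofReal_ne_top,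
        show a - 1 / 2 + (b - 1 / 2) = 0 by linarith, ENNReal.rpow_zero]
    calc _ = (ENNReal.ofReal t ^ (a - 1 / 2) * ENNReal.ofReal t ^ (b - 1 / 2)) *
        (rs μ f t * rs μ g t) := by rw [this, one_mul]
      _ = _ := by ring
  rw [e]
  refine (lintegral_mul_cs _ ?_ ?_).trans (le_of_eq ?_)
  · exact ((ENNReal.measurable_ofReal.pow_const _).mul rs_meas).aemeasurable
  · exact ((ENNReal.measurable_ofReal.pow_const _).mul rs_meas).aemeasurable
  · unfold LL
    simp_rw [mul_pow]
    have k : ∀ (c : ℝ) (t : ℝ), (ENNReal.ofReal t ^ (c - 1 / 2)) ^ 2 =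
        ENNReal.ofReal t ^ (2 * c - 1) := by
      intro c t
      rw [← ENNReal.rpow_natCast, ← ENNReal.rpow_mul]
      congr 1; push_cast; ring
    simp_rw [k]

lemma LL_conv {a0 a1 a θ : ℝ} (h0 : 0 ≤ θ) (h1 : θ ≤ 1) (ha : a = (1 - θ) * a0 + θ * a1) :
    LL a μ f ≤ LL a0 μ f ^ (1 - θ) * LL a1 μ f ^ θ := by
  unfold LL
  refine le_trans (le_of_eq ?_) (ENNReal.lintegral_mul_norm_pow_le
    ((ENNReal.measurable_ofReal.pow_const _).mul (rs_meas.pow_const 2)).aemeasurable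
    ((ENNReal.measurable_ofReal.pow_const _).mul (rs_meas.pow_const 2)).aemeasurable
    (by linarith : 0 ≤ 1 - θ) h0 (by ring))
  refine setLIntegral_congr_fun measurableSet_Ioi fun t ht => ?_
  have ht0 : ENNReal.ofReal t ≠ 0 := by simpa using ht
  simp only [Pi.mul_apply]
  rw [ENNReal.mul_rpow_of_nonneg _ _ (by linarith), ENNReal.mul_rpow_of_nonneg _ _ h0,
    ← ENNReal.rpow_mul, ← ENNReal.rpow_mul]
  have e1 : rs μ f t ^ 2 = (rs μ f t ^ 2) ^ (1 - θ) * (rs μ f t ^ 2) ^ θ := by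
    rw [← ENNReal.rpow_add_of_nonneg _ _ (by linarith) h0]; simp
  have e2 : ENNReal.ofReal t ^ (2 * a - 1) =
      ENNReal.ofReal t ^ ((2 * a0 - 1) * (1 - θ)) * ENNReal.ofReal t ^ ((2 * a1 - 1) * θ) := by
    rw [← ENNReal.rpow_add _ _ ht0 ENNReal.ofReal_ne_top]
    congr 1; rw [ha]; ring
  conv_lhs => rw [e1, e2]
  ring

end rearr

/-- subsets of prescribed measure -/
lemma exists_subset_eq {m : ℕ} (hm : 3 ≤ m) {S : Set (Fin m → ℝ)} (hS : MeasurableSet S)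
    {c : ℝ} (hc : 0 < c) (h : ENNReal.ofReal c < volume S) :
    ∃ B ⊆ S, MeasurableSet B ∧ volume B = ENNReal.ofReal c := by
  have : Nonempty (Fin m) := ⟨⟨0, by omega⟩⟩
  obtain ⟨S', hS'm, hsub, hlt, hfin⟩ := Measure.exists_subset_measure_lt_top hS h
  let g : ℝ → ℝ := fun R => ∫ x in S', ({x : Fin m → ℝ | ‖x‖ ≤ R}).indicator (fun _ => (1:ℝ)) x
  have : IsFiniteMeasure (volume.restrict S') := ⟨by rw [Measure.restrict_apply_univ]; exact hfin⟩
  have hms : ∀ R : ℝ, MeasurableSet {x : Fin m → ℝ | ‖x‖ ≤ R} := fun R =>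
    measurableSet_le measurable_norm measurable_const
  have hgc : Continuous g := by
    rw [continuous_iff_continuousAt]
    intro R
    refine continuousAt_of_dominated (bound := fun _ => 1) ?_ ?_ (integrable_const _) ?_
    · exact Eventually.of_forall fun R => (measurable_const.indicator (hms R)).aestronglyMeasurable
    · refine Eventually.of_forall fun R => Eventually.of_forall fun x => ?_
      by_cases hx : x ∈ {x : Fin m → ℝ | ‖x‖ ≤ R}
      · rw [indicator_of_mem hx]; simp
      · rw [indicator_of_notMem hx]; simp
    · have : ∀ᵐ x : Fin m → ℝ, x ∉ Metric.sphere 0 R :=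
        measure_eq_zero_iff_ae_notMem.1 (Measure.addHaar_sphere _ _ _)
      filter_upwards [ae_restrict_of_ae this] with x hx
      have hx' : ‖x‖ ≠ R := by simpa using hx
      rcases lt_or_gt_of_ne hx' with h | h
      · have : (fun R' => ({x : Fin m → ℝ | ‖x‖ ≤ R'}).indicator (fun _ => (1:ℝ)) x) =ᶠ[𝓝 R]
            fun _ => 1 := by
          filter_upwards [lt_mem_nhds h] with R' hR'
          exact indicator_of_mem (show x ∈ {x : Fin m → ℝ | ‖x‖ ≤ R'} from le_of_lt hR') _
        exact continuousAt_const.congr this.symm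
      · have : (fun R' => ({x : Fin m → ℝ | ‖x‖ ≤ R'}).indicator (fun _ => (1:ℝ)) x) =ᶠ[𝓝 R]
            fun _ => 0 := by
          filter_upwards [gt_mem_nhds h] with R' hR'
          exact indicator_of_notMem
            (show x ∉ {x : Fin m → ℝ | ‖x‖ ≤ R'} from not_le.2 hR') _
        exact continuousAt_const.congr this.symm
  have hg : ∀ R, ENNReal.ofReal (g R) = volume (S' ∩ {x | ‖x‖ ≤ R}) := by
    intro R
    simp only [g]
    rw [integral_indicator (hms R)]
    simp only [integral_const, smul_eq_mul, mul_one]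
    rw [Measure.real, ENNReal.ofReal_toReal (measure_ne_top _ _), Measure.restrict_apply_univ,
      Measure.restrict_apply (hms R), inter_comm]
  have hbig : ∃ R, c < g R := by
    have hU : S' = ⋃ k : ℕ, S' ∩ {x | ‖x‖ ≤ (k:ℝ)} := by
      rw [← inter_iUnion]
      refine (inter_eq_left.2 fun x _ => ?_).symm
      obtain ⟨k, hk⟩ := exists_nat_ge ‖x‖
      exact mem_iUnion.2 ⟨k, hk⟩
    rw [hU, Directed.measure_iUnion, lt_iSup_iff] at hlt
    · obtain ⟨k, hk⟩ := hlt
      refine ⟨k, ?_⟩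
      rw [← hg] at hk
      exact (ENNReal.ofReal_lt_ofReal_iff_of_nonneg hc.le).1 hk
    · exact directed_of_isDirected_le fun a b hab => inter_subset_inter_right _
        fun x (hx : ‖x‖ ≤ a) => hx.trans (by exact_mod_cast hab)
  have hsmall : g (-1) ≤ c := by
    have : g (-1) = 0 := by
      simp only [g]
      have : {x : Fin m → ℝ | ‖x‖ ≤ -1} = ∅ := by
        ext x; simp; linarith [norm_nonneg x]
      rw [this]; simp
    rw [this]; exact hc.le
  obtain ⟨R1, hR1⟩ := hbig
  obtain ⟨R, hR⟩ : ∃ R, g R = c := mem_range_of_exists_le_of_exists_ge hgc ⟨_, hsmall⟩ ⟨_, hR1.le⟩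
  exact ⟨S' ∩ {x | ‖x‖ ≤ R}, inter_subset_left.trans hsub, hS'm.inter (hms R), by rw [← hg, hR]⟩

end KT

namespace KT
open Set Filter Topology ManyBodyWaveguide

section D0
variable {E : Type*} [NormedAddCommGroup E] [InnerProductSpace ℂ E]

/-- cut property of `v` with amplitude function `f` -/
def Cut {m : ℕ} (N1 : E → ℝ≥0∞) (f : (Fin m → ℝ) → ℝ≥0∞) (v : E) : Prop :=
  ∀ (τ : ℝ) (B : Set (Fin m → ℝ)) (c : ℝ), 0 ≤ τ → MeasurableSet B →
    B ⊆ {y | ENNReal.ofReal τ < f y} → 0 < c → volume B = ENNReal.ofReal c →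
    ∃ a : E, ‖a‖ ^ 2 ≤ c ∧ (∀ s : ℝ, 0 ≤ s → N1 (s • a) ≤ ENNReal.ofReal (s * c)) ∧
      τ * c ≤ (inner ℂ v a).re

variable {m : ℕ} {N1 : E → ℝ≥0∞} {f : (Fin m → ℝ) → ℝ≥0∞} {v : E}

lemma rs_fin {α : Type*} [MeasurableSpace α] {μ : Measure α} [SFinite μ] {f : α → ℝ≥0∞}
    (hf : AEMeasurable f μ)
    (hfin : ∫⁻ y, f y ^ 2 ∂μ ≠ ∞) {x : ℝ} (hx : 0 < x) : rs μ f x ≠ ∞ := by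
  intro h
  rw [← rs_sq hf] at hfin
  refine hfin (top_le_iff.1 ?_)
  calc (∞ : ℝ≥0∞) = ∫⁻ t in Ioc 0 x, ∞ := by
        rw [setLIntegral_const, Real.volume_Ioc, ENNReal.top_mul]
        simpa using hx
    _ ≤ ∫⁻ t in Ioc 0 x, rs μ f t ^ 2 := by
        refine setLIntegral_mono' measurableSet_Ioc fun t ht => ?_
        have : rs μ f t = ∞ := top_le_iff.1 (h ▸ rs_anti ht.2)
        rw [this]; simp
    _ ≤ _ := lintegral_mono_set Ioc_subset_Ioi_self

lemma atom_k (hm : 3 ≤ m) (hf : Measurable f) (hfin : ∫⁻ y, f y ^ 2 ≠ ∞) (hcut : Cut N1 f v)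
    (hz : N1 0 = 0) {x : ℝ} (k : ℤ) (hx : x = (2:ℝ) ^ ((m:ℝ) / 2 * k)) :
    ∃ a : E, IsAtom N1 ((m:ℝ) / 2) k a ∧
      x ^ (1 / 2 - 1 / (m:ℝ)) * (rs volume f x).toReal / 2 ≤ (inner ℂ v a).re := by
  have hx0 : 0 < x := by rw [hx]; positivity
  have hm0 : (0:ℝ) < m := by positivity
  have hfin' := rs_fin hf.aemeasurable hfin hx0
  by_cases h0 : rs volume f x = 0
  · refine ⟨0, ⟨by rw [norm_zero]; positivity, by rw [hz]; exact zero_le⟩, ?_⟩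
    rw [h0]; simp
  set T := (rs volume f x).toReal with hT
  have hT0 : 0 < T := ENNReal.toReal_pos h0 hfin'
  have hlt : ENNReal.ofReal (T / 2) < rs volume f x := by
    rw [← ENNReal.ofReal_toReal hfin', ← hT]
    exact (ENNReal.ofReal_lt_ofReal_iff hT0).2 (by linarith)
  rw [rs, lt_rearr] at hlt
  obtain ⟨B, hBs, hBm, hB⟩ := exists_subset_eq hm (measurableSet_lt measurable_const hf) hx0 hlt
  obtain ⟨a, ha1, ha2, ha3⟩ := hcut (T / 2) B x (by positivity) hBm hBs hx0 hB
  set c := x ^ (-(1 / 2 + 1 / (m:ℝ))) with hc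
  have hc0 : 0 < c := by positivity
  have hcx : c * x = x ^ (1 / 2 - 1 / (m:ℝ)) := by
    rw [hc]
    nth_rewrite 2 [← Real.rpow_one x]
    rw [← Real.rpow_add hx0]
    congr 1; ring
  refine ⟨c • a, ⟨?_, ?_⟩, ?_⟩
  · rw [norm_smul, Real.norm_of_nonneg hc0.le]
    have h1 : ‖a‖ ≤ x ^ (1 / 2 : ℝ) := by
      rw [← Real.sqrt_eq_rpow]
      exact Real.le_sqrt_of_sq_le ha1
    calc c * ‖a‖ ≤ c * x ^ (1 / 2 : ℝ) := by gcongr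
      _ = (2:ℝ) ^ (-(k:ℝ) / 2) := by
        rw [hc, ← Real.rpow_add hx0, hx, ← Real.rpow_mul (by norm_num)]
        congr 1; field_simp; ring
  · refine (ha2 c hc0.le).trans (le_of_eq ?_)
    rw [hcx, hx, ← Real.rpow_mul (by norm_num)]
    congr 2; field_simp
  · have : (inner ℂ v (c • a)).re = c * (inner ℂ v a).re := by
      rw [← Complex.coe_smul, inner_smul_right]; simp
    rw [this]
    calc _ = c * (T / 2 * x) := by rw [← hcx]; ring
      _ ≤ _ := by gcongr

lemma sum_le_MM (hm : 3 ≤ m) (hf : Measurable f) (hfin : ∫⁻ y, f y ^ 2 ≠ ∞) (hcut : Cut N1 f v)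
    (hz : N1 0 = 0) (s : ℤ → ℝ)
    (hs : ∀ k, s k = ((2:ℝ) ^ ((m:ℝ) / 2 * k)) ^ (1 / 2 - 1 / (m:ℝ)) *
      (rs volume f ((2:ℝ) ^ ((m:ℝ) / 2 * k))).toReal) (S : Finset ℤ) :
    ∑ k ∈ S, ENNReal.ofReal (s k ^ 2) ≤ 4 * MM N1 ((m:ℝ) / 2) v ^ 2 := by
  choose a ha1 ha2 using fun k : ℤ => atom_k hm hf hfin hcut hz k rfl
  rw [← ENNReal.ofReal_sum_of_nonneg fun k _ => sq_nonneg _]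
  set A := ∑ k ∈ S, s k ^ 2 with hA
  have hA0 : 0 ≤ A := Finset.sum_nonneg fun k _ => sq_nonneg _
  rcases hA0.eq_or_lt with h | hpos
  · rw [← h]; simp
  have hq : 0 < √A := Real.sqrt_pos.2 hpos
  have hqq : √A * √A = A := Real.mul_self_sqrt hA0
  set g : E := ∑ k ∈ S, (s k / √A) • a k with hg
  have hgG : g ∈ GG N1 ((m:ℝ) / 2) := by
    refine ⟨S, fun k => s k / √A, a, ha1, rfl, ?_⟩
    have : ∀ k, ‖s k / √A‖ₑ ^ 2 = ENNReal.ofReal (s k ^ 2 / A) := by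
      intro k
      rw [← ofReal_norm, ← ENNReal.ofReal_pow (norm_nonneg _), Real.norm_eq_abs, sq_abs, div_pow,
        Real.sq_sqrt hA0]
    simp_rw [this]
    rw [← ENNReal.ofReal_sum_of_nonneg fun k _ => by positivity, ← Finset.sum_div, ← hA,
      div_self hpos.ne']
    simp
  have hre : √A / 2 ≤ (inner ℂ v g).re := by
    have e : (inner ℂ v g).re = ∑ k ∈ S, s k / √A * (inner ℂ v (a k)).re := by
      rw [hg, inner_sum, Complex.re_sum]
      refine Finset.sum_congr rfl fun k _ => ?_
      rw [← Complex.coe_smul, inner_smul_right, Complex.re_ofReal_mul]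
    rw [e]
    calc √A / 2 = ∑ k ∈ S, s k / √A * (s k / 2) := by
          have : ∀ k, s k / √A * (s k / 2) = s k ^ 2 * (1 / (2 * √A)) := by
            intro k; field_simp
          simp_rw [this]
          rw [← Finset.sum_mul, ← hA]
          field_simp
          rw [sq, hqq]
      _ ≤ _ := by
          refine Finset.sum_le_sum fun k _ => mul_le_mul_of_nonneg_left ?_ ?_
          · rw [hs k]; exact ha2 k
          · rw [hs k]; positivity
  have hMM : ENNReal.ofReal (√A / 2) ≤ MM N1 ((m:ℝ) / 2) v := by
    refine le_trans ?_ (le_iSup₂ (f := fun g (_ : g ∈ GG N1 ((m:ℝ) / 2)) => ‖inner ℂ v g‖ₑ) g hgG)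
    rw [← ofReal_norm]
    exact ENNReal.ofReal_le_ofReal (hre.trans (Complex.re_le_norm _))
  calc ENNReal.ofReal A = 4 * ENNReal.ofReal (√A / 2) ^ 2 := by
        rw [← ENNReal.ofReal_pow (by positivity), show (4:ℝ≥0∞) = ENNReal.ofReal 4 by simp,
          ← ENNReal.ofReal_mul (by norm_num)]
        congr 1
        nlinarith
    _ ≤ _ := by gcongr

/-- the constant -/
def cD (m : ℕ) : ℝ≥0∞ := ENNReal.ofReal ((2:ℝ) ^ ((m:ℝ) / 2) - 1) * 4

lemma cD_ne_top : cD m ≠ ∞ := ENNReal.mul_ne_top ENNReal.ofReal_ne_top (by simp)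

lemma D0 (hm : 3 ≤ m) (hf : Measurable f) (hfin : ∫⁻ y, f y ^ 2 ≠ ∞) (hcut : Cut N1 f v)
    (hz : N1 0 = 0) :
    LL (1 / 2 - 1 / (m:ℝ)) volume f ≤ cD m * MM N1 ((m:ℝ) / 2) v ^ 2 := by
  set ρ : ℝ := (2:ℝ) ^ ((m:ℝ) / 2) with hρ
  have hm0 : (0:ℝ) < m := by positivity
  have hρ1 : 1 < ρ := Real.one_lt_rpow (by norm_num) (by positivity)
  have hρ0 : 0 < ρ := by linarith
  have hpw : ∀ k : ℤ, (2:ℝ) ^ ((m:ℝ) / 2 * k) = ρ ^ k := fun k => by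
    rw [Real.rpow_mul (by norm_num), Real.rpow_intCast]
  set s : ℤ → ℝ := fun k => ((2:ℝ) ^ ((m:ℝ) / 2 * k)) ^ (1 / 2 - 1 / (m:ℝ)) *
      (rs volume f ((2:ℝ) ^ ((m:ℝ) / 2 * k))).toReal with hs
  have hcov : Ioi (0:ℝ) ⊆ ⋃ k : ℤ, Ioc (ρ ^ k) (ρ ^ (k + 1)) := fun x hx => by
    obtain ⟨k, hk⟩ := exists_mem_Ioc_zpow hx hρ1
    exact mem_iUnion.2 ⟨k, hk⟩
  have hpiece : ∀ k : ℤ, ∫⁻ t in Ioc (ρ ^ k) (ρ ^ (k + 1)),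
      ENNReal.ofReal t ^ (2 * (1 / 2 - 1 / (m:ℝ)) - 1) * rs volume f t ^ 2 ≤
      ENNReal.ofReal (ρ - 1) * ENNReal.ofReal (s k ^ 2) := by
    intro k
    have hx0 : 0 < ρ ^ k := by positivity
    have hfin' := rs_fin hf.aemeasurable hfin hx0
    calc _ ≤ ∫⁻ t in Ioc (ρ ^ k) (ρ ^ (k + 1)),
          ENNReal.ofReal ((ρ ^ k) ^ (-2 / (m:ℝ)) * (rs volume f (ρ ^ k)).toReal ^ 2) := by
          refine setLIntegral_mono' measurableSet_Ioc fun t ht => ?_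
          rw [ENNReal.ofReal_mul (by positivity), ENNReal.ofReal_pow ENNReal.toReal_nonneg,
            ENNReal.ofReal_toReal hfin']
          have ht0 : 0 < t := hx0.trans ht.1
          gcongr
          · rw [ENNReal.ofReal_rpow_of_pos ht0]
            refine ENNReal.ofReal_le_ofReal ?_
            rw [show 2 * (1 / 2 - 1 / (m:ℝ)) - 1 = -2 / m by ring]
            refine Real.rpow_le_rpow_of_nonpos hx0 ht.1.le ?_
            exact div_nonpos_of_nonpos_of_nonneg (by norm_num) hm0.le
          · exact rs_anti ht.1.le
      _ = _ := by
          rw [setLIntegral_const, Real.volume_Ioc, ← ENNReal.ofReal_mul (by positivity),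
            ← ENNReal.ofReal_mul (by linarith)]
          congr 1
          have h2 : ((ρ ^ k) ^ (1 / 2 - 1 / (m:ℝ))) ^ 2 = ρ ^ k * (ρ ^ k) ^ (-2 / (m:ℝ)) := by
            rw [← Real.rpow_natCast, ← Real.rpow_mul hx0.le]
            nth_rewrite 2 [← Real.rpow_one (ρ ^ k)]
            rw [← Real.rpow_add hx0]
            congr 1; push_cast; ring
          simp only [hs]
          rw [hpw, mul_pow, h2, zpow_add_one₀ hρ0.ne']
          ring
  unfold LL
  calc _ ≤ ∫⁻ t in ⋃ k : ℤ, Ioc (ρ ^ k) (ρ ^ (k + 1)),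
        ENNReal.ofReal t ^ (2 * (1 / 2 - 1 / (m:ℝ)) - 1) * rs volume f t ^ 2 :=
        lintegral_mono_set hcov
    _ ≤ ∑' k : ℤ, ∫⁻ t in Ioc (ρ ^ k) (ρ ^ (k + 1)),
        ENNReal.ofReal t ^ (2 * (1 / 2 - 1 / (m:ℝ)) - 1) * rs volume f t ^ 2 :=
        lintegral_iUnion_le _ _
    _ ≤ ∑' k : ℤ, ENNReal.ofReal (ρ - 1) * ENNReal.ofReal (s k ^ 2) := ENNReal.tsum_le_tsum hpiece
    _ = ENNReal.ofReal (ρ - 1) * ∑' k : ℤ, ENNReal.ofReal (s k ^ 2) := ENNReal.tsum_mul_left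
    _ ≤ ENNReal.ofReal (ρ - 1) * (4 * MM N1 ((m:ℝ) / 2) v ^ 2) := by
        gcongr
        rw [ENNReal.tsum_eq_iSup_sum]
        exact iSup_le fun S => sum_le_MM hm hf hfin hcut hz s (fun k => rfl) S
    _ = _ := by rw [cD, mul_assoc]

end D0
end KT

namespace KT
open Set Filter Topology ManyBodyWaveguide

variable {m n N : ℕ}

/-- configurations from the `y_α` component and everything else -/
def gl (α : Fin N) (p : (Fin m → ℝ) × (Torus n × Hat m n N α)) : Cfg m n N :=
  glue m n N α (p.1, p.2.1) p.2.2

lemma gl_alpha (α : Fin N) (p : (Fin m → ℝ) × (Torus n × Hat m n N α)) :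
    gl α p α = (p.1, p.2.1) := by simp [gl, glue]

lemma gl_ne (α : Fin N) (p : (Fin m → ℝ) × (Torus n × Hat m n N α)) (β : Fin N) (h : β ≠ α) :
    gl α p β = p.2.2 ⟨β, h⟩ := by simp [gl, glue, h]

instance sfin_wg : SigmaFinite (volume : Measure (Wg m n)) := by
  rw [Measure.volume_eq_prod]; infer_instance

instance sfin_W (α : Fin N) : SigmaFinite (volume : Measure (Torus n × Hat m n N α)) := by
  rw [Measure.volume_eq_prod]; infer_instance

instance sfin_cfg : SigmaFinite (volume : Measure (Cfg m n N)) := by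
  rw [volume_pi]; infer_instance

lemma meas_slice {X Y Z : Type*} [MeasurableSpace X] [MeasurableSpace Y] [MeasurableSpace Z]
    {f : X × Y → Z} (hf : Measurable f) (x : X) : Measurable fun y => f (x, y) :=
  hf.comp (measurable_const.prodMk measurable_id)

/-- the measurable equivalence -/
def glE (m n : ℕ) {N : ℕ} (α : Fin N) :
    ((Fin m → ℝ) × (Torus n × Hat m n N α)) ≃ᵐ Cfg m n N :=
  (MeasurableEquiv.prodAssoc.symm.trans
    ((MeasurableEquiv.prodCongr
      (MeasurableEquiv.piUnique (fun _ : {β : Fin N // β = α} => Wg m n)).symm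
      (MeasurableEquiv.refl (Hat m n N α))))).trans
    (MeasurableEquiv.piEquivPiSubtypeProd (fun _ : Fin N => Wg m n) (fun β => β = α)).symm

lemma glE_apply (α : Fin N) (p : (Fin m → ℝ) × (Torus n × Hat m n N α)) :
    glE m n α p = gl α p := by
  funext β
  by_cases h : β = α
  · subst h
    rw [gl_alpha]
    simp [glE, MeasurableEquiv.piEquivPiSubtypeProd, MeasurableEquiv.piUnique,
      MeasurableEquiv.prodAssoc, MeasurableEquiv.prodCongr]
  · rw [gl_ne _ _ _ h]
    simp [glE, MeasurableEquiv.piEquivPiSubtypeProd, MeasurableEquiv.piUnique,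
      MeasurableEquiv.prodAssoc, MeasurableEquiv.prodCongr, h]

lemma glE_mp (α : Fin N) : MeasurePreserving (glE m n α) := by
  have h1 : MeasurePreserving (MeasurableEquiv.prodAssoc.symm :
      (Fin m → ℝ) × (Torus n × Hat m n N α) ≃ᵐ Wg m n × Hat m n N α) :=
    volume_preserving_prodAssoc.symm
  have h0 := (volume_preserving_piUnique (fun _ : {β : Fin N // β = α} => Wg m n)).symm
  rw [Subsingleton.elim (Fintype.subtypeEq α) (Subtype.fintype fun β => β = α)] at h0
  have h2 := h0.prod
    (MeasurePreserving.id (volume : Measure (Hat m n N α)))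
  have h3 := (volume_preserving_piEquivPiSubtypeProd (fun _ : Fin N => Wg m n)
    (fun β => β = α)).symm
  have h4 := h3.comp (h2.comp h1)
  exact h4

lemma gl_meas (α : Fin N) : Measurable (gl (m := m) (n := n) α) := by
  have : gl (m := m) (n := n) α = glE m n α := by funext p; rw [glE_apply]
  rw [this]; exact (glE m n α).measurable

lemma gl_mp (α : Fin N) : MeasurePreserving (gl (m := m) (n := n) α) := by
  have : gl (m := m) (n := n) α = glE m n α := by funext p; rw [glE_apply]
  rw [this]; exact glE_mp α

lemma lint_gl (α : Fin N) {F : Cfg m n N → ℝ≥0∞} (hF : Measurable F) :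
    ∫⁻ x, F x = ∫⁻ y, ∫⁻ w, F (gl α (y, w)) := by
  rw [← (gl_mp α).lintegral_comp hF, Measure.volume_eq_prod,
    lintegral_prod (fun p => F (gl α p)) (hF.comp (gl_meas α)).aemeasurable]

lemma gl_ae (α : Fin N) {p : Cfg m n N → Prop} (h : ∀ᵐ x, p x) :
    ∀ᵐ y, ∀ᵐ w, p (gl α (y, w)) := by
  have := (gl_mp (m := m) (n := n) α).quasiMeasurePreserving.tendsto_ae.eventually h
  rw [Measure.volume_eq_prod] at this
  exact Measure.ae_ae_of_ae_prod this

/-- the amplitude in the variable `y_α` -/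
def amp (α : Fin N) (g : Cfg m n N → ℂ) (y : Fin m → ℝ) : ℝ≥0∞ :=
  (∫⁻ w : Torus n × Hat m n N α, ‖g (gl α (y, w))‖ₑ ^ 2) ^ (1 / 2 : ℝ)

lemma amp_sq (α : Fin N) (g : Cfg m n N → ℂ) (y : Fin m → ℝ) :
    amp α g y ^ 2 = ∫⁻ w, ‖g (gl α (y, w))‖ₑ ^ 2 := by
  rw [amp, ← ENNReal.rpow_natCast, ← ENNReal.rpow_mul]; norm_num

lemma amp_congr (α : Fin N) {g g' : Cfg m n N → ℂ} (h : g =ᵐ[volume] g') :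
    amp α g =ᵐ[volume] amp α g' := by
  filter_upwards [gl_ae α h] with y hy
  unfold amp
  congr 1
  refine lintegral_congr_ae ?_
  filter_upwards [hy] with w hw
  rw [hw]

lemma amp_meas (α : Fin N) {g : Cfg m n N → ℂ} (h : Measurable g) : Measurable (amp α g) := by
  unfold amp
  refine Measurable.pow_const ?_ _
  refine Measurable.lintegral_prod_right' (f := fun p => ‖g (gl α p)‖ₑ ^ 2) ?_
  exact (h.comp (gl_meas α)).enorm.pow_const 2

lemma amp_int (α : Fin N) {g : Cfg m n N → ℂ} (h : Measurable g) :
    ∫⁻ y, amp α g y ^ 2 = ∫⁻ x, ‖g x‖ₑ ^ 2 := by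
  simp_rw [amp_sq]
  rw [lint_gl α (h.enorm.pow_const 2)]

lemma amp_eq (α : Fin N) {g : Cfg m n N → ℂ} (hg : Measurable g) (y : Fin m → ℝ) :
    (eN 2 volume fun zα : Torus n =>
        eLpNorm (fun h : Hat m n N α => g (glue m n N α (y, zα) h)) 2 volume) = amp α g y := by
  unfold eN amp
  rw [if_neg (by simp)]
  simp only [ENNReal.toReal_ofNat]
  congr 1
  rw [Measure.volume_eq_prod, lintegral_prod (fun w => ‖g (gl α (y, w))‖ₑ ^ 2)
    (meas_slice (hg.comp (gl_meas α)).enorm y |>.pow_const 2).aemeasurable]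
  refine lintegral_congr fun z => ?_
  rw [eLpNorm_eq_lintegral_rpow_enorm_toReal (by simp) (by simp)]
  simp only [ENNReal.toReal_ofNat]
  rw [← ENNReal.rpow_mul]
  norm_num
  rfl

lemma amp_mul (α : Fin N) (c : (Fin m → ℝ) → ℂ) (g : Cfg m n N → ℂ) (hg : Measurable g)
    (y : Fin m → ℝ) : amp α (fun x => c (x α).1 * g x) y = ‖c y‖ₑ * amp α g y := by
  unfold amp
  simp_rw [gl_alpha, enorm_mul, mul_pow]
  rw [lintegral_const_mul (f := fun w => ‖g (gl α (y, w))‖ₑ ^ 2) _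
    (meas_slice (hg.comp (gl_meas α)).enorm y |>.pow_const 2),
    ENNReal.mul_rpow_of_nonneg _ _ (by norm_num), ← ENNReal.rpow_natCast, ← ENNReal.rpow_mul]
  norm_num

lemma l2_meas (v : L2 m n N) : Measurable v := (Lp.stronglyMeasurable v).measurable

lemma l2_enorm (v : L2 m n N) : ‖v‖ₑ ^ 2 = ∫⁻ x, ‖v x‖ₑ ^ 2 := by
  rw [Lp.enorm_def, eLpNorm_eq_lintegral_rpow_enorm_toReal (by simp) (by simp)]
  simp only [ENNReal.toReal_ofNat]
  rw [← ENNReal.rpow_natCast, ← ENNReal.rpow_mul]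
  norm_num

lemma amp_norm (α : Fin N) (v : L2 m n N) : ∫⁻ y, amp α v y ^ 2 = ‖v‖ₑ ^ 2 := by
  rw [amp_int α (l2_meas v), l2_enorm]

lemma amp_fin (α : Fin N) (v : L2 m n N) : ∫⁻ y, amp α v y ^ 2 ≠ ∞ := by
  rw [amp_norm]; simp

lemma inner_amp (α : Fin N) (v w : L2 m n N) :
    ‖inner ℂ v w‖ₑ ≤ ∫⁻ y, amp α v y * amp α w y := by
  rw [L2.inner_def]
  refine (enorm_integral_le_lintegral_enorm _).trans ?_
  have : ∀ x, ‖inner ℂ (v x) (w x)‖ₑ = ‖v x‖ₑ * ‖w x‖ₑ := by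
    intro x; rw [RCLike.inner_apply, enorm_mul, RCLike.enorm_conj, mul_comm]
  simp_rw [this]
  rw [lint_gl α (F := fun x => ‖v x‖ₑ * ‖w x‖ₑ) ((l2_meas v).enorm.mul (l2_meas w).enorm)]
  refine lintegral_mono fun y => ?_
  have h := fun u : L2 m n N => ((l2_meas u).comp ((gl_meas α).comp
    (measurable_const.prodMk measurable_id : Measurable fun w => (y, w)))).enorm.aemeasurable
      (μ := volume)
  exact lintegral_mul_cs _ (h v) (h w)

/-- the `L^1_{y_α} L^2` norm -/
def N1 (α : Fin N) (v : L2 m n N) : ℝ≥0∞ := ∫⁻ y, amp α v y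

lemma N1_congr (α : Fin N) {v : L2 m n N} {g : Cfg m n N → ℂ} (h : v =ᵐ[volume] g) :
    N1 α v = ∫⁻ y, amp α g y := lintegral_congr_ae (amp_congr α h)

lemma N1_smul (α : Fin N) (z : ℂ) (v : L2 m n N) : N1 α (z • v) = ‖z‖ₑ * N1 α v := by
  rw [N1_congr α (g := fun x => (fun _ => z) (x α).1 * v x)]
  · simp_rw [amp_mul α (fun _ => z) v (l2_meas v)]
    rw [lintegral_const_mul _ (amp_meas α (l2_meas v))]; rfl
  · filter_upwards [Lp.coeFn_smul z v] with x hx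
    rw [hx]; rfl

lemma N1_zero (α : Fin N) : N1 α (0 : L2 m n N) = 0 := by
  rw [← zero_smul ℂ (0 : L2 m n N), N1_smul]; simp

lemma cut (α : Fin N) (v : L2 m n N) : Cut (N1 α) (amp α v) v := by
  intro τ B c hτ hB hBs hc hvol
  set f := amp α v with hf
  have hfm : Measurable f := amp_meas α (l2_meas v)
  set k : (Fin m → ℝ) → ℝ := fun y => B.indicator (fun y => (f y).toReal⁻¹) y with hk
  have hkm : Measurable k := hfm.ennreal_toReal.inv.indicator hB
  have hk0 : ∀ y, 0 ≤ k y := fun y => indicator_nonneg (fun _ _ => by positivity) y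
  set a0 : Cfg m n N → ℂ := fun x => (fun y => (k y : ℂ)) (x α).1 * v x with ha0
  have hpr : Measurable fun x : Cfg m n N => (x α).1 := by fun_prop
  have ha0m : Measurable a0 :=
    ((Complex.measurable_ofReal.comp hkm).comp hpr).mul (l2_meas v)
  have hke : ∀ y, ‖(k y : ℂ)‖ₑ = ENNReal.ofReal (k y) := fun y => by
    rw [← ofReal_norm, Complex.norm_real, Real.norm_of_nonneg (hk0 y)]
  have hkf : ∀ y, ENNReal.ofReal (k y) * f y ≤ B.indicator 1 y := by
    intro y
    by_cases hy : y ∈ B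
    · rw [indicator_of_mem hy, hk]
      simp only
      rw [indicator_of_mem hy]
      by_cases h0 : f y = 0
      · rw [h0]; simp
      by_cases ht : f y = ∞
      · rw [ht]; simp
      have := ENNReal.toReal_pos h0 ht
      nth_rewrite 2 [← ENNReal.ofReal_toReal ht]
      rw [← ENNReal.ofReal_mul (by positivity), inv_mul_cancel₀ this.ne']
      simp
    · rw [indicator_of_notMem hy, hk]
      simp only
      rw [indicator_of_notMem hy]; simp
  have hamp : ∀ y, amp α a0 y = ENNReal.ofReal (k y) * f y := fun y => by
    rw [ha0, amp_mul α (fun y => (k y : ℂ)) v (l2_meas v), hke]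
  have hB1 : ∫⁻ y, B.indicator (1 : (Fin m → ℝ) → ℝ≥0∞) y = ENNReal.ofReal c := by
    rw [lintegral_indicator_one hB, hvol]
  have hL : ∫⁻ x, ‖a0 x‖ₑ ^ 2 ≤ ENNReal.ofReal c := by
    rw [← amp_int α ha0m, ← hB1]
    refine lintegral_mono fun y => ?_
    rw [hamp]
    refine (pow_le_pow_left' (hkf y) 2).trans ?_
    by_cases hy : y ∈ B <;> simp [hy]
  have hmem : MemLp a0 2 volume := by
    refine ⟨ha0m.aestronglyMeasurable, ?_⟩
    rw [eLpNorm_eq_lintegral_rpow_enorm_toReal (by simp) (by simp)]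
    simp only [ENNReal.toReal_ofNat]
    refine ENNReal.rpow_lt_top_of_nonneg (by norm_num) (ne_top_of_le_ne_top ENNReal.ofReal_ne_top
      (le_trans (le_of_eq ?_) hL))
    refine lintegral_congr fun x => ?_
    rw [← ENNReal.rpow_natCast]; norm_num
  have hae := hmem.coeFn_toLp
  refine ⟨hmem.toLp a0, ?_, ?_, ?_⟩
  · have : ‖hmem.toLp a0‖ₑ ^ 2 ≤ ENNReal.ofReal c := by
      rw [l2_enorm]
      refine le_trans (le_of_eq (lintegral_congr_ae ?_)) hL
      filter_upwards [hae] with x hx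
      rw [hx]
    rw [← ofReal_norm, ← ENNReal.ofReal_pow (norm_nonneg _)] at this
    exact (ENNReal.ofReal_le_ofReal_iff hc.le).1 this
  · intro s hs
    rw [← Complex.coe_smul, N1_smul, N1_congr α hae, ← ofReal_norm, Complex.norm_real,
      Real.norm_of_nonneg hs, ENNReal.ofReal_mul hs, ← hB1]
    gcongr with y
    rw [hamp]; exact hkf y
  · have hInt := (L2.integrable_inner (𝕜 := ℂ) v (hmem.toLp a0))
    rw [L2.inner_def]
    have e1 : (fun x => inner ℂ (v x) (hmem.toLp a0 x)) =ᵐ[volume]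
        fun x => ((k (x α).1 * ‖v x‖ ^ 2 : ℝ) : ℂ) := by
      filter_upwards [hae] with x hx
      rw [hx, RCLike.inner_apply, ha0]
      simp only
      rw [mul_assoc, RCLike.mul_conj]
      push_cast
      rfl
    have hint2 : Integrable fun x : Cfg m n N => k (x α).1 * ‖v x‖ ^ 2 := by
      have := (hInt.congr e1).re
      refine this.congr (Eventually.of_forall fun x => ?_)
      exact Complex.ofReal_re _
    rw [integral_congr_ae e1, integral_complex_ofReal, Complex.ofReal_re]
    rw [← ENNReal.ofReal_le_ofReal_iff (integral_nonneg fun x =>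
      mul_nonneg (hk0 _) (sq_nonneg _)),
      ofReal_integral_eq_lintegral_ofReal hint2 (Eventually.of_forall fun x =>
      mul_nonneg (hk0 _) (sq_nonneg _))]
    have e2 : ∀ x : Cfg m n N, ENNReal.ofReal (k (x α).1 * ‖v x‖ ^ 2) =
        ENNReal.ofReal (k (x α).1) * ‖v x‖ₑ ^ 2 := fun x => by
      rw [ENNReal.ofReal_mul (hk0 _), ENNReal.ofReal_pow (norm_nonneg _), ofReal_norm]
    simp_rw [e2]
    rw [lint_gl α (F := fun x => ENNReal.ofReal (k (x α).1) * ‖v x‖ₑ ^ 2) ((hkm.comp hpr).ennreal_ofReal.mul ((l2_meas v).enorm.pow_const 2))]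
    simp_rw [gl_alpha]
    have e3 : ∀ y, ∫⁻ w, ENNReal.ofReal (k y) * ‖v (gl α (y, w))‖ₑ ^ 2 =
        ENNReal.ofReal (k y) * f y ^ 2 := fun y => by
      rw [lintegral_const_mul (f := fun w => ‖v (gl α (y, w))‖ₑ ^ 2) _
        (meas_slice ((l2_meas v).comp (gl_meas α)).enorm y |>.pow_const 2), hf, amp_sq]
    simp_rw [e3]
    rw [ENNReal.ofReal_mul hτ, ← hB1, ← lintegral_const_mul _ (measurable_one.indicator hB)]
    refine lintegral_mono_ae ?_
    have hfin := ae_lt_top (hfm.pow_const 2) (amp_fin α v)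
    filter_upwards [hfin] with y hy
    by_cases hyB : y ∈ B
    · have h1 : ENNReal.ofReal τ < f y := hBs hyB
      have ht : f y ≠ ∞ := fun h => by rw [h] at hy; simp at hy
      have h0 : f y ≠ 0 := (lt_of_le_of_lt zero_le h1).ne'
      have := ENNReal.toReal_pos h0 ht
      rw [indicator_of_mem hyB, hk]
      simp only
      rw [indicator_of_mem hyB]
      have e4 : ENNReal.ofReal (f y).toReal⁻¹ * f y = 1 := by
        nth_rewrite 2 [← ENNReal.ofReal_toReal ht]
        rw [← ENNReal.ofReal_mul (by positivity), inv_mul_cancel₀ this.ne']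
        simp
      rw [sq, ← mul_assoc, e4, one_mul]
      simpa using h1.le
    · rw [indicator_of_notMem hyB]; simp

end KT

namespace KT
open Set Filter Topology ManyBodyWaveguide

variable {m n N : ℕ}

lemma adm_exp (hm : 3 ≤ m) {q r : ℝ≥0∞} (h : Admissible m q r) :
    0 ≤ 2 / q.toReal ∧ 2 / q.toReal ≤ 1 ∧ 1 / r.toReal = 1 / 2 - (2 / q.toReal) / m := by
  obtain ⟨hq, hr, he, -⟩ := h
  have hm0 : (0:ℝ) < m := by positivity
  have hq0 : q ≠ 0 := fun h => by simp [h] at hq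
  have hr0 : r ≠ 0 := fun h => by simp [h] at hr
  have h1 : 2 / q.toReal ≤ 1 := by
    by_cases hqt : q = ∞
    · simp [hqt]
    · have : 2 ≤ q.toReal := by
        have := ENNReal.toReal_mono hqt hq
        simpa using this
      rw [div_le_one (by linarith)]; exact this
  have he' := congrArg ENNReal.toReal he
  rw [ENNReal.toReal_add (ENNReal.div_ne_top (by simp) hq0) (ENNReal.div_ne_top (by simp) hr0)] at he'
  simp only [ENNReal.toReal_div, ENNReal.toReal_ofNat, ENNReal.toReal_natCast] at he'
  refine ⟨by positivity, h1, ?_⟩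
  have : (m:ℝ) / r.toReal = m * (1 / r.toReal) := by ring
  rw [this] at he'
  have h2 : 1 / r.toReal = ((m:ℝ) / 2 - 2 / q.toReal) / m := by
    rw [eq_div_iff hm0.ne']; linarith
  rw [h2, sub_div]
  congr 1
  field_simp

lemma dual_exp {q qd : ℝ≥0∞} (hq : 2 ≤ q) (h : 1 / q + 1 / qd = 1) :
    qd ≠ ∞ ∧ 1 / qd.toReal = 1 - 1 / q.toReal := by
  have hq0 : q ≠ 0 := fun h => by simp [h] at hq
  have hd0 : qd ≠ 0 := fun h' => by simp [h'] at h
  constructor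
  · rintro rfl
    simp only [one_div, ENNReal.inv_top, add_zero] at h
    rw [ENNReal.inv_eq_one] at h
    rw [h] at hq; norm_num at hq
  · have := congrArg ENNReal.toReal h
    rw [ENNReal.toReal_add (ENNReal.div_ne_top (by simp) hq0) (ENNReal.div_ne_top (by simp) hd0)] at this
    simp only [ENNReal.toReal_div, ENNReal.toReal_one] at this
    linarith

lemma LLb_bound (hm : 3 ≤ m) (α : Fin N) {θ : ℝ} (h0 : 0 ≤ θ) (h1 : θ ≤ 1) (w : L2 m n N) :
    LL (1 / 2 - θ / m) volume (amp α w) ^ (1 / 2 : ℝ) ≤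
      cD m ^ (θ / 2) * (‖w‖ₑ ^ (1 - θ) * MM (N1 α) ((m:ℝ) / 2) w ^ θ) := by
  have hmeas := amp_meas α (l2_meas w)
  have hd := D0 hm hmeas (amp_fin α w) (cut α w) (N1_zero α)
  have hc := LL_conv (μ := volume) (f := amp α w) (a0 := 1 / 2) (a1 := 1 / 2 - 1 / (m:ℝ))
    (a := 1 / 2 - θ / m) h0 h1 (by ring)
  rw [LL_half hmeas.aemeasurable, amp_norm] at hc
  have h12 : (0:ℝ) ≤ 1 / 2 := by norm_num
  calc _ ≤ ((‖w‖ₑ ^ 2) ^ (1 - θ) * (cD m * MM (N1 α) ((m:ℝ) / 2) w ^ 2) ^ θ) ^ (1 / 2 : ℝ) := by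
        refine ENNReal.rpow_le_rpow (hc.trans ?_) h12
        gcongr
    _ = _ := by
        rw [ENNReal.mul_rpow_of_nonneg _ _ h12, ENNReal.mul_rpow_of_nonneg _ _ h0,
          ENNReal.mul_rpow_of_nonneg _ _ h12]
        simp_rw [← ENNReal.rpow_natCast, ← ENNReal.rpow_mul]
        rw [show ((2:ℕ):ℝ) * (1 - θ) * (1 / 2) = 1 - θ by push_cast; ring,
          show ((2:ℕ):ℝ) * θ * (1 / 2) = θ by push_cast; ring,
          show θ * (1 / 2) = θ / 2 by ring]
        ring

lemma hX_concrete (hm : 3 ≤ m) (α : Fin N) {θ : ℝ} (h0 : 0 ≤ θ) (h1 : θ ≤ 1) {rd : ℝ≥0∞}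
    (hrd : 1 / rd.toReal = 1 / 2 + θ / m) (v w : L2 m n N) :
    ‖inner ℂ v w‖ₑ ≤ cD m ^ (θ / 2) * (lorentz rd 2 volume (amp α v) *
      (‖w‖ₑ ^ (1 - θ) * MM (N1 α) ((m:ℝ) / 2) w ^ θ)) := by
  refine (inner_amp α v w).trans ?_
  refine (LL_holder (a := 1 / rd.toReal) (b := 1 / 2 - θ / m) (amp_meas α (l2_meas v)).aemeasurable
    (amp_meas α (l2_meas w)).aemeasurable (by rw [hrd]; ring)).trans ?_
  rw [lorentz_eq]
  calc _ ≤ LL (1 / rd.toReal) volume (amp α v) ^ (1 / 2 : ℝ) *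
        (cD m ^ (θ / 2) * (‖w‖ₑ ^ (1 - θ) * MM (N1 α) ((m:ℝ) / 2) w ^ θ)) := by
        gcongr
        exact LLb_bound hm α h0 h1 w
    _ = _ := by ring

lemma fn_eq (α : Fin N) (q r : ℝ≥0∞) (u : ℝ → L2 m n N) :
    frozenNormL q r 2 α (fun t x => u t x) =
      eN q volume fun t => lorentz r 2 volume (amp α (u t)) := by
  unfold frozenNormL
  congr 1
  funext t
  congr 1
  funext y
  exact amp_eq α (l2_meas _) y

instance fact2 : Fact ((2:ℝ≥0∞) ≠ ∞) := ⟨by simp⟩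

set_option maxHeartbeats 1000000 in
theorem final (hm : 3 ≤ m) (q r qt rt qd rd : ℝ≥0∞)
    (hqr : Admissible m q r) (hqtrt : Admissible m qt rt)
    (hqd : 1 / qt + 1 / qd = 1) (hrd : 1 / rt + 1 / rd = 1) (α : Fin N) (K : ℝ) :
    ∃ C : ℝ, 0 < C ∧
      ∀ U0 : ℝ → L2 m n N →L[ℂ] L2 m n N, Disp U0 (N1 α) K ((m:ℝ) / 2) →
        ∀ F : ℝ → L2 m n N, AEStronglyMeasurable F (volume : Measure ℝ) →
          frozenNormL q r 2 α (duhamel U0 F) ≤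
            ENNReal.ofReal C * frozenNormL qd rd 2 α (fun t x => (F t) x) := by
  obtain ⟨t0, t1, hr⟩ := adm_exp hm hqr
  obtain ⟨s0, s1, hrt⟩ := adm_exp hm hqtrt
  obtain ⟨hqdt, hqd'⟩ := dual_exp hqtrt.1 hqd
  obtain ⟨-, hrd'⟩ := dual_exp hqtrt.2.1 hrd
  set θ := 2 / q.toReal with hθ
  set η := 2 / qt.toReal with hη
  have hrd2 : 1 / rd.toReal = 1 / 2 + η / m := by rw [hrd', hrt]; ring
  have hp : qd.toReal = (1 - η / 2)⁻¹ := by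
    have : 1 - η / 2 = 1 / qd.toReal := by rw [hqd', hη]; ring
    rw [this]; simp
  set D := cD m with hD
  have hDt : D ≠ ∞ := cD_ne_top
  have hη2 : 0 ≤ η / 2 := by positivity
  have hθ2 : 0 ≤ θ / 2 := by positivity
  set C2 := D ^ (η / 2) with hC2
  have hC2t : C2 ≠ ∞ := ENNReal.rpow_ne_top_of_nonneg hη2 hDt
  set c2 : ℝ≥0∞ := C2 * b1 K ((m:ℝ)/2) ^ η with hc2
  set c1 : ℝ≥0∞ := C2 * (b1 K ((m:ℝ)/2) ^ (1 - η) * C1 K ((m:ℝ)/2) ^ η) with hc1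
  have hc2t : c2 ≠ ∞ := ENNReal.mul_ne_top hC2t (ENNReal.rpow_ne_top_of_nonneg s0 b1_ne_top)
  have hc1t : c1 ≠ ∞ := ENNReal.mul_ne_top hC2t (ENNReal.mul_ne_top
    (ENNReal.rpow_ne_top_of_nonneg (by linarith) b1_ne_top)
    (ENNReal.rpow_ne_top_of_nonneg s0 C1_ne_top))
  set A : ℝ≥0∞ := D ^ (θ / 2) * (c2 ^ (1 - θ) * (2 ^ (θ / 2) * c1 ^ θ)) with hA
  have hAt : A ≠ ∞ := by
    refine ENNReal.mul_ne_top (ENNReal.rpow_ne_top_of_nonneg hθ2 hDt) (ENNReal.mul_ne_top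
      (ENNReal.rpow_ne_top_of_nonneg (by linarith) hc2t) (ENNReal.mul_ne_top
      (ENNReal.rpow_ne_top_of_nonneg hθ2 (by simp)) (ENNReal.rpow_ne_top_of_nonneg t0 hc1t)))
  refine ⟨A.toReal + 1, by positivity, fun U0 hU F hF => ?_⟩
  have hAC : A ≤ ENNReal.ofReal (A.toReal + 1) := by
    rw [← ENNReal.ofReal_toReal hAt, ENNReal.toReal_ofReal ENNReal.toReal_nonneg]
    exact ENNReal.ofReal_le_ofReal (by linarith)
  set X : L2 m n N → ℝ≥0∞ := fun v => lorentz rd 2 volume (amp α v) with hXd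
  have hX := hX_concrete (n := n) hm α s0 s1 hrd2
  set R := (∫⁻ s, X (F s) ^ qd.toReal) ^ (1 / qd.toReal) with hR
  have hrhs : frozenNormL qd rd 2 α (fun t x => (F t) x) = R := by
    rw [fn_eq]; unfold eN; rw [if_neg hqdt]
  rw [hrhs]
  by_cases hRt : R = ∞
  · rw [hRt, ENNReal.mul_top]
    · exact le_top
    · simp only [ne_eq, ENNReal.ofReal_eq_zero, not_le]; positivity
  have hsup : ∀ t, ‖duh U0 F t‖ₑ ≤ c2 * R := hU.sup_bound s0 s1 hC2t hX hp hF
  have hmain := hU.main s0 s1 hC2t hX hp hF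
  have hlhs : frozenNormL q r 2 α (duhamel U0 F) =
      eN q volume fun t => lorentz r 2 volume (amp α (duh U0 F t : L2 m n N)) := by
    have e : duhamel U0 F = fun t x => (duh U0 F t : L2 m n N) x := rfl
    rw [e]
    exact fn_eq (m := m) (n := n) α q r (fun t => (duh U0 F t : L2 m n N))
  rw [hlhs]
  have hpt : ∀ t, lorentz r 2 volume (amp α (duh U0 F t : L2 m n N)) ≤
      D ^ (θ / 2) * (c2 * R) ^ (1 - θ) * MM (N1 α) ((m:ℝ) / 2) (duh U0 F t) ^ θ := by
    intro t
    rw [lorentz_eq, hr, mul_assoc]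
    refine (LLb_bound hm α t0 t1 _).trans ?_
    have := ENNReal.rpow_le_rpow (hsup t) (by linarith : 0 ≤ 1 - θ)
    gcongr
  have hone : R ^ (1 - θ) * R ^ θ = R := by
    rw [← ENNReal.rpow_add_of_nonneg _ _ (by linarith) t0]; simp
  refine le_trans ?_ (mul_le_mul_left hAC R)
  by_cases hq : q = ∞
  · have hθ0 : θ = 0 := by rw [hθ, hq]; simp
    unfold eN
    rw [if_pos hq]
    refine essSup_le_of_ae_le _ (Eventually.of_forall fun t => (hpt t).trans (le_of_eq ?_))
    simp only [hA, hθ0]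
    simp
  · have hq0 : q ≠ 0 := fun h => by have := hqr.1; simp [h] at this
    have hqp : 0 < q.toReal := ENNReal.toReal_pos hq0 hq
    have hqe : 1 / q.toReal = θ / 2 := by rw [hθ]; ring
    have hθq : θ * q.toReal = 2 := by rw [hθ]; field_simp
    set B := D ^ (θ / 2) * (c2 * R) ^ (1 - θ) with hB
    have hBt : B ≠ ∞ := ENNReal.mul_ne_top (ENNReal.rpow_ne_top_of_nonneg hθ2 hDt)
      (ENNReal.rpow_ne_top_of_nonneg (by linarith) (ENNReal.mul_ne_top hc2t hRt))
    unfold eN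
    rw [if_neg hq]
    calc _ ≤ (∫⁻ t, (B * MM (N1 α) ((m:ℝ) / 2) (duh U0 F t) ^ θ) ^ q.toReal) ^ (1 / q.toReal) := by
          refine ENNReal.rpow_le_rpow (lintegral_mono fun t => ?_) (by positivity)
          exact ENNReal.rpow_le_rpow (hpt t) hqp.le
      _ = B * (∫⁻ t, MM (N1 α) ((m:ℝ) / 2) (duh U0 F t) ^ 2) ^ (1 / q.toReal) := by
          have : ∀ t, (B * MM (N1 α) ((m:ℝ) / 2) (duh U0 F t) ^ θ) ^ q.toReal =
              B ^ q.toReal * MM (N1 α) ((m:ℝ) / 2) (duh U0 F t) ^ 2 := fun t => by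
            rw [ENNReal.mul_rpow_of_nonneg _ _ hqp.le, ← ENNReal.rpow_mul, hθq]
            norm_num
          simp_rw [this]
          rw [lintegral_const_mul' _ _ (ENNReal.rpow_ne_top_of_nonneg hqp.le hBt),
            ENNReal.mul_rpow_of_nonneg _ _ (by positivity), ← ENNReal.rpow_mul,
            mul_one_div_cancel hqp.ne', ENNReal.rpow_one]
      _ ≤ B * (2 * (c1 * R) ^ 2) ^ (1 / q.toReal) := by
          gcongr
      _ = A * R := by
          rw [hqe, hB, ENNReal.mul_rpow_of_nonneg _ _ hθ2, ← ENNReal.rpow_natCast,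
            ← ENNReal.rpow_mul, show ((2:ℕ):ℝ) * (θ / 2) = θ by push_cast; ring,
            ENNReal.mul_rpow_of_nonneg _ _ (by linarith : 0 ≤ 1 - θ),
            ENNReal.mul_rpow_of_nonneg _ _ t0, hA]
          calc _ = D ^ (θ / 2) * (c2 ^ (1 - θ) * (2 ^ (θ / 2) * c1 ^ θ)) *
                (R ^ (1 - θ) * R ^ θ) := by ring
            _ = _ := by rw [hone]

end KT

namespace KT
open Set Filter Topology ManyBodyWaveguide

section toL
variable {X : Type*} [MeasurableSpace X] {μ : Measure X}

open Classical in
/-- the class in `L²` of a function (zero if not square integrable) -/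
def toL (μ : Measure X) (f : X → ℂ) : Lp ℂ 2 μ := if h : MemLp f 2 μ then h.toLp f else 0

lemma toL_coe {f : X → ℂ} (h : MemLp f 2 μ) : toL μ f =ᵐ[μ] f := by
  unfold toL; rw [dif_pos h]; exact h.coeFn_toLp

lemma toL_congr {f g : X → ℂ} (h : MemLp f 2 μ) (hfg : f =ᵐ[μ] g) : toL μ f = toL μ g := by
  have hg : MemLp g 2 μ := h.ae_eq hfg
  refine Lp.ext ?_
  exact (toL_coe h).trans (hfg.trans (toL_coe hg).symm)

lemma toL_self (v : Lp ℂ 2 μ) : toL μ v = v := Lp.ext (toL_coe (Lp.memLp v))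

lemma toL_add {f g : X → ℂ} (hf : MemLp f 2 μ) (hg : MemLp g 2 μ) :
    toL μ (fun x => f x + g x) = toL μ f + toL μ g := by
  refine Lp.ext ((toL_coe (hf.add hg)).trans ?_)
  filter_upwards [toL_coe hf, toL_coe hg, Lp.coeFn_add (toL μ f) (toL μ g)] with x h1 h2 h3
  rw [h3]; simp [h1, h2]

lemma toL_smul {f : X → ℂ} (hf : MemLp f 2 μ) (c : ℂ) :
    toL μ (fun x => c * f x) = c • toL μ f := by
  refine Lp.ext ((toL_coe (hf.const_mul c)).trans ?_)
  filter_upwards [toL_coe hf, Lp.coeFn_smul c (toL μ f)] with x h1 h3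
  rw [h3]; simp [h1]

lemma toL_sub {f g : X → ℂ} (hf : MemLp f 2 μ) (hg : MemLp g 2 μ) :
    toL μ (fun x => f x - g x) = toL μ f - toL μ g := by
  refine Lp.ext ((toL_coe (hf.sub hg)).trans ?_)
  filter_upwards [toL_coe hf, toL_coe hg, Lp.coeFn_sub (toL μ f) (toL μ g)] with x h1 h2 h3
  rw [h3]; simp [h1, h2]

lemma toL_sum {ι : Type*} (s : Finset ι) {f : ι → X → ℂ} (hf : ∀ i ∈ s, MemLp (f i) 2 μ) :
    toL μ (fun x => ∑ i ∈ s, f i x) = ∑ i ∈ s, toL μ (f i) := by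
  classical
  induction s using Finset.induction_on with
  | empty =>
    simp only [Finset.sum_empty]
    refine Lp.ext ((toL_coe MemLp.zero').trans (Lp.coeFn_zero _ _ _).symm)
  | insert a s ha ih =>
    have h1 := hf a (Finset.mem_insert_self _ _)
    have h2 : ∀ i ∈ s, MemLp (f i) 2 μ := fun i hi => hf i (Finset.mem_insert_of_mem hi)
    simp only [Finset.sum_insert ha]
    rw [toL_add h1 (memLp_finsetSum s h2), ih h2]

lemma lp_enorm (v : Lp ℂ 2 μ) : ‖v‖ₑ ^ 2 = ∫⁻ x, ‖v x‖ₑ ^ 2 ∂μ := by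
  rw [Lp.enorm_def, eLpNorm_eq_lintegral_rpow_enorm_toReal (by simp) (by simp)]
  simp only [ENNReal.toReal_ofNat]
  rw [← ENNReal.rpow_natCast, ← ENNReal.rpow_mul]
  norm_num

lemma toL_enorm {f : X → ℂ} (h : MemLp f 2 μ) : ‖toL μ f‖ₑ ^ 2 = ∫⁻ x, ‖f x‖ₑ ^ 2 ∂μ := by
  rw [lp_enorm]
  refine lintegral_congr_ae ?_
  filter_upwards [toL_coe h] with x hx
  rw [hx]

lemma inner_toL {f : X → ℂ} (h : MemLp f 2 μ) (v : Lp ℂ 2 μ) :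
    inner ℂ (toL μ f) v = ∫ x, (starRingEnd ℂ) (f x) * v x ∂μ := by
  rw [L2.inner_def]
  refine integral_congr_ae ?_
  filter_upwards [toL_coe h] with x hx
  rw [hx]; simp [RCLike.inner_apply, mul_comm]

lemma memLp_dom {f : X → ℂ} {G : X → ℝ} (hG : MemLp G 2 μ) (hf : AEStronglyMeasurable f μ)
    (h : ∀ x, ‖f x‖ ≤ G x) : MemLp f 2 μ :=
  hG.mono hf (Eventually.of_forall fun x => (h x).trans (le_abs_self _))

lemma dct {ι : Type*} {l : Filter ι} [l.IsCountablyGenerated] {F : ι → X → ℂ} {f : X → ℂ}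
    {G : X → ℝ} (hG : MemLp G 2 μ) (hF : ∀ i, Measurable (F i))
    (hf : Measurable f)
    (hb : ∀ᶠ i in l, ∀ x, ‖F i x‖ ≤ G x) (hfb : ∀ x, ‖f x‖ ≤ G x)
    (hl : ∀ x, Tendsto (fun i => F i x) l (𝓝 (f x))) :
    Tendsto (fun i => toL μ (F i)) l (𝓝 (toL μ f)) := by
  have hfm := memLp_dom hG hf.aestronglyMeasurable hfb
  have hd : Tendsto (fun i => ∫⁻ x, ‖F i x - f x‖ₑ ^ 2 ∂μ) l (𝓝 (∫⁻ _, 0 ∂μ)) := by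
    refine tendsto_lintegral_filter_of_dominated_convergence (fun x => (2 * ‖G x‖ₑ) ^ 2) ?_ ?_ ?_ ?_
    · exact Eventually.of_forall fun i => (((hF i).sub hf).enorm.pow_const 2)
    · filter_upwards [hb] with i hi
      refine Eventually.of_forall fun x => ?_
      gcongr
      calc ‖F i x - f x‖ₑ ≤ ‖F i x‖ₑ + ‖f x‖ₑ := enorm_sub_le
        _ ≤ ‖G x‖ₑ + ‖G x‖ₑ := by
          gcongr
          · rw [enorm_le_iff_norm_le]; exact (hi x).trans (le_abs_self _)
          · rw [enorm_le_iff_norm_le]; exact (hfb x).trans (le_abs_self _)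
        _ = _ := by ring
    · have h2 : MemLp (fun x => (2:ℝ) * G x) 2 μ := hG.const_mul 2
      have := (eLpNorm_lt_top_iff_lintegral_rpow_enorm_lt_top (p := 2) (by simp) (by simp)).1 h2.2
      simp only [ENNReal.toReal_ofNat, enorm_mul] at this
      refine ne_of_lt (lt_of_le_of_lt (le_of_eq ?_) this)
      refine lintegral_congr fun x => ?_
      rw [← ENNReal.rpow_natCast]
      norm_num [enorm_eq_nnnorm]
    · refine Eventually.of_forall fun x => ?_
      have : Tendsto (fun i => F i x - f x) l (𝓝 0) := by
        simpa using (hl x).sub_const (f x)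
      have := (ENNReal.continuous_pow 2).tendsto _ |>.comp this.enorm
      simpa [Function.comp_def] using this
  rw [tendsto_iff_norm_sub_tendsto_zero]
  rw [lintegral_zero] at hd
  have h3 : Tendsto (fun i => ‖toL μ (F i) - toL μ f‖ ^ 2) l (𝓝 0) := by
    have := (ENNReal.tendsto_toReal ENNReal.zero_ne_top).comp hd
    rw [ENNReal.toReal_zero] at this
    refine this.congr' ?_
    filter_upwards [hb] with i hi
    have hi' := memLp_dom hG (hF i).aestronglyMeasurable hi
    rw [← toL_sub hi' hfm]
    simp only [Function.comp]
    rw [← toL_enorm (f := fun x => F i x - f x) (hi'.sub hfm), ENNReal.toReal_pow, toReal_enorm]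
  have := (Real.continuous_sqrt.tendsto 0).comp h3
  simpa [Function.comp_def, Real.sqrt_sq] using this

lemma toL_deriv {Φ Φ' : ℝ → X → ℂ} {G : X → ℝ} {t0 δ : ℝ} (hδ : 0 < δ) (hG : MemLp G 2 μ)
    (hΦ : ∀ t, MemLp (Φ t) 2 μ) (hΦm : ∀ t, Measurable (Φ t)) (hΦ' : Measurable (Φ' t0))
    (hd : ∀ t, |t - t0| < δ → ∀ x, HasDerivAt (fun s => Φ s x) (Φ' t x) t)
    (hb : ∀ t, |t - t0| < δ → ∀ x, ‖Φ' t x‖ ≤ G x) :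
    HasDerivAt (fun t => toL μ (Φ t)) (toL μ (Φ' t0)) t0 := by
  rw [hasDerivAt_iff_tendsto_slope]
  have h0 : |t0 - t0| < δ := by simpa using hδ
  have key := dct (l := 𝓝[≠] t0) (F := fun t x => ((t - t0)⁻¹ : ℝ) * (Φ t x - Φ t0 x)) (f := Φ' t0) hG
    (fun t => ((hΦm t).sub (hΦm t0)).const_mul _) hΦ' ?_ (hb t0 h0) ?_
  · refine key.congr fun t => ?_
    rw [toL_smul (f := fun x => Φ t x - Φ t0 x) ((hΦ t).sub (hΦ t0)), toL_sub (hΦ t) (hΦ t0), slope_def_module]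
    rw [Complex.coe_smul]
    rfl
  · have : ∀ᶠ t in 𝓝[≠] t0, |t - t0| < δ :=
      nhdsWithin_le_nhds (Metric.ball_mem_nhds t0 hδ)
    filter_upwards [this, self_mem_nhdsWithin] with t ht hne x
    have hmv := (convex_ball t0 δ).norm_image_sub_le_of_norm_hasDerivWithin_le
      (f := fun s => Φ s x) (f' := fun s => Φ' s x) (C := G x)
      (fun s hs => (hd s hs x).hasDerivWithinAt) (fun s hs => hb s hs x)
      (Metric.mem_ball_self hδ) (y := t) ht
    have hne' : t - t0 ≠ 0 := sub_ne_zero.2 hne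
    rw [norm_mul, Complex.norm_real, norm_inv, inv_mul_le_iff₀ (norm_pos_iff.2 hne'), mul_comm]
    exact hmv
  · intro x
    have := (hasDerivAt_iff_tendsto_slope.1 (hd t0 h0 x))
    refine this.congr fun t => ?_
    rw [slope_def_module]
    simp

end toL

section abs
variable {E : Type*} [NormedAddCommGroup E] [InnerProductSpace ℂ E]

/-- weak generator relation -/
def WRel (U : ℝ → E →L[ℂ] E) (a b : E) : Prop :=
  ∀ f : E, ∀ s : ℝ, HasDerivAt (fun s => inner ℂ a (U s f)) (Complex.I * inner ℂ b (U s f)) s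

lemma WRel_closed {U : ℝ → E →L[ℂ] E} (hU : ∀ t f, ‖U t f‖ = ‖f‖) {a b : ℕ → E} {a0 b0 : E}
    (h : ∀ k, WRel U (a k) (b k)) (ha : Tendsto a atTop (𝓝 a0)) (hb : Tendsto b atTop (𝓝 b0)) :
    WRel U a0 b0 := by
  intro f s
  refine hasDerivAt_of_tendstoUniformly (l := atTop) (f := fun k s => inner ℂ (a k) (U s f))
    (f' := fun k s => Complex.I * inner ℂ (b k) (U s f))
    (g := fun s => inner ℂ a0 (U s f)) (g' := fun s => Complex.I * inner ℂ b0 (U s f)) ?_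
    (Eventually.of_forall fun k s => h k f s) (fun s => ?_) s
  · rw [Metric.tendstoUniformly_iff]
    intro ε hε
    have h1 : Tendsto (fun k => ‖b k - b0‖ * ‖f‖) atTop (𝓝 0) := by
      simpa using (tendsto_iff_norm_sub_tendsto_zero.1 hb).mul_const ‖f‖
    filter_upwards [h1.eventually_lt_const hε] with k hk s
    rw [dist_comm, dist_eq_norm, ← mul_sub, ← inner_sub_left, norm_mul, Complex.norm_I, one_mul]
    refine lt_of_le_of_lt (norm_inner_le_norm _ _) ?_
    rw [hU]; exact hk
  · exact ha.inner tendsto_const_nhds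

theorem prop_curve {U : ℝ → E →L[ℂ] E} (hU : ∀ t f, ‖U t f‖ = ‖f‖) (h0 : ∀ f, U 0 f = f)
    (hadd : ∀ s t f, U (s + t) f = U s (U t f)) {Ψ b : ℝ → E}
    (hd : ∀ t, HasDerivAt Ψ (Complex.I • b t) t) (hw : ∀ t, WRel U (Ψ t) (b t)) (s t : ℝ) :
    U s (Ψ t) = Ψ (t + s) := by
  -- weak continuity against b
  have hcb : ∀ t f s, Tendsto (fun s' => inner ℂ (b t) (U s' f)) (𝓝 s) (𝓝 (inner ℂ (b t) (U s f))) := by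
    intro t f s
    have hcs : ContinuousAt (fun s' => inner ℂ (Complex.I • b t) (U s' f)) s := by
      have hsl := hasDerivAt_iff_tendsto_slope.1 (hd t)
      refine continuousAt_of_locally_uniform_approx_of_continuousAt ?_
      intro u hu
      obtain ⟨ε, hε, hεu⟩ := Metric.mem_uniformity_dist.1 hu
      have h1 : Tendsto (fun k => ‖slope Ψ t k - Complex.I • b t‖ * ‖f‖) (𝓝[≠] t) (𝓝 0) := by
        simpa using (tendsto_iff_norm_sub_tendsto_zero.1 hsl).mul_const ‖f‖
      obtain ⟨k, hk⟩ := (h1.eventually_lt_const hε).exists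
      refine ⟨univ, univ_mem, fun s' => inner ℂ (slope Ψ t k) (U s' f), ?_, fun s' _ => hεu ?_⟩
      · have e : ∀ s', inner ℂ (slope Ψ t k) (U s' f) =
            ((k - t)⁻¹ : ℝ) * (inner ℂ (Ψ k) (U s' f) - inner ℂ (Ψ t) (U s' f)) := by
          intro s'
          rw [slope_def_module, ← Complex.coe_smul, inner_smul_left, inner_sub_left]
          simp
        simp_rw [e]
        exact continuousAt_const.mul
          (((hw k f s).continuousAt).sub ((hw t f s).continuousAt))
      · rw [dist_comm, dist_eq_norm, ← inner_sub_left]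
        refine lt_of_le_of_lt (norm_inner_le_norm _ _) ?_
        rw [hU]; exact hk
    simp_rw [inner_smul_left] at hcs
    have h3 : (starRingEnd ℂ Complex.I) ≠ 0 := by simp
    have := Tendsto.const_mul ((starRingEnd ℂ Complex.I)⁻¹) hcs
    simp_rw [inv_mul_cancel_left₀ h3] at this
    exact this
  -- constancy
  have hconst : ∀ f s, HasDerivAt (fun s => inner ℂ (Ψ (t + s)) (U s f)) 0 s := by
    intro f s
    rw [hasDerivAt_iff_tendsto_slope]
    have hΨ : HasDerivAt (fun s => Ψ (t + s)) (Complex.I • b (t + s)) s := (hd (t + s)).comp_const_add t s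
    have h1 := hasDerivAt_iff_tendsto_slope.1 hΨ
    have h2 := hasDerivAt_iff_tendsto_slope.1 (hw (t + s) f s)
    have h3 : Tendsto (fun s' => inner ℂ (slope (fun s => Ψ (t + s)) s s' - Complex.I • b (t + s)) (U s' f))
        (𝓝[≠] s) (𝓝 0) := by
      refine squeeze_zero_norm (a := fun s' => ‖slope (fun s => Ψ (t + s)) s s' - Complex.I • b (t + s)‖ * ‖f‖) ?_ ?_
      · intro s'
        refine (norm_inner_le_norm _ _).trans ?_
        rw [hU]
      · simpa using (tendsto_iff_norm_sub_tendsto_zero.1 h1).mul_const ‖f‖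
    have h4 : Tendsto (fun s' => inner ℂ (Complex.I • b (t + s)) (U s' f)) (𝓝[≠] s)
        (𝓝 (inner ℂ (Complex.I • b (t + s)) (U s f))) := by
      simp_rw [inner_smul_left]
      exact ((hcb (t + s) f s).const_mul _).mono_left nhdsWithin_le_nhds
    have h5 := (h3.add h4).add h2
    have e0 : (0:ℂ) + inner ℂ (Complex.I • b (t + s)) (U s f) + Complex.I * inner ℂ (b (t + s)) (U s f) = 0 := by
      rw [inner_smul_left]; simp
    rw [e0] at h5
    refine h5.congr fun s' => ?_
    rw [← inner_add_left, sub_add_cancel, slope_def_module, slope_def_module, slope_def_module,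
      ← Complex.coe_smul, inner_smul_left, inner_sub_left, ← Complex.coe_smul, ← Complex.coe_smul]
    simp only [Complex.conj_ofReal, smul_eq_mul]
    ring
  have hc : ∀ f, inner ℂ (Ψ (t + s)) (U s f) = inner ℂ (Ψ t) f := by
    intro f
    have := is_const_of_deriv_eq_zero (f := fun s => inner ℂ (Ψ (t + s)) (U s f))
      (fun s => (hconst f s).differentiableAt) (fun s => (hconst f s).deriv) s 0
    simpa [h0] using this
  have hinn : ∀ x y, inner ℂ (U s x) (U s y) = inner ℂ x y := by
    intro x y
    exact (⟨(U s : E →ₗ[ℂ] E), hU s⟩ : E →ₗᵢ[ℂ] E).inner_map_map x y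
  have hsurj : ∀ g, ∃ f, U s f = g := fun g => ⟨U (-s) g, by rw [← hadd]; simp [h0]⟩
  refine ext_inner_right ℂ fun g => ?_
  obtain ⟨f, rfl⟩ := hsurj g
  rw [hinn, hc]

end abs
end KT

namespace KT
open Set Filter Topology ManyBodyWaveguide

section PE
variable {ι E : Type*} [Fintype ι] [DecidableEq ι] [NormedAddCommGroup E] [NormedSpace ℝ E]

/-- product of one-variable functions of coordinates -/
def PE (l : ι → E →L[ℝ] ℝ) (v : ι → ℝ → ℂ) (X : E) : ℂ := ∏ p, v p (l p X)

lemma PE_smooth (l : ι → E →L[ℝ] ℝ) {v : ι → ℝ → ℂ} (hv : ∀ p, ContDiff ℝ (⊤ : ℕ∞) (v p)) :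
    ContDiff ℝ (⊤ : ℕ∞) (PE l v) := by
  unfold PE
  exact contDiff_prod fun p _ => (hv p).comp (l p).contDiff

lemma PE_update (l : ι → E →L[ℝ] ℝ) (v : ι → ℝ → ℂ) (p : ι) (w : ℝ → ℂ) (X : E) :
    PE l (Function.update v p w) X = w (l p X) * ∏ q ∈ Finset.univ.erase p, v q (l q X) := by
  unfold PE
  rw [← Finset.mul_prod_erase _ _ (Finset.mem_univ p)]
  congr 1
  · simp
  · refine Finset.prod_congr rfl fun q hq => ?_
    rw [Function.update_of_ne (Finset.ne_of_mem_erase hq)]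

lemma PE_fderiv (l : ι → E →L[ℝ] ℝ) {v : ι → ℝ → ℂ} (hv : ∀ p, ContDiff ℝ (⊤ : ℕ∞) (v p))
    (p : ι) (e : E) (he : ∀ q, l q e = if q = p then 1 else 0) (X : E) :
    fderiv ℝ (PE l v) X e = PE l (Function.update v p (deriv (v p))) X := by
  have hd : DifferentiableAt ℝ (PE l v) X := ((PE_smooth l hv).differentiable (by simp)).differentiableAt
  rw [← hd.lineDeriv_eq_fderiv, lineDeriv, PE_update]
  have : ∀ t : ℝ, PE l v (X + t • e) = v p (l p X + t) * ∏ q ∈ Finset.univ.erase p, v q (l q X) := by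
    intro t
    conv_lhs => rw [← Function.update_eq_self p v]
    rw [PE_update]
    congr 1
    · simp [he]
    · refine Finset.prod_congr rfl fun q hq => ?_
      simp [he, Finset.ne_of_mem_erase hq]
  simp_rw [this]
  rw [deriv_mul_const]
  · rw [deriv_comp_const_add]; simp
  · have := ((hv p).differentiable (by simp))
    exact (this.comp ((differentiable_const _).add differentiable_id)).differentiableAt

lemma smooth_deriv {w : ℝ → ℂ} (h : ContDiff ℝ (⊤ : ℕ∞) w) : ContDiff ℝ (⊤ : ℕ∞) (deriv w) := by
  exact (contDiff_infty_iff_deriv.1 h).2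

lemma smooth_update {v : ι → ℝ → ℂ} (hv : ∀ p, ContDiff ℝ (⊤ : ℕ∞) (v p)) (p : ι) {w : ℝ → ℂ}
    (hw : ContDiff ℝ (⊤ : ℕ∞) w) (q : ι) : ContDiff ℝ (⊤ : ℕ∞) (Function.update v p w q) := by
  by_cases h : q = p
  · subst h; simpa using hw
  · rw [Function.update_of_ne h]; exact hv q

lemma PE_second (l : ι → E →L[ℝ] ℝ) {v : ι → ℝ → ℂ} (hv : ∀ p, ContDiff ℝ (⊤ : ℕ∞) (v p))
    (p : ι) (e : E) (he : ∀ q, l q e = if q = p then 1 else 0) (X : E) :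
    secondDeriv (PE l v) X e = PE l (Function.update v p (deriv (deriv (v p)))) X := by
  unfold secondDeriv
  have : (fun y => fderiv ℝ (PE l v) y e) = PE l (Function.update v p (deriv (v p))) := by
    funext y; exact PE_fderiv l hv p e he y
  rw [this, PE_fderiv l (smooth_update hv p (smooth_deriv (hv p))) p e he]
  simp

end PE

variable {m n N : ℕ}

/-- tensor product functions -/
def Ten (v : Fin N × Fin m → ℝ → ℂ) (k : Fin N × Fin n → ℤ) (x : Cfg m n N) : ℂ :=
  (∏ p : Fin N × Fin m, v p ((x p.1).1 p.2)) * ∏ p : Fin N × Fin n, fourier (k p) ((x p.1).2 p.2)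

/-- periodic exponentials -/
def ex (k : ℤ) (s : ℝ) : ℂ := fourier k (s : AddCircle (1:ℝ))

lemma ex_eq (k : ℤ) (s : ℝ) : ex k s = Complex.exp (2 * Real.pi * Complex.I * k * s) := by
  unfold ex; rw [fourier_coe_apply]; simp

lemma ex_smooth (k : ℤ) : ContDiff ℝ (⊤ : ℕ∞) (ex k) := by
  have : ex k = fun s : ℝ => Complex.exp (2 * Real.pi * Complex.I * k * s) := by
    funext s; exact ex_eq k s
  rw [this]
  have h1 : ContDiff ℝ (⊤ : ℕ∞) (fun s : ℝ => (s : ℂ)) := Complex.ofRealCLM.contDiff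
  exact (contDiff_const.mul h1).cexp

lemma ex_deriv (k : ℤ) : deriv (ex k) = fun s => (2 * Real.pi * Complex.I * k) * ex k s := by
  funext s
  have : ex k = fun s : ℝ => Complex.exp (2 * Real.pi * Complex.I * k * s) := by
    funext s; exact ex_eq k s
  rw [this]
  have h1 : HasDerivAt (fun s : ℝ => (2 * Real.pi * Complex.I * k) * (s:ℂ))
      ((2 * Real.pi * Complex.I * k) * 1) s := (Complex.ofRealCLM.hasDerivAt (x := s)).const_mul _
  rw [h1.cexp.deriv]; ring

/-- eigenvalue -/
def lam (k : Fin N × Fin n → ℤ) : ℝ := ∑ p, 4 * Real.pi ^ 2 * (k p : ℝ) ^ 2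

lemma ex_deriv2 (k : ℤ) : deriv (deriv (ex k)) = fun s => -((4 * Real.pi ^ 2 * (k:ℝ) ^ 2 : ℝ) : ℂ) * ex k s := by
  funext s
  rw [ex_deriv, deriv_const_mul _ (((ex_smooth k).differentiable (by simp)).differentiableAt), ex_deriv]
  push_cast
  ring_nf
  simp

/-- coordinates -/
def coo (m n N : ℕ) : (Fin N × Fin m) ⊕ (Fin N × Fin n) → CfgE m n N →L[ℝ] ℝ
  | Sum.inl p => (ContinuousLinearMap.proj (R := ℝ) (φ := fun _ : Fin m => ℝ) p.2).comp
      ((ContinuousLinearMap.fst ℝ (Fin m → ℝ) (Fin n → ℝ)).comp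
        (ContinuousLinearMap.proj (R := ℝ) (φ := fun _ : Fin N => (Fin m → ℝ) × (Fin n → ℝ)) p.1))
  | Sum.inr p => (ContinuousLinearMap.proj (R := ℝ) (φ := fun _ : Fin n => ℝ) p.2).comp
      ((ContinuousLinearMap.snd ℝ (Fin m → ℝ) (Fin n → ℝ)).comp
        (ContinuousLinearMap.proj (R := ℝ) (φ := fun _ : Fin N => (Fin m → ℝ) × (Fin n → ℝ)) p.1))

lemma coo_inl (p : Fin N × Fin m) (X : CfgE m n N) : coo m n N (Sum.inl p) X = (X p.1).1 p.2 := rfl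
lemma coo_inr (p : Fin N × Fin n) (X : CfgE m n N) : coo m n N (Sum.inr p) X = (X p.1).2 p.2 := rfl

lemma coo_eY (a : Fin N) (i : Fin m) (q : (Fin N × Fin m) ⊕ (Fin N × Fin n)) :
    coo m n N q (eY m n N a i) = if q = Sum.inl (a, i) then 1 else 0 := by
  rcases q with ⟨b, j⟩ | ⟨b, j⟩
  · rw [coo_inl]; unfold eY
    by_cases h : b = a
    · subst h; simp [Pi.single_apply]
    · simp [h]
  · rw [coo_inr]; unfold eY
    by_cases h : b = a
    · subst h; simp
    · simp [h]

lemma coo_eZ (a : Fin N) (i : Fin n) (q : (Fin N × Fin m) ⊕ (Fin N × Fin n)) :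
    coo m n N q (eZ m n N a i) = if q = Sum.inr (a, i) then 1 else 0 := by
  rcases q with ⟨b, j⟩ | ⟨b, j⟩
  · rw [coo_inl]; unfold eZ
    by_cases h : b = a
    · subst h; simp
    · simp [h]
  · rw [coo_inr]; unfold eZ
    by_cases h : b = a
    · subst h; simp [Pi.single_apply]
    · simp [h]

lemma Ten_fold (v : Fin N × Fin m → ℝ → ℂ) (k : Fin N × Fin n → ℤ) :
    Ten v k ∘ fold m n N = PE (coo m n N) (Sum.elim v (fun p => ex (k p))) := by
  funext X
  simp only [Function.comp, Ten, PE, Fintype.prod_sum_type, Sum.elim_inl, Sum.elim_inr]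
  rfl

lemma fold_lift (x : Cfg m n N) : fold m n N (liftCfg m n N x) = x := by
  funext a
  refine Prod.ext rfl ?_
  funext j
  exact (AddCircle.equivIco (1:ℝ) 0).symm_apply_apply ((x a).2 j)

/-- Laplacian of a tensor -/
def LT (v : Fin N × Fin m → ℝ → ℂ) (k : Fin N × Fin n → ℤ) (x : Cfg m n N) : ℂ :=
  (∑ p, Ten (Function.update v p (deriv (deriv (v p)))) k x) - lam k * Ten v k x

lemma sum_smooth {v : Fin N × Fin m → ℝ → ℂ} (hv : ∀ p, ContDiff ℝ (⊤ : ℕ∞) (v p))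
    (k : Fin N × Fin n → ℤ) (q : (Fin N × Fin m) ⊕ (Fin N × Fin n)) :
    ContDiff ℝ (⊤ : ℕ∞) ((Sum.elim v (fun p => ex (k p)) : _ → ℝ → ℂ) q) := by
  rcases q with q | q
  · exact hv q
  · exact ex_smooth _

lemma lap_Ten {v : Fin N × Fin m → ℝ → ℂ} (hv : ∀ p, ContDiff ℝ (⊤ : ℕ∞) (v p))
    (k : Fin N × Fin n → ℤ) (x : Cfg m n N) : lap m n N (Ten v k) x = LT v k x := by
  unfold lap laplacianE
  rw [Ten_fold]
  have h1 : ∀ a i, secondDeriv (PE (coo m n N) (Sum.elim v (fun p => ex (k p)))) (liftCfg m n N x)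
      (eY m n N a i) = Ten (Function.update v (a, i) (deriv (deriv (v (a, i))))) k x := by
    intro a i
    rw [PE_second _ (sum_smooth hv k) (Sum.inl (a, i)) _ (coo_eY a i)]
    conv_rhs => rw [← fold_lift x]
    rw [← Function.comp_apply (f := Ten _ k), Ten_fold, Sum.elim_inl, Sum.update_elim_inl]
  have h2 : ∀ a i, secondDeriv (PE (coo m n N) (Sum.elim v (fun p => ex (k p)))) (liftCfg m n N x)
      (eZ m n N a i) = -((4 * Real.pi ^ 2 * (k (a, i):ℝ) ^ 2 : ℝ) : ℂ) * Ten v k x := by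
    intro a i
    rw [PE_second _ (sum_smooth hv k) (Sum.inr (a, i)) _ (coo_eZ a i)]
    conv_rhs => rw [← fold_lift x]
    rw [← Function.comp_apply (f := Ten _ k), Ten_fold, Sum.elim_inr, ex_deriv2, PE_update, mul_assoc]
    congr 1
    unfold PE
    rw [← Finset.mul_prod_erase _ _ (Finset.mem_univ (Sum.inr (a, i)))]
    rfl
  simp_rw [h1, h2]
  rw [Finset.sum_add_distrib, LT, lam, Fintype.sum_prod_type, Fintype.sum_prod_type]
  push_cast
  rw [Finset.sum_mul, sub_eq_add_neg, ← Finset.sum_neg_distrib]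
  congr 1
  refine Finset.sum_congr rfl fun a _ => ?_
  rw [Finset.sum_mul, ← Finset.sum_neg_distrib]
  refine Finset.sum_congr rfl fun i _ => ?_
  ring

lemma Ten_cont {v : Fin N × Fin m → ℝ → ℂ} (hv : ∀ p, Continuous (v p)) (k : Fin N × Fin n → ℤ) :
    Continuous (Ten v k) := by
  unfold Ten
  refine Continuous.mul ?_ ?_
  · exact continuous_finsetProd _ fun p _ => (hv p).comp (by fun_prop)
  · exact continuous_finsetProd _ fun p _ => (fourier (k p)).continuous.comp (by fun_prop)

lemma Ten_test {v : Fin N × Fin m → ℝ → ℂ} (hv : ∀ p, ContDiff ℝ (⊤ : ℕ∞) (v p))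
    (hc : ∀ p, HasCompactSupport (v p)) (k : Fin N × Fin n → ℤ) :
    IsTest m n N (Ten v k) := by
  refine ⟨by rw [Ten_fold]; exact PE_smooth _ (sum_smooth hv k), ?_⟩
  refine HasCompactSupport.intro (K := Set.pi univ fun a : Fin N =>
    (Set.pi univ fun i : Fin m => tsupport (v (a, i))) ×ˢ (univ : Set (Torus n)))
    (isCompact_univ_pi fun a => (isCompact_univ_pi fun i => hc (a, i)).prod isCompact_univ) ?_
  intro x hx
  simp only [Set.mem_pi, Set.mem_prod, Set.mem_univ, and_true, true_imp_iff, not_forall] at hx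
  obtain ⟨a, i, hai⟩ := hx
  unfold Ten
  rw [Finset.prod_eq_zero (Finset.mem_univ (a, i)), zero_mul]
  exact image_eq_zero_of_notMem_tsupport hai

/-- conjugate data -/
def cj (v : Fin N × Fin m → ℝ → ℂ) : Fin N × Fin m → ℝ → ℂ := fun p y => (starRingEnd ℂ) (v p y)

lemma Ten_cj (v : Fin N × Fin m → ℝ → ℂ) (k : Fin N × Fin n → ℤ) (x : Cfg m n N) :
    Ten (cj v) (-k) x = (starRingEnd ℂ) (Ten v k x) := by
  unfold Ten cj
  rw [map_mul, map_prod, map_prod]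
  congr 1
  refine Finset.prod_congr rfl fun p _ => ?_
  rw [Pi.neg_apply, fourier_neg]

lemma deriv_conj (w : ℝ → ℂ) : deriv (fun y => (starRingEnd ℂ) (w y)) = fun y => (starRingEnd ℂ) (deriv w y) := by
  funext y
  exact deriv.star (f := w)

lemma LT_cj (v : Fin N × Fin m → ℝ → ℂ) (k : Fin N × Fin n → ℤ) (x : Cfg m n N) :
    LT (cj v) (-k) x = (starRingEnd ℂ) (LT v k x) := by
  unfold LT
  rw [map_sub, map_sum, map_mul, Complex.conj_ofReal, Ten_cj]
  have : lam (-k) = lam k := by unfold lam; simp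
  rw [this]
  congr 1
  refine Finset.sum_congr rfl fun p _ => ?_
  rw [← Ten_cj]
  congr 1
  funext q
  by_cases h : q = p
  · subst h
    have e : cj v q = fun y => (starRingEnd ℂ) (v q y) := rfl
    rw [Function.update_self, e, deriv_conj, deriv_conj]
    funext y
    simp [cj]
  · rw [Function.update_of_ne h]
    funext y
    simp [cj, Function.update_of_ne h]

lemma weak_Ten {U : ℝ → L2 m n N →L[ℂ] L2 m n N} (hU : IsPropagator m n N 0 U)
    {v : Fin N × Fin m → ℝ → ℂ} (hv : ∀ p, ContDiff ℝ (⊤ : ℕ∞) (v p))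
    (hc : ∀ p, HasCompactSupport (v p)) (k : Fin N × Fin n → ℤ)
    (h1 : MemLp (Ten v k) 2 (volume : Measure (Cfg m n N)))
    (h2 : MemLp (LT v k) 2 (volume : Measure (Cfg m n N))) :
    WRel U (toL volume (Ten v k)) (toL volume (LT v k)) := by
  intro f s
  have hv' : ∀ p, ContDiff ℝ (⊤ : ℕ∞) (cj v p) := fun p =>
    (Complex.conjCLE.contDiff (n := (⊤ : ℕ∞))).comp (hv p)
  have hc' : ∀ p, HasCompactSupport (cj v p) := fun p => by
    have := (hc p).comp_left (g := starRingEnd ℂ) (map_zero _)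
    exact this
  have := hU.weak f (Ten (cj v) (-k)) (Ten_test hv' hc' _) s
  simp_rw [lap_Ten hv', Ten_cj, LT_cj] at this
  simp_rw [inner_toL h1, inner_toL h2]
  simpa using this

end KT

namespace KT
open Set Filter Topology ManyBodyWaveguide

/-- the complex width -/
def wd (τ : ℝ) : ℂ := 1 + 4 * Complex.I * τ

lemma wd_re (τ : ℝ) : (wd τ).re = 1 := by simp [wd]
lemma wd_im (τ : ℝ) : (wd τ).im = 4 * τ := by simp [wd]
lemma wd_ne (τ : ℝ) : wd τ ≠ 0 := fun h => by
  have := wd_re τ; rw [h] at this; simp at this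
lemma wd_slit (τ : ℝ) : wd τ ∈ Complex.slitPlane := Or.inl (by rw [wd_re]; norm_num)
lemma wd_normSq (τ : ℝ) : Complex.normSq (wd τ) = 1 + 16 * τ ^ 2 := by
  rw [Complex.normSq_apply, wd_re, wd_im]; ring
lemma wd_norm (τ : ℝ) : 1 ≤ ‖wd τ‖ := by
  have := Complex.abs_re_le_norm (wd τ)
  rw [wd_re] at this; simpa using this
lemma wd_inv_norm (τ : ℝ) : ‖(wd τ)⁻¹‖ ≤ 1 := by
  rw [norm_inv]; exact inv_le_one_of_one_le₀ (wd_norm τ)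

/-- one-dimensional Gaussian wave packet -/
def psi (ξ τ y : ℝ) : ℂ :=
  (wd τ) ^ (-(1/2) : ℂ) * Complex.exp (-(wd τ)⁻¹ * ((y:ℂ) - Complex.I * ξ) ^ 2)

lemma psi_smooth (ξ τ : ℝ) : ContDiff ℝ (⊤ : ℕ∞) (psi ξ τ) := by
  have h1 : ContDiff ℝ (⊤ : ℕ∞) (fun s : ℝ => (s : ℂ)) := Complex.ofRealCLM.contDiff
  unfold psi
  exact contDiff_const.mul ((contDiff_const.mul ((h1.sub contDiff_const).pow 2)).cexp)

lemma psi_deriv (ξ τ : ℝ) : deriv (psi ξ τ) =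
    fun y : ℝ => (-2 * (wd τ)⁻¹ * ((y:ℂ) - Complex.I * ξ)) * psi ξ τ y := by
  funext y
  have hz : HasDerivAt (fun y : ℝ => (y:ℂ) - Complex.I * ξ) 1 y :=
    (Complex.ofRealCLM.hasDerivAt (x := y)).sub_const _
  have := (((hz.pow 2).const_mul (-(wd τ)⁻¹)).cexp).const_mul ((wd τ) ^ (-(1/2) : ℂ))
  refine (HasDerivAt.deriv (f := psi ξ τ) this).trans ?_
  unfold psi
  simp
  ring

lemma psi_deriv2 (ξ τ : ℝ) : deriv (deriv (psi ξ τ)) =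
    fun y : ℝ => (4 * (wd τ)⁻¹ ^ 2 * ((y:ℂ) - Complex.I * ξ) ^ 2 - 2 * (wd τ)⁻¹) * psi ξ τ y := by
  funext y
  have hz : HasDerivAt (fun y : ℝ => (y:ℂ) - Complex.I * ξ) 1 y :=
    (Complex.ofRealCLM.hasDerivAt (x := y)).sub_const _
  have hp : HasDerivAt (psi ξ τ) ((-2 * (wd τ)⁻¹ * ((y:ℂ) - Complex.I * ξ)) * psi ξ τ y) y := by
    have := ((psi_smooth ξ τ).differentiable (by simp)).differentiableAt (x := y) |>.hasDerivAt
    rwa [psi_deriv] at this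
  rw [psi_deriv]
  refine (HasDerivAt.deriv ((hz.const_mul (-2 * (wd τ)⁻¹)).mul hp)).trans ?_
  ring

lemma psi_dt (ξ τ y : ℝ) :
    HasDerivAt (fun τ => psi ξ τ y) (Complex.I * deriv (deriv (psi ξ τ)) y) τ := by
  rw [psi_deriv2]
  set Z : ℂ := ((y:ℂ) - Complex.I * ξ) ^ 2 with hZ
  have h1 : HasDerivAt (fun s : ℂ => 1 + 4 * Complex.I * s) (4 * Complex.I) (τ:ℂ) := by
    simpa using ((hasDerivAt_id (τ:ℂ)).const_mul (4 * Complex.I)).const_add 1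
  have hw : (1 + 4 * Complex.I * (τ:ℂ)) = wd τ := rfl
  have h2 := h1.cpow_const (c := (-(1/2) : ℂ)) (by rw [hw]; exact wd_slit τ)
  have h3 := ((h1.inv (by rw [hw]; exact wd_ne τ)).neg.mul_const Z).cexp
  have h4 := (h2.mul h3).comp_ofReal
  refine (h4.congr_deriv ?_ : HasDerivAt (fun τ => psi ξ τ y) _ τ)
  have e : wd τ ^ (-(1 / 2) - 1 : ℂ) = wd τ ^ (-(1/2) : ℂ) * (wd τ)⁻¹ := by
    rw [Complex.cpow_sub _ _ (wd_ne τ), Complex.cpow_one, div_eq_mul_inv]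
  simp only [Pi.inv_apply, Pi.neg_apply, hw, e]
  unfold psi
  field_simp
  ring

/-- decay rate -/
def rt (T : ℝ) : ℝ := (2 * (1 + 16 * T ^ 2))⁻¹
lemma rt_pos (T : ℝ) : 0 < rt T := by unfold rt; positivity
/-- constant -/
def CT (T ξ : ℝ) : ℝ := 8 * (1 + |ξ|) ^ 2 * Real.exp (ξ ^ 2 + (2 * |ξ| + 2) ^ 2 / (4 * rt T))

lemma CT_pos (T ξ : ℝ) : 0 < CT T ξ := by unfold CT; positivity

lemma psi_norm_le {T τ : ℝ} (h : |τ| ≤ T) (ξ y : ℝ) :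
    ‖psi ξ τ y‖ ≤ Real.exp (ξ ^ 2 + 2 * |ξ| * |y| - 2 * rt T * y ^ 2) := by
  unfold psi
  rw [norm_mul, Complex.norm_exp]
  have h1 : ‖wd τ ^ (-(1/2) : ℂ)‖ ≤ 1 := by
    have : (-(1/2) : ℂ) = ((-(1/2) : ℝ) : ℂ) := by push_cast; ring
    rw [this, Complex.norm_cpow_real]
    exact Real.rpow_le_one_of_one_le_of_nonpos (wd_norm τ) (by norm_num)
  have hn : ‖(wd τ)⁻¹‖ ≤ 1 := wd_inv_norm τ
  have e : -(wd τ)⁻¹ * ((y:ℂ) - Complex.I * ξ) ^ 2 =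
      ((-y^2 : ℝ) : ℂ) * (wd τ)⁻¹ + (wd τ)⁻¹ * (2 * Complex.I * ξ * y + ξ ^ 2) := by
    push_cast; ring_nf; simp
  have hre : (wd τ)⁻¹.re = (1 + 16 * τ ^ 2)⁻¹ := by
    rw [Complex.inv_re, wd_re, wd_normSq]; simp
  have hb : (1 + 16 * T ^ 2)⁻¹ ≤ (1 + 16 * τ ^ 2)⁻¹ := by
    have := sq_le_sq' (by linarith [neg_abs_le τ]) ((le_abs_self τ).trans h)
    gcongr
  have h2 : ((wd τ)⁻¹ * (2 * Complex.I * ξ * y + ξ ^ 2)).re ≤ ξ ^ 2 + 2 * |ξ| * |y| := by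
    refine (Complex.re_le_norm _).trans ?_
    rw [norm_mul]
    have : ‖(2 * Complex.I * ξ * y + (ξ:ℂ) ^ 2)‖ ≤ ξ ^ 2 + 2 * |ξ| * |y| := by
      refine (norm_add_le _ _).trans ?_
      simp [Complex.norm_real]
      linarith
    calc _ ≤ 1 * ‖(2 * Complex.I * ξ * y + (ξ:ℂ) ^ 2)‖ := by gcongr
      _ ≤ _ := by rw [one_mul]; exact this
  calc _ ≤ 1 * Real.exp ((-(wd τ)⁻¹ * ((y:ℂ) - Complex.I * ξ) ^ 2).re) := by gcongr
    _ ≤ _ := by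
      rw [one_mul, e, Complex.add_re, Complex.re_ofReal_mul, hre]
      refine Real.exp_le_exp.2 ?_
      have : 2 * rt T = (1 + 16 * T ^ 2)⁻¹ := by unfold rt; field_simp
      rw [this]
      nlinarith [sq_nonneg y]

lemma psi_bounds {T τ : ℝ} (h : |τ| ≤ T) (ξ y : ℝ) :
    ‖psi ξ τ y‖ ≤ CT T ξ * Real.exp (-rt T * y ^ 2) ∧
    ‖deriv (psi ξ τ) y‖ ≤ CT T ξ * Real.exp (-rt T * y ^ 2) ∧
    ‖deriv (deriv (psi ξ τ)) y‖ ≤ CT T ξ * Real.exp (-rt T * y ^ 2) := by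
  have hp := psi_norm_le h ξ y
  have hn : ‖(wd τ)⁻¹‖ ≤ 1 := wd_inv_norm τ
  set A := (1 + |ξ|) with hA
  have hA1 : 1 ≤ A := by simp [hA]
  set B := 1 + |y| with hB
  have hB1 : 1 ≤ B := by simp [hB]
  have hz : ‖(y:ℂ) - Complex.I * ξ‖ ≤ A * B := by
    refine (norm_sub_le _ _).trans ?_
    simp [Complex.norm_real, hA, hB]
    nlinarith [abs_nonneg ξ, abs_nonneg y]
  have hAB : 1 ≤ A * B := one_le_mul_of_one_le_of_one_le hA1 hB1
  have hmain : 8 * (A * B) ^ 2 * ‖psi ξ τ y‖ ≤ CT T ξ * Real.exp (-rt T * y ^ 2) := by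
    have hBe : B ^ 2 ≤ Real.exp (2 * |y|) := by
      have : B ≤ Real.exp |y| := by rw [hB, add_comm]; exact Real.add_one_le_exp _
      calc B ^ 2 ≤ Real.exp |y| ^ 2 := by gcongr
        _ = _ := by rw [← Real.exp_nat_mul]; norm_num
    calc 8 * (A * B) ^ 2 * ‖psi ξ τ y‖ ≤ 8 * (A ^ 2 * Real.exp (2 * |y|)) *
          Real.exp (ξ ^ 2 + 2 * |ξ| * |y| - 2 * rt T * y ^ 2) := by
          rw [mul_pow]; gcongr
      _ = 8 * A ^ 2 * Real.exp (2 * |y| + (ξ ^ 2 + 2 * |ξ| * |y| - 2 * rt T * y ^ 2)) := by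
          rw [Real.exp_add]; ring
      _ ≤ 8 * A ^ 2 * Real.exp ((ξ ^ 2 + (2 * |ξ| + 2) ^ 2 / (4 * rt T)) + -rt T * y ^ 2) := by
          refine mul_le_mul_of_nonneg_left (Real.exp_le_exp.2 ?_) (by positivity)
          have hr := rt_pos T
          have : (2 * |ξ| + 2) * |y| ≤ (2 * |ξ| + 2) ^ 2 / (4 * rt T) + rt T * y ^ 2 := by
            rw [div_add' _ _ _ (by positivity), le_div_iff₀ (by positivity), ← sq_abs y]
            nlinarith [sq_nonneg ((2 * |ξ| + 2) - 2 * rt T * |y|)]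
          nlinarith
      _ = _ := by unfold CT; rw [Real.exp_add]; ring
  have hle : ∀ c : ℂ, ‖c‖ ≤ 8 * (A * B) ^ 2 → ‖c * psi ξ τ y‖ ≤ CT T ξ * Real.exp (-rt T * y ^ 2) := by
    intro c hc
    refine le_trans ?_ hmain
    rw [norm_mul]; gcongr
  have hAB2 : A * B ≤ (A * B) ^ 2 := by nlinarith
  refine ⟨?_, ?_, ?_⟩
  · simpa using hle 1 (by simp; nlinarith)
  · rw [psi_deriv]
    refine hle _ ?_
    rw [norm_mul, norm_mul]
    calc _ ≤ 2 * 1 * (A * B) := by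
          have : ‖(-2:ℂ)‖ = 2 := by simp
          rw [this]; gcongr
      _ ≤ _ := by nlinarith
  · rw [psi_deriv2]
    refine hle _ ?_
    refine (norm_sub_le _ _).trans ?_
    rw [norm_mul, norm_mul, norm_mul, norm_pow, norm_pow]
    calc _ ≤ ‖(4:ℂ)‖ * 1 ^ 2 * (A * B) ^ 2 + ‖(2:ℂ)‖ * 1 := by gcongr
      _ ≤ _ := by simp; nlinarith

/-- one-dimensional propagator constant -/
def kc (t : ℝ) : ℂ := (wd t) ^ (-(1/2) : ℂ) / ((Real.pi : ℂ) / -(Complex.I / (4 * t) - 1)) ^ (1/2 : ℂ)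

/-- one-dimensional propagator kernel -/
def kap (t y s : ℝ) : ℂ := kc t * Complex.exp (Complex.I * ((y:ℂ) - s) ^ 2 / (4 * t))

lemma kap_norm {t : ℝ} (ht : t ≠ 0) (y s : ℝ) : ‖kap t y s‖ = (4 * Real.pi * |t|) ^ (-(1/2) : ℝ) := by
  have e : Complex.I * ((y:ℂ) - s) ^ 2 / (4 * t) = (((y - s) ^ 2 / (4 * t) : ℝ) : ℂ) * Complex.I := by
    push_cast; ring
  unfold kap kc
  rw [norm_mul, e, Complex.norm_exp_ofReal_mul_I, mul_one, norm_div]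
  have e1 : (-(1/2) : ℂ) = ((-(1/2) : ℝ) : ℂ) := by push_cast; ring
  have e2 : ((1/2) : ℂ) = (((1/2) : ℝ) : ℂ) := by push_cast; ring
  rw [e1, e2, Complex.norm_cpow_real, Complex.norm_cpow_real, norm_div]
  have h4 : (-(Complex.I / (4 * t) - 1)) = wd t * (-Complex.I / (4 * t)) := by
    have : (t:ℂ) ≠ 0 := by exact_mod_cast ht
    unfold wd
    field_simp
    ring_nf
    simp
  rw [h4, norm_mul]
  have h5 : ‖-Complex.I / (4 * (t:ℂ))‖ = (4 * |t|)⁻¹ := by simp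
  rw [h5, Complex.norm_real]
  have hw : 0 < ‖wd t‖ := norm_pos_iff.2 (wd_ne t)
  have hpi : ‖Real.pi‖ = Real.pi := by simp [Real.pi_pos.le]
  have htp : 0 < |t| := abs_pos.2 ht
  rw [hpi, Real.rpow_neg hw.le, Real.rpow_neg (by positivity), inv_eq_one_div, div_div, ← Real.mul_rpow (by positivity) (by positivity),
    one_div]
  congr 2
  field_simp

lemma kap_int {t : ℝ} (ht : t ≠ 0) (ξ y : ℝ) :
    Integrable (fun s : ℝ => kap t y s * psi ξ 0 s) ∧ ∫ s : ℝ, kap t y s * psi ξ 0 s = psi ξ t y := by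
  have htc : (t:ℂ) ≠ 0 := by exact_mod_cast ht
  set b : ℂ := Complex.I / (4 * t) - 1 with hb
  set c : ℂ := -Complex.I * y / (2 * t) + 2 * Complex.I * ξ with hc
  set d : ℂ := Complex.I * y ^ 2 / (4 * t) + ξ ^ 2 with hd
  have hbre : b.re < 0 := by
    have e : b = (((1 / (4 * t) : ℝ)) : ℂ) * Complex.I - 1 := by rw [hb]; push_cast; ring
    rw [e]; simp
  have e : ∀ s : ℝ, kap t y s * psi ξ 0 s = kc t * Complex.exp (b * s ^ 2 + c * s + d) := by
    intro s
    have w0 : wd 0 = 1 := by simp [wd]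
    unfold kap psi
    rw [w0, Complex.one_cpow, one_mul, mul_assoc, ← Complex.exp_add]
    congr 2
    rw [hb, hc, hd]
    field_simp
    ring_nf
    simp
    ring
  simp_rw [e]
  have hbz : b ≠ 0 := fun h => by rw [h] at hbre; simp at hbre
  refine ⟨?_, ?_⟩
  · exact (integrable_cexp_quadratic' hbre c d).const_mul _
  · rw [integral_const_mul, integral_cexp_quadratic hbre]
    unfold psi kc
    rw [← hb, ← mul_assoc, div_mul_cancel₀]
    · congr 2
      have hb' : b = wd t * Complex.I / (4 * t) := by
        rw [hb]; unfold wd; field_simp; ring_nf; simp; ring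
      have hw := wd_ne t
      rw [hb', hc, hd]
      field_simp
      unfold wd
      ring_nf
      simp [Complex.I_sq]
      ring
    · refine (Complex.cpow_ne_zero_iff_of_exponent_ne_zero (by norm_num)).2 ?_
      refine div_ne_zero (by exact_mod_cast Real.pi_ne_zero) (neg_ne_zero.2 hbz)

end KT

namespace KT
open Set Filter Topology ManyBodyWaveguide

variable {m n N : ℕ}

/-- Gaussian weight -/
def Gs (c : Fin N × Fin m → ℝ) (x : Cfg m n N) : ℝ :=
  ∏ p : Fin N × Fin m, Real.exp (-c p * ((x p.1).1 p.2) ^ 2)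

lemma Gs_nonneg (c : Fin N × Fin m → ℝ) (x : Cfg m n N) : 0 ≤ Gs c x :=
  Finset.prod_nonneg fun _ _ => (Real.exp_pos _).le

lemma Gs_pos (c : Fin N × Fin m → ℝ) (x : Cfg m n N) : 0 < Gs c x :=
  Finset.prod_pos fun _ _ => Real.exp_pos _

lemma Gs_cont (c : Fin N × Fin m → ℝ) : Continuous (Gs (n := n) c) := by
  unfold Gs
  exact continuous_finsetProd _ fun p _ => by fun_prop

lemma Gs_mul (c d : Fin N × Fin m → ℝ) (x : Cfg m n N) : Gs c x * Gs d x = Gs (c + d) x := by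
  unfold Gs
  rw [← Finset.prod_mul_distrib]
  refine Finset.prod_congr rfl fun p _ => ?_
  rw [← Real.exp_add, Pi.add_apply]; ring_nf

lemma Gs_integrable {c : Fin N × Fin m → ℝ} (hc : ∀ p, 0 < c p) :
    Integrable (Gs c : Cfg m n N → ℝ) := by
  have e : (Gs c : Cfg m n N → ℝ) = fun x => ∏ a : Fin N, (fun (a : Fin N) (w : Wg m n) =>
      (∏ i : Fin m, Real.exp (-c (a, i) * (w.1 i) ^ 2)) * 1) a (x a) := by
    funext x
    unfold Gs
    rw [Fintype.prod_prod_type]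
    simp
  rw [e, volume_pi]
  refine Integrable.fintype_prod (f := fun (a : Fin N) (w : Wg m n) =>
      (∏ i : Fin m, Real.exp (-c (a, i) * (w.1 i) ^ 2)) * 1) fun a => ?_
  rw [Measure.volume_eq_prod]
  refine Integrable.mul_prod (f := fun y : Fin m → ℝ => ∏ i : Fin m, Real.exp (-c (a, i) * (y i) ^ 2))
    (g := fun _ : Torus n => (1:ℝ)) ?_ (integrable_const _)
  rw [volume_pi]
  exact Integrable.fintype_prod (f := fun (i : Fin m) (s : ℝ) => Real.exp (-c (a, i) * s ^ 2))
    fun i => integrable_exp_neg_mul_sq (hc (a, i))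

lemma Gs_memLp {c : Fin N × Fin m → ℝ} (hc : ∀ p, 0 < c p) :
    MemLp (Gs c : Cfg m n N → ℝ) 2 volume := by
  rw [memLp_two_iff_integrable_sq (Gs_cont c).aestronglyMeasurable]
  have : (fun x : Cfg m n N => Gs c x ^ 2) = Gs (c + c) := by
    funext x; rw [← Gs_mul, sq]
  rw [this]
  exact Gs_integrable fun p => add_pos (hc p) (hc p)

lemma fourier_norm (k : ℤ) (z : AddCircle (1:ℝ)) : ‖fourier k z‖ = 1 := by
  rw [fourier_apply]; exact Circle.norm_coe _

lemma Ten_bound {v : Fin N × Fin m → ℝ → ℂ} {D c : Fin N × Fin m → ℝ}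
    (h : ∀ p y, ‖v p y‖ ≤ D p * Real.exp (-c p * y ^ 2)) (k : Fin N × Fin n → ℤ) (x : Cfg m n N) :
    ‖Ten v k x‖ ≤ (∏ p, D p) * Gs c x := by
  unfold Ten Gs
  rw [norm_mul, norm_prod, norm_prod, ← Finset.prod_mul_distrib]
  simp_rw [fourier_norm]
  rw [Finset.prod_const_one, mul_one]
  exact Finset.prod_le_prod (fun _ _ => norm_nonneg _) fun p _ => h p _

lemma Ten_bound' {v : Fin N × Fin m → ℝ → ℂ} {D c : Fin N × Fin m → ℝ}
    (h : ∀ p y, ‖v p y‖ ≤ D p * Real.exp (-c p * y ^ 2))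
    (h2 : ∀ p y, ‖deriv (deriv (v p)) y‖ ≤ D p * Real.exp (-c p * y ^ 2))
    (k : Fin N × Fin n → ℤ) (p : Fin N × Fin m) (x : Cfg m n N) :
    ‖Ten (Function.update v p (deriv (deriv (v p)))) k x‖ ≤ (∏ p, D p) * Gs c x := by
  refine Ten_bound (fun q y => ?_) k x
  by_cases hq : q = p
  · subst hq; simpa using h2 q y
  · rw [Function.update_of_ne hq]; exact h q y

lemma lam_nonneg (k : Fin N × Fin n → ℤ) : 0 ≤ lam k :=
  Finset.sum_nonneg fun _ _ => by positivity

lemma LT_bound {v : Fin N × Fin m → ℝ → ℂ} {D c : Fin N × Fin m → ℝ}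
    (h : ∀ p y, ‖v p y‖ ≤ D p * Real.exp (-c p * y ^ 2))
    (h2 : ∀ p y, ‖deriv (deriv (v p)) y‖ ≤ D p * Real.exp (-c p * y ^ 2))
    (k : Fin N × Fin n → ℤ) (x : Cfg m n N) :
    ‖LT v k x‖ ≤ ((Fintype.card (Fin N × Fin m) : ℝ) + lam k) * ((∏ p, D p) * Gs c x) := by
  unfold LT
  refine (norm_sub_le _ _).trans ?_
  rw [add_mul]
  refine add_le_add ?_ ?_
  · refine (norm_sum_le _ _).trans ?_
    refine (Finset.sum_le_sum fun p _ => Ten_bound' h h2 k p x).trans ?_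
    simp
  · rw [norm_mul, Complex.norm_real, Real.norm_of_nonneg (lam_nonneg k)]
    exact mul_le_mul_of_nonneg_left (Ten_bound h k x) (lam_nonneg k)

lemma LT_cont {v : Fin N × Fin m → ℝ → ℂ} (hv : ∀ p, ContDiff ℝ (⊤ : ℕ∞) (v p))
    (k : Fin N × Fin n → ℤ) : Continuous (LT v k) := by
  unfold LT
  refine Continuous.sub (continuous_finsetSum _ fun p _ => Ten_cont (fun q => ?_) k)
    (continuous_const.mul (Ten_cont (fun q => (hv q).continuous) k))
  exact (smooth_update hv p (smooth_deriv (smooth_deriv (hv p))) q).continuous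

lemma cutoff : ∃ (χ : ℕ → ℝ → ℂ) (M : ℝ), 1 ≤ M ∧ (∀ j, ContDiff ℝ (⊤ : ℕ∞) (χ j)) ∧
    (∀ j, HasCompactSupport (χ j)) ∧ (∀ j y, ‖χ j y‖ ≤ 1) ∧ (∀ j y, ‖deriv (χ j) y‖ ≤ M) ∧
    (∀ j y, ‖deriv (deriv (χ j)) y‖ ≤ M) ∧ ∀ y, ∀ᶠ j in atTop, ∀ᶠ y' in 𝓝 y, χ j y' = 1 := by
  let f : ContDiffBump (0:ℝ) := ⟨1, 2, by norm_num, by norm_num⟩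
  set η : ℝ → ℂ := fun y => (f y : ℂ) with hη
  have hs : ContDiff ℝ (⊤ : ℕ∞) η := (Complex.ofRealCLM.contDiff (n := (⊤ : ℕ∞))).comp f.contDiff
  have hcs : HasCompactSupport η := f.hasCompactSupport.comp_left (g := fun r : ℝ => (r:ℂ)) (by simp)
  have hs1 := smooth_deriv hs
  have hs2 := smooth_deriv hs1
  obtain ⟨M1, hM1⟩ := hcs.deriv.exists_bound_of_continuous hs1.continuous
  obtain ⟨M2, hM2⟩ := hcs.deriv.deriv.exists_bound_of_continuous hs2.continuous
  have hcj : ∀ j : ℕ, (0:ℝ) < ((j:ℝ) + 1)⁻¹ ∧ ((j:ℝ) + 1)⁻¹ ≤ 1 := fun j =>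
    ⟨by positivity, inv_le_one_of_one_le₀ (by linarith [(Nat.cast_nonneg j : (0:ℝ) ≤ j)])⟩
  have hd1 : ∀ j : ℕ, deriv (fun y => η (((j:ℝ) + 1)⁻¹ * y)) =
      fun y => ((j:ℝ) + 1)⁻¹ • deriv η (((j:ℝ) + 1)⁻¹ * y) := fun j => by
    funext y; exact deriv_comp_mul_left _ _ _
  have hd2 : ∀ j : ℕ, deriv (deriv (fun y => η (((j:ℝ) + 1)⁻¹ * y))) =
      fun y => ((j:ℝ) + 1)⁻¹ • (((j:ℝ) + 1)⁻¹ • deriv (deriv η) (((j:ℝ) + 1)⁻¹ * y)) := fun j => by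
    funext y
    rw [hd1, deriv_fun_const_smul_field, deriv_comp_mul_left]
  refine ⟨fun j y => η (((j:ℝ) + 1)⁻¹ * y), max 1 (max M1 M2), le_max_left _ _, ?_, ?_, ?_, ?_, ?_, ?_⟩
  · intro j; exact hs.comp (contDiff_const.mul contDiff_id)
  · intro j
    have := hcs.comp_homeomorph (Homeomorph.mulLeft₀ (((j:ℝ) + 1)⁻¹) (hcj j).1.ne')
    exact this
  · intro j y
    simp only [hη, Complex.norm_real]
    rw [Real.norm_of_nonneg f.nonneg]; exact f.le_one
  · intro j y
    rw [hd1]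
    simp only [norm_smul, Real.norm_of_nonneg (hcj j).1.le]
    calc _ ≤ 1 * M1 := mul_le_mul (hcj j).2 (hM1 _) (norm_nonneg _) (by norm_num)
      _ ≤ _ := by rw [one_mul]; exact (le_max_left _ _).trans (le_max_right _ _)
  · intro j y
    rw [hd2]
    simp only [norm_smul, Real.norm_of_nonneg (hcj j).1.le]
    calc _ ≤ 1 * (1 * M2) := by
          refine mul_le_mul (hcj j).2 (mul_le_mul (hcj j).2 (hM2 _) (norm_nonneg _) (by norm_num))
            (mul_nonneg (hcj j).1.le (norm_nonneg _)) (by norm_num)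
      _ ≤ _ := by rw [one_mul, one_mul]; exact (le_max_right _ _).trans (le_max_right _ _)
  · intro y
    have h1 : ∀ᶠ j : ℕ in atTop, |y| + 1 < (j:ℝ) := (tendsto_natCast_atTop_atTop.eventually_gt_atTop _)
    filter_upwards [h1] with j hj
    filter_upwards [Metric.ball_mem_nhds y one_pos] with y' hy'
    have hy2 : |y'| ≤ j := by
      have h3 : |y' - y| < 1 := by simpa [Real.dist_eq] using hy'
      have h4 : |y'| ≤ |y' - y| + |y| := by simpa using abs_add_le (y' - y) y
      linarith
    have : f (((j:ℝ) + 1)⁻¹ * y') = 1 := by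
      refine f.one_of_mem_closedBall ?_
      simp only [Metric.mem_closedBall, dist_zero_right, norm_mul, Real.norm_of_nonneg (hcj j).1.le, Real.norm_eq_abs]
      rw [inv_mul_le_iff₀ (by positivity)]
      change |y'| ≤ ((j:ℝ) + 1) * 1
      linarith
    simp [hη, this]

lemma weak_ext {U : ℝ → L2 m n N →L[ℂ] L2 m n N} (hU : IsPropagator m n N 0 U)
    {v : Fin N × Fin m → ℝ → ℂ} (hv : ∀ p, ContDiff ℝ (⊤ : ℕ∞) (v p)) {D c : Fin N × Fin m → ℝ}
    (hc : ∀ p, 0 < c p)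
    (b0 : ∀ p y, ‖v p y‖ ≤ D p * Real.exp (-c p * y ^ 2))
    (b1 : ∀ p y, ‖deriv (v p) y‖ ≤ D p * Real.exp (-c p * y ^ 2))
    (b2 : ∀ p y, ‖deriv (deriv (v p)) y‖ ≤ D p * Real.exp (-c p * y ^ 2))
    (k : Fin N × Fin n → ℤ) :
    WRel U (toL volume (Ten v k)) (toL volume (LT v k)) := by
  obtain ⟨χ, M, hM, hχ, hχc, hχ0, hχ1, hχ2, hχl⟩ := cutoff
  set w : ℕ → Fin N × Fin m → ℝ → ℂ := fun j p y => χ j y * v p y with hw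
  have hws : ∀ j p, ContDiff ℝ (⊤ : ℕ∞) (w j p) := fun j p => (hχ j).mul (hv p)
  have hwc : ∀ j p, HasCompactSupport (w j p) := fun j p => (hχc j).mul_right
  have hd : ∀ {u : ℝ → ℂ}, ContDiff ℝ (⊤ : ℕ∞) u → ∀ y, HasDerivAt u (deriv u y) y := fun h y =>
    (h.differentiable (by simp)).differentiableAt.hasDerivAt
  have hw1 : ∀ j p, deriv (w j p) = fun y => deriv (χ j) y * v p y + χ j y * deriv (v p) y := by
    intro j p; funext y
    exact ((hd (hχ j) y).mul (hd (hv p) y)).deriv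
  have hw2 : ∀ j p, deriv (deriv (w j p)) = fun y => (deriv (deriv (χ j)) y * v p y +
      deriv (χ j) y * deriv (v p) y) + (deriv (χ j) y * deriv (v p) y + χ j y * deriv (deriv (v p)) y) := by
    intro j p; funext y
    rw [hw1]
    exact (((hd (smooth_deriv (hχ j)) y).mul (hd (hv p) y)).add
      ((hd (hχ j) y).mul (hd (smooth_deriv (hv p)) y))).deriv
  have hDg : ∀ p y, 0 ≤ D p * Real.exp (-c p * y ^ 2) := fun p y => (norm_nonneg _).trans (b0 p y)
  have hB0 : ∀ j p y, ‖w j p y‖ ≤ (4 * M * D p) * Real.exp (-c p * y ^ 2) := by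
    intro j p y
    rw [hw]
    simp only [norm_mul]
    calc _ ≤ 1 * (D p * Real.exp (-c p * y ^ 2)) :=
          mul_le_mul (hχ0 j y) (b0 p y) (norm_nonneg _) (by norm_num)
      _ ≤ _ := by nlinarith [hDg p y]
  have hB2 : ∀ j p y, ‖deriv (deriv (w j p)) y‖ ≤ (4 * M * D p) * Real.exp (-c p * y ^ 2) := by
    intro j p y
    rw [hw2]
    have e1 : ‖deriv (deriv (χ j)) y * v p y‖ ≤ M * (D p * Real.exp (-c p * y ^ 2)) := by
      rw [norm_mul]; exact mul_le_mul (hχ2 j y) (b0 p y) (norm_nonneg _) (by linarith)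
    have e2 : ‖deriv (χ j) y * deriv (v p) y‖ ≤ M * (D p * Real.exp (-c p * y ^ 2)) := by
      rw [norm_mul]; exact mul_le_mul (hχ1 j y) (b1 p y) (norm_nonneg _) (by linarith)
    have e3 : ‖χ j y * deriv (deriv (v p)) y‖ ≤ M * (D p * Real.exp (-c p * y ^ 2)) := by
      rw [norm_mul]; exact mul_le_mul ((hχ0 j y).trans hM) (b2 p y) (norm_nonneg _) (by linarith)
    refine (norm_add_le _ _).trans ?_
    have e4 := norm_add_le (deriv (deriv (χ j)) y * v p y) (deriv (χ j) y * deriv (v p) y)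
    have e5 := norm_add_le (deriv (χ j) y * deriv (v p) y) (χ j y * deriv (deriv (v p)) y)
    linarith
  have hmono : ∀ p y, D p * Real.exp (-c p * y ^ 2) ≤ (4 * M * D p) * Real.exp (-c p * y ^ 2) := by
    intro p y; nlinarith [hDg p y]
  have hloc : ∀ p y, ∀ᶠ j in atTop, w j p =ᶠ[𝓝 y] v p := by
    intro p y
    filter_upwards [hχl y] with j hj
    filter_upwards [hj] with y' hy'
    simp [hw, hy']
  have hl0 : ∀ p y, Tendsto (fun j => w j p y) atTop (𝓝 (v p y)) := by
    intro p y
    refine tendsto_const_nhds.congr' ?_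
    filter_upwards [hloc p y] with j hj
    exact hj.self_of_nhds.symm
  have hl2 : ∀ p y, Tendsto (fun j => deriv (deriv (w j p)) y) atTop (𝓝 (deriv (deriv (v p)) y)) := by
    intro p y
    refine tendsto_const_nhds.congr' ?_
    filter_upwards [hloc p y] with j hj
    exact hj.deriv.deriv.self_of_nhds.symm
  have hTl : ∀ (a : ℕ → Fin N × Fin m → ℝ → ℂ) (a0 : Fin N × Fin m → ℝ → ℂ),
      (∀ p y, Tendsto (fun j => a j p y) atTop (𝓝 (a0 p y))) →
      ∀ x : Cfg m n N, Tendsto (fun j => Ten (a j) k x) atTop (𝓝 (Ten a0 k x)) := by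
    intro a a0 ha x
    unfold Ten
    exact (tendsto_finsetProd _ fun p _ => ha p _).mul_const _
  have hGm : ∀ r : ℝ, MemLp (fun x : Cfg m n N => r * ((∏ p, (4 * M * D p)) * Gs c x)) 2 volume :=
    fun r => ((Gs_memLp hc).const_mul _).const_mul r
  have hGm1 : MemLp (fun x : Cfg m n N => ((∏ p, (4 * M * D p)) * Gs c x)) 2 volume :=
    (Gs_memLp hc).const_mul _
  have m1 : ∀ j, MemLp (Ten (w j) k) 2 (volume : Measure (Cfg m n N)) := fun j =>
    memLp_dom hGm1 (Ten_cont (fun p => (hws j p).continuous) k).aestronglyMeasurable (Ten_bound (hB0 j) k)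
  have m2 : ∀ j, MemLp (LT (w j) k) 2 (volume : Measure (Cfg m n N)) := fun j =>
    memLp_dom (hGm _) (LT_cont (hws j) k).aestronglyMeasurable (LT_bound (hB0 j) (hB2 j) k)
  refine WRel_closed (a := fun j => toL volume (Ten (w j) k)) (b := fun j => toL volume (LT (w j) k))
    hU.unitary (fun j => weak_Ten hU (hws j) (hwc j) k (m1 j) (m2 j)) ?_ ?_
  · refine dct hGm1 (fun j => (Ten_cont (fun p => (hws j p).continuous) k).measurable)
      (Ten_cont (fun p => (hv p).continuous) k).measurable
      (Eventually.of_forall fun j => Ten_bound (hB0 j) k)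
      (Ten_bound (fun p y => (b0 p y).trans (hmono p y)) k) (hTl w v hl0)
  · refine dct (hGm _) (fun j => (LT_cont (hws j) k).measurable) (LT_cont hv k).measurable
      (Eventually.of_forall fun j => LT_bound (hB0 j) (hB2 j) k)
      (LT_bound (fun p y => (b0 p y).trans (hmono p y)) (fun p y => (b2 p y).trans (hmono p y)) k) ?_
    intro x
    unfold LT
    refine Tendsto.sub (tendsto_finsetSum _ fun p _ => ?_) ((hTl w v hl0 x).const_mul _)
    refine hTl (fun j => Function.update (w j) p (deriv (deriv (w j p)))) _ ?_ x
    intro q y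
    by_cases hq : q = p
    · subst hq; simpa using hl2 q y
    · simp only [Function.update_of_ne hq]; exact hl0 q y

end KT

namespace KT
open Set Filter Topology ManyBodyWaveguide

variable {m n N : ℕ}

/-- phase -/
def ph (k : Fin N × Fin n → ℤ) (τ : ℝ) : ℂ := Complex.exp (-Complex.I * lam k * τ)

lemma ph_norm (k : Fin N × Fin n → ℤ) (τ : ℝ) : ‖ph k τ‖ = 1 := by
  unfold ph
  rw [show -Complex.I * lam k * τ = ((-(lam k * τ) : ℝ) : ℂ) * Complex.I by push_cast; ring]
  exact Complex.norm_exp_ofReal_mul_I _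

lemma ph_zero (k : Fin N × Fin n → ℤ) : ph k 0 = 1 := by simp [ph]

lemma ph_deriv (k : Fin N × Fin n → ℤ) (τ : ℝ) : HasDerivAt (ph k) (-Complex.I * lam k * ph k τ) τ := by
  have h1 : HasDerivAt (fun s : ℂ => Complex.exp (-Complex.I * lam k * s))
      (Complex.exp (-Complex.I * lam k * τ) * (-Complex.I * lam k * 1)) (τ:ℂ) :=
    ((hasDerivAt_id (τ:ℂ)).const_mul (-Complex.I * lam k)).cexp
  refine (h1.comp_ofReal.congr_deriv ?_ : HasDerivAt (ph k) _ τ)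
  unfold ph; ring

/-- Gaussian wave packets -/
def WP (ξ : Fin N × Fin m → ℝ) (k : Fin N × Fin n → ℤ) (τ : ℝ) (x : Cfg m n N) : ℂ :=
  ph k τ * Ten (fun p => psi (ξ p) τ) k x

/-- their Laplacian -/
def WL (ξ : Fin N × Fin m → ℝ) (k : Fin N × Fin n → ℤ) (τ : ℝ) (x : Cfg m n N) : ℂ :=
  ph k τ * LT (fun p => psi (ξ p) τ) k x

lemma WP_cont (ξ : Fin N × Fin m → ℝ) (k : Fin N × Fin n → ℤ) (τ : ℝ) : Continuous (WP ξ k τ) :=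
  continuous_const.mul (Ten_cont (fun q => (psi_smooth _ _).continuous) k)

lemma WL_cont (ξ : Fin N × Fin m → ℝ) (k : Fin N × Fin n → ℤ) (τ : ℝ) : Continuous (WL ξ k τ) :=
  continuous_const.mul (LT_cont (fun q => (psi_smooth _ _)) k)

lemma WP_bound {T τ : ℝ} (h : |τ| ≤ T) (ξ : Fin N × Fin m → ℝ) (k : Fin N × Fin n → ℤ) (x : Cfg m n N) :
    ‖WP ξ k τ x‖ ≤ (∏ p, CT T (ξ p)) * Gs (fun _ => rt T) x := by
  unfold WP
  rw [norm_mul, ph_norm, one_mul]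
  exact Ten_bound (fun p y => (psi_bounds h (ξ p) y).1) k x

lemma WL_bound {T τ : ℝ} (h : |τ| ≤ T) (ξ : Fin N × Fin m → ℝ) (k : Fin N × Fin n → ℤ) (x : Cfg m n N) :
    ‖WL ξ k τ x‖ ≤ ((Fintype.card (Fin N × Fin m) : ℝ) + lam k) *
      ((∏ p, CT T (ξ p)) * Gs (fun _ => rt T) x) := by
  unfold WL
  rw [norm_mul, ph_norm, one_mul]
  exact LT_bound (fun p y => (psi_bounds h (ξ p) y).1) (fun p y => (psi_bounds h (ξ p) y).2.2) k x

lemma WP_memLp (ξ : Fin N × Fin m → ℝ) (k : Fin N × Fin n → ℤ) (τ : ℝ) : MemLp (WP ξ k τ) 2 volume :=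
  memLp_dom ((Gs_memLp fun _ => rt_pos |τ|).const_mul _) (WP_cont ξ k τ).aestronglyMeasurable
    (WP_bound le_rfl ξ k)

lemma WL_memLp (ξ : Fin N × Fin m → ℝ) (k : Fin N × Fin n → ℤ) (τ : ℝ) : MemLp (WL ξ k τ) 2 volume :=
  memLp_dom (((Gs_memLp fun _ => rt_pos |τ|).const_mul _).const_mul _) (WL_cont ξ k τ).aestronglyMeasurable
    (WL_bound le_rfl ξ k)

lemma WP_dt (ξ : Fin N × Fin m → ℝ) (k : Fin N × Fin n → ℤ) (τ : ℝ) (x : Cfg m n N) :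
    HasDerivAt (fun τ => WP ξ k τ x) (Complex.I * WL ξ k τ x) τ := by
  have h1 := HasDerivAt.fun_finsetProd (u := (Finset.univ : Finset (Fin N × Fin m)))
    (fun p _ => psi_dt (ξ p) τ ((x p.1).1 p.2))
  have h2 := (ph_deriv k τ).mul (h1.mul_const (∏ p : Fin N × Fin n, fourier (k p) ((x p.1).2 p.2)))
  refine (h2.congr_deriv ?_ : HasDerivAt (fun τ => WP ξ k τ x) _ τ)
  unfold WL LT
  have e : ∀ p : Fin N × Fin m, Ten (Function.update (fun p => psi (ξ p) τ) p (deriv (deriv (psi (ξ p) τ)))) k x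
      = ((∏ j ∈ Finset.univ.erase p, psi (ξ j) τ ((x j.1).1 j.2)) * deriv (deriv (psi (ξ p) τ)) ((x p.1).1 p.2))
        * ∏ p : Fin N × Fin n, fourier (k p) ((x p.1).2 p.2) := by
    intro p
    unfold Ten
    congr 1
    rw [← Finset.mul_prod_erase Finset.univ _ (Finset.mem_univ p), mul_comm]
    congr 1
    · refine Finset.prod_congr rfl fun j hj => ?_
      rw [Function.update_of_ne (Finset.ne_of_mem_erase hj)]
    · rw [Function.update_self]
  simp_rw [e]
  rw [← Finset.sum_mul]
  simp only [smul_eq_mul]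
  have e2 : ∑ p : Fin N × Fin m, (∏ j ∈ Finset.univ.erase p, psi (ξ j) τ ((x j.1).1 j.2)) *
      (Complex.I * deriv (deriv (psi (ξ p) τ)) ((x p.1).1 p.2)) = Complex.I *
      ∑ p : Fin N × Fin m, (∏ j ∈ Finset.univ.erase p, psi (ξ j) τ ((x j.1).1 j.2)) *
      (deriv (deriv (psi (ξ p) τ)) ((x p.1).1 p.2)) := by
    rw [Finset.mul_sum]; exact Finset.sum_congr rfl fun p _ => by ring
  rw [e2]
  unfold Ten
  ring

lemma WP_hasDeriv (ξ : Fin N × Fin m → ℝ) (k : Fin N × Fin n → ℤ) (τ : ℝ) :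
    HasDerivAt (fun τ => toL volume (WP ξ k τ)) (Complex.I • toL volume (WL ξ k τ)) τ := by
  rw [← toL_smul (WL_memLp ξ k τ)]
  refine toL_deriv (Φ' := fun τ x => Complex.I * WL ξ k τ x) one_pos
    (((Gs_memLp fun _ => rt_pos (|τ| + 1)).const_mul (∏ p, CT (|τ| + 1) (ξ p))).const_mul
      ((Fintype.card (Fin N × Fin m) : ℝ) + lam k))
    (WP_memLp ξ k) (fun t => (WP_cont ξ k t).measurable) ((WL_cont ξ k τ).measurable.const_mul _)
    (fun t _ x => WP_dt ξ k t x) fun t ht x => ?_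
  rw [norm_mul, Complex.norm_I, one_mul]
  refine WL_bound ?_ ξ k x
  have := abs_sub_abs_le_abs_sub t τ
  linarith

lemma WRel_smul {E : Type*} [NormedAddCommGroup E] [InnerProductSpace ℂ E] {U : ℝ → E →L[ℂ] E} {a b : E}
    (h : WRel U a b) (c : ℂ) : WRel U (c • a) (c • b) := by
  intro f s
  simp_rw [inner_smul_left]
  refine ((h f s).const_mul _).congr_deriv ?_
  ring

lemma Ten_psi_memLp (ξ : Fin N × Fin m → ℝ) (k : Fin N × Fin n → ℤ) (τ : ℝ) :
    MemLp (Ten (fun p => psi (ξ p) τ) k) 2 volume :=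
  memLp_dom ((Gs_memLp fun _ => rt_pos |τ|).const_mul _)
    (Ten_cont (fun q => (psi_smooth _ _).continuous) k).aestronglyMeasurable
    (Ten_bound (fun p y => (psi_bounds le_rfl (ξ p) y).1) k)

lemma LT_psi_memLp (ξ : Fin N × Fin m → ℝ) (k : Fin N × Fin n → ℤ) (τ : ℝ) :
    MemLp (LT (fun p => psi (ξ p) τ) k) 2 volume :=
  memLp_dom (((Gs_memLp fun _ => rt_pos |τ|).const_mul _).const_mul _)
    (LT_cont (fun q => (psi_smooth _ _)) k).aestronglyMeasurable
    (LT_bound (fun p y => (psi_bounds le_rfl (ξ p) y).1) (fun p y => (psi_bounds le_rfl (ξ p) y).2.2) k)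

theorem WP_prop {U : ℝ → L2 m n N →L[ℂ] L2 m n N} (hU : IsPropagator m n N 0 U)
    (ξ : Fin N × Fin m → ℝ) (k : Fin N × Fin n → ℤ) (s t : ℝ) :
    U s (toL volume (WP ξ k t)) = toL volume (WP ξ k (t + s)) := by
  refine prop_curve (Ψ := fun t => toL volume (WP ξ k t)) hU.unitary (fun f => by rw [hU.init]; rfl)
    (fun s t f => by rw [hU.group]; rfl) (WP_hasDeriv ξ k) (fun τ => ?_) s t
  have h := WRel_smul (weak_ext hU (v := fun p => psi (ξ p) τ) (c := fun _ => rt |τ|) (fun p => psi_smooth _ _) (fun _ => rt_pos |τ|)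
    (fun p y => (psi_bounds le_rfl (ξ p) y).1) (fun p y => (psi_bounds le_rfl (ξ p) y).2.1)
    (fun p y => (psi_bounds le_rfl (ξ p) y).2.2) k) (ph k τ)
  rw [← toL_smul (Ten_psi_memLp ξ k τ), ← toL_smul (LT_psi_memLp ξ k τ)] at h
  exact h

lemma WP_curve_cont (ξ : Fin N × Fin m → ℝ) (k : Fin N × Fin n → ℤ) :
    Continuous fun τ => toL volume (WP (m := m) ξ k τ) :=
  continuous_iff_continuousAt.2 fun τ => (WP_hasDeriv ξ k τ).continuousAt

end KT

namespace KT
open Set Filter Topology ManyBodyWaveguide BoundedContinuousFunction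

variable {m n N : ℕ}

lemma real_zero {E : Type*} [TopologicalSpace E] [PolishSpace E] [MeasurableSpace E] [BorelSpace E]
    {μ : Measure E} {A : StarSubalgebra ℂ (E →ᵇ ℂ)}
    (hA : (A.map (toContinuousMapStarₐ ℂ)).SeparatesPoints) {v : E → ℝ} (hv : Integrable v μ)
    (h : ∀ g ∈ A, ∫ x, g x * (v x : ℂ) ∂μ = 0) : v =ᵐ[μ] 0 := by
  have key : ∀ u : E → ℝ, Integrable u μ → (∀ x, 0 ≤ u x) → ∀ g : E →ᵇ ℂ,
      ∫ x, g x ∂(μ.withDensity fun x => ENNReal.ofReal (u x)) = ∫ x, g x * (u x : ℂ) ∂μ := by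
    intro u hu h0 g
    rw [integral_withDensity_eq_integral_toReal_smul₀ hu.aemeasurable.ennreal_ofReal (by simp)]
    refine integral_congr_ae (Eventually.of_forall fun x => ?_)
    simp [ENNReal.toReal_ofReal (h0 x), mul_comm]
  have hfin : ∀ u : E → ℝ, Integrable u μ → IsFiniteMeasure (μ.withDensity fun x => ENNReal.ofReal (u x)) :=
    fun u hu => isFiniteMeasure_withDensity_ofReal hu.2
  have hp : Integrable (fun x => max (v x) 0) μ := hv.pos_part
  have hn : Integrable (fun x => max (-v x) 0) μ := hv.neg_part
  have i1 := hfin _ hp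
  have i2 := hfin _ hn
  have heq : μ.withDensity (fun x => ENNReal.ofReal (max (v x) 0)) =
      μ.withDensity (fun x => ENNReal.ofReal (max (-v x) 0)) := by
    refine ext_of_forall_mem_subalgebra_integral_eq_of_polish (𝕜 := ℂ) hA fun g hg => ?_
    rw [key _ hp (fun _ => le_max_right _ _), key _ hn (fun _ => le_max_right _ _), ← sub_eq_zero,
      ← integral_sub]
    · rw [← h g hg]
      refine integral_congr_ae (Eventually.of_forall fun x => ?_)
      simp only
      rw [← mul_sub, ← Complex.ofReal_sub]
      congr 2
      rcases le_total 0 (v x) with h | h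
      · rw [max_eq_left h, max_eq_right (by linarith)]; simp
      · rw [max_eq_right h, max_eq_left (by linarith)]; simp
    · exact hp.ofReal.bdd_mul (c := ‖g‖) g.continuous.aestronglyMeasurable (Eventually.of_forall fun x => g.norm_coe_le_norm x)
    · exact hn.ofReal.bdd_mul (c := ‖g‖) g.continuous.aestronglyMeasurable (Eventually.of_forall fun x => g.norm_coe_le_norm x)
  have hne : ∫⁻ x, ENNReal.ofReal (max (v x) 0) ∂μ ≠ ∞ := by
    have := i1.measure_univ_lt_top
    rw [withDensity_apply _ MeasurableSet.univ, Measure.restrict_univ] at this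
    exact this.ne
  rw [withDensity_eq_iff hp.aemeasurable.ennreal_ofReal hn.aemeasurable.ennreal_ofReal hne] at heq
  filter_upwards [heq] with x hx
  rw [ENNReal.ofReal_eq_ofReal_iff (le_max_right _ _) (le_max_right _ _)] at hx
  rcases le_total 0 (v x) with h | h
  · rw [max_eq_left h, max_eq_right (by linarith)] at hx; exact hx
  · rw [max_eq_right h, max_eq_left (by linarith)] at hx; simp; linarith

lemma cplx_zero {E : Type*} [TopologicalSpace E] [PolishSpace E] [MeasurableSpace E] [BorelSpace E]
    {μ : Measure E} {A : StarSubalgebra ℂ (E →ᵇ ℂ)}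
    (hA : (A.map (toContinuousMapStarₐ ℂ)).SeparatesPoints) {v : E → ℂ} (hv : Integrable v μ)
    (h : ∀ g ∈ A, ∫ x, g x * v x ∂μ = 0) : v =ᵐ[μ] 0 := by
  have h' : ∀ g ∈ A, ∫ x, g x * (starRingEnd ℂ) (v x) ∂μ = 0 := by
    intro g hg
    have := congrArg (starRingEnd ℂ) (h (star g) (star_mem hg))
    rw [← integral_conj] at this
    simpa using this
  have hb : ∀ (g : E →ᵇ ℂ) {u : E → ℂ}, Integrable u μ → Integrable (fun x => g x * u x) μ := fun g u hu =>
    hu.bdd_mul (c := ‖g‖) g.continuous.aestronglyMeasurable (Eventually.of_forall fun x => g.norm_coe_le_norm x)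
  have hvc : Integrable (fun x => (starRingEnd ℂ) (v x)) μ := by
    refine hv.mono (Complex.continuous_conj.comp_aestronglyMeasurable hv.1) (Eventually.of_forall fun x => ?_)
    simp
  have hre := real_zero hA (v := fun x => (v x).re) hv.re fun g hg => by
    have e : ∀ x, g x * ((v x).re : ℂ) = (1/2 : ℂ) * (g x * v x + g x * (starRingEnd ℂ) (v x)) := by
      intro x; rw [← mul_add, Complex.add_conj]; push_cast; ring
    simp_rw [e]
    rw [integral_const_mul, integral_add (hb g hv) (hb g hvc), h g hg, h' g hg]; simp
  have him := real_zero hA (v := fun x => (v x).im) hv.im fun g hg => by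
    have e : ∀ x, g x * ((v x).im : ℂ) = (1/(2 * Complex.I) : ℂ) * (g x * v x - g x * (starRingEnd ℂ) (v x)) := by
      intro x; rw [← mul_sub, Complex.sub_conj]; push_cast; field_simp
    simp_rw [e]
    rw [integral_const_mul, integral_sub (hb g hv) (hb g hvc), h g hg, h' g hg]; simp
  filter_upwards [hre, him] with x h1 h2
  exact Complex.ext h1 h2

/-- plane waves -/
def pw (ξ : ℝ) (y : ℝ) : ℂ := Complex.exp (2 * Complex.I * ξ * y)

lemma pw_cont (ξ : ℝ) : Continuous (pw ξ) := by unfold pw; fun_prop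
lemma pw_norm (ξ y : ℝ) : ‖pw ξ y‖ = 1 := by
  unfold pw
  rw [show 2 * Complex.I * ξ * y = ((2 * ξ * y : ℝ) : ℂ) * Complex.I by push_cast; ring]
  exact Complex.norm_exp_ofReal_mul_I _
lemma pw_add (ξ ξ' y : ℝ) : pw (ξ + ξ') y = pw ξ y * pw ξ' y := by
  unfold pw; rw [← Complex.exp_add]; push_cast; ring_nf
lemma pw_neg (ξ y : ℝ) : pw (-ξ) y = (starRingEnd ℂ) (pw ξ y) := by
  unfold pw; rw [← Complex.exp_conj]; simp [Complex.conj_ofNat]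

/-- characters -/
def chi (ξ : Fin N × Fin m → ℝ) (k : Fin N × Fin n → ℤ) : Cfg m n N →ᵇ ℂ :=
  BoundedContinuousFunction.ofNormedAddCommGroup (Ten (fun p => pw (ξ p)) k)
    (Ten_cont (fun _ => pw_cont _) k) 1 fun x => by
      unfold Ten
      rw [norm_mul, norm_prod, norm_prod]
      simp_rw [fourier_norm, pw_norm]
      simp

lemma chi_apply (ξ : Fin N × Fin m → ℝ) (k : Fin N × Fin n → ℤ) (x : Cfg m n N) :
    chi ξ k x = Ten (fun p => pw (ξ p)) k x := rfl

lemma chi_mul (ξ ξ' : Fin N × Fin m → ℝ) (k k' : Fin N × Fin n → ℤ) :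
    chi ξ k * chi ξ' k' = chi (ξ + ξ') (k + k') := by
  ext x
  rw [BoundedContinuousFunction.mul_apply, chi_apply, chi_apply, chi_apply]
  unfold Ten
  simp_rw [Pi.add_apply, pw_add, fourier_add]
  rw [Finset.prod_mul_distrib, Finset.prod_mul_distrib]
  ring

lemma chi_star (ξ : Fin N × Fin m → ℝ) (k : Fin N × Fin n → ℤ) :
    star (chi ξ k) = chi (-ξ) (-k) := by
  ext x
  rw [BoundedContinuousFunction.star_apply, chi_apply, chi_apply]
  unfold Ten
  simp_rw [Pi.neg_apply, pw_neg, fourier_neg]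
  simp

/-- algebra spanned by characters -/
def chiAlg (m n N : ℕ) : StarSubalgebra ℂ (Cfg m n N →ᵇ ℂ) where
  carrier := Submodule.span ℂ (range fun p : (Fin N × Fin m → ℝ) × (Fin N × Fin n → ℤ) => chi p.1 p.2)
  mul_mem' := by
    intro a b ha hb
    have h := Submodule.mul_mem_mul ha hb
    rw [Submodule.span_mul_span] at h
    refine Submodule.span_mono ?_ h
    rintro _ ⟨_, ⟨p, rfl⟩, _, ⟨q, rfl⟩, rfl⟩
    exact ⟨(p.1 + q.1, p.2 + q.2), (chi_mul _ _ _ _).symm⟩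
  add_mem' := fun ha hb => Submodule.add_mem _ ha hb
  algebraMap_mem' := by
    intro r
    rw [Algebra.algebraMap_eq_smul_one]
    refine Submodule.smul_mem _ _ (Submodule.subset_span ⟨(0, 0), ?_⟩)
    ext x
    simp [chi_apply, Ten, pw]
  star_mem' := by
    intro a ha
    refine Submodule.span_induction (p := fun a _ => star a ∈ Submodule.span ℂ (range fun p : (Fin N × Fin m → ℝ) × (Fin N × Fin n → ℤ) => chi (m := m) p.1 p.2)) ?_ ?_ ?_ ?_ ha
    · rintro _ ⟨p, rfl⟩
      exact Submodule.subset_span ⟨(-p.1, -p.2), (chi_star _ _).symm⟩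
    · simp
    · intro x y _ _ hx hy
      rw [star_add]; exact Submodule.add_mem _ hx hy
    · intro c x _ hx
      rw [star_smul]; exact Submodule.smul_mem _ _ hx

lemma chi_mem (ξ : Fin N × Fin m → ℝ) (k : Fin N × Fin n → ℤ) : chi ξ k ∈ chiAlg m n N :=
  Submodule.subset_span ⟨(ξ, k), rfl⟩

lemma chi_sep : ((chiAlg m n N).map (toContinuousMapStarₐ ℂ)).SeparatesPoints := by
  classical
  intro x x' hne
  have : (∃ p : Fin N × Fin m, (x p.1).1 p.2 ≠ (x' p.1).1 p.2) ∨ ∃ p : Fin N × Fin n, (x p.1).2 p.2 ≠ (x' p.1).2 p.2 := by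
    by_contra hcon
    push Not at hcon
    refine hne (funext fun a => Prod.ext (funext fun i => hcon.1 (a, i)) (funext fun i => hcon.2 (a, i)))
  rcases this with ⟨p, hp⟩ | ⟨p, hp⟩
  · set d := (x p.1).1 p.2 - (x' p.1).1 p.2 with hd
    have hd0 : d ≠ 0 := sub_ne_zero.2 hp
    refine ⟨_, ⟨_, ⟨_, chi_mem (Pi.single p (Real.pi / (2 * d))) 0, rfl⟩, rfl⟩, ?_⟩
    have e : ∀ x : Cfg m n N, chi (Pi.single p (Real.pi / (2 * d))) 0 x = pw (Real.pi / (2 * d)) ((x p.1).1 p.2) := by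
      intro x
      rw [chi_apply]; unfold Ten
      rw [Finset.prod_eq_single p]
      · simp
      · intro q _ hq; simp [Pi.single_eq_of_ne hq, pw]
      · simp
    change chi _ 0 x ≠ chi _ 0 x'
    rw [e, e]
    have e1 : (x p.1).1 p.2 = (x' p.1).1 p.2 + d := by rw [hd]; ring
    have e2 : pw (Real.pi / (2 * d)) ((x p.1).1 p.2) = - pw (Real.pi / (2 * d)) ((x' p.1).1 p.2) := by
      unfold pw
      rw [e1]
      have hdc : (d:ℂ) ≠ 0 := by exact_mod_cast hd0
      rw [show 2 * Complex.I * ((Real.pi / (2 * d) : ℝ) : ℂ) * (((x' p.1).1 p.2 + d : ℝ) : ℂ) =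
        2 * Complex.I * ((Real.pi / (2 * d) : ℝ) : ℂ) * (((x' p.1).1 p.2 : ℝ) : ℂ) + Real.pi * Complex.I by
          push_cast; field_simp, Complex.exp_add, Complex.exp_pi_mul_I]
      ring
    rw [e2]
    intro h
    have h1 := pw_norm (Real.pi / (2 * d)) ((x' p.1).1 p.2)
    rw [neg_eq_iff_add_eq_zero, ← two_mul] at h
    rw [(mul_eq_zero.1 h).resolve_left two_ne_zero] at h1
    simp at h1
  · refine ⟨_, ⟨_, ⟨_, chi_mem 0 (Pi.single p 1), rfl⟩, rfl⟩, ?_⟩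
    have e : ∀ x : Cfg m n N, chi 0 (Pi.single p 1) x = fourier 1 ((x p.1).2 p.2) := by
      intro x
      rw [chi_apply]; unfold Ten
      rw [Finset.prod_eq_single (s := (Finset.univ : Finset (Fin N × Fin n))) p]
      · simp [pw]
      · intro q _ hq; rw [Pi.single_eq_of_ne hq]; simp
      · simp
    change chi 0 _ x ≠ chi 0 _ x'
    rw [e, e, fourier_one, fourier_one]
    intro h
    exact hp (AddCircle.injective_toCircle one_ne_zero (Circle.ext h))

/-- weighted characters -/
def gch (c : Fin N × Fin m → ℝ) (p : (Fin N × Fin m → ℝ) × (Fin N × Fin n → ℤ)) (x : Cfg m n N) : ℂ :=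
  (Gs c x : ℂ) * chi p.1 p.2 x

lemma gch_cont (c : Fin N × Fin m → ℝ) (p : (Fin N × Fin m → ℝ) × (Fin N × Fin n → ℤ)) : Continuous (gch c p) :=
  (Complex.continuous_ofReal.comp (Gs_cont c)).mul (chi p.1 p.2).continuous

lemma gch_memLp {c : Fin N × Fin m → ℝ} (hc : ∀ p, 0 < c p) (p : (Fin N × Fin m → ℝ) × (Fin N × Fin n → ℤ)) :
    MemLp (gch c p) 2 volume := by
  refine memLp_dom (Gs_memLp hc) (gch_cont c p).aestronglyMeasurable fun x => ?_
  unfold gch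
  rw [norm_mul, Complex.norm_real, Real.norm_of_nonneg (Gs_nonneg c x), chi_apply]
  unfold Ten
  rw [norm_mul, norm_prod, norm_prod]
  simp_rw [fourier_norm, pw_norm]
  simp

theorem gch_dense {c : Fin N × Fin m → ℝ} (hc : ∀ p, 0 < c p) :
    (Submodule.span ℂ (range fun p : (Fin N × Fin m → ℝ) × (Fin N × Fin n → ℤ) =>
      toL (volume : Measure (Cfg m n N)) (gch c p))).topologicalClosure = ⊤ := by
  have ip : PolishSpace (AddCircle (1:ℝ)) := by
    have : SecondCountableTopology (AddCircle (1:ℝ)) := inferInstance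
    have : CompleteSpace (AddCircle (1:ℝ)) := inferInstance
    infer_instance
  have ip2 : PolishSpace (Wg m n) := inferInstance
  have ip3 : PolishSpace (Cfg m n N) := inferInstance
  have b0 : BorelSpace (AddCircle (1:ℝ)) := inferInstance
  have b1 : BorelSpace (Wg m n) := inferInstance
  have b2 : BorelSpace (Cfg m n N) := inferInstance
  rw [Submodule.topologicalClosure_eq_top_iff, Submodule.eq_bot_iff]
  intro h hh
  rw [Submodule.mem_orthogonal] at hh
  have hInt : Integrable (fun x => (Gs c x : ℂ) * h x) (volume : Measure (Cfg m n N)) := by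
    have h1 : MemLp (fun x : Cfg m n N => (Gs c x : ℂ)) 2 volume := (Gs_memLp hc).ofReal
    exact h1.integrable_mul (Lp.memLp h)
  have hz := cplx_zero (chi_sep (m := m) (n := n) (N := N)) hInt fun g hg => by
    refine Submodule.span_induction (p := fun g _ => ∫ x, g x * ((Gs c x : ℂ) * h x) = 0) ?_ ?_ ?_ ?_ hg
    · rintro _ ⟨p, rfl⟩
      have h1 := hh _ (Submodule.subset_span ⟨(-p.1, -p.2), rfl⟩)
      simp only at h1
      rw [inner_toL (gch_memLp hc _)] at h1
      rw [← h1]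
      refine integral_congr_ae (Eventually.of_forall fun x => ?_)
      simp only [gch]
      rw [← chi_star, map_mul, Complex.conj_ofReal, BoundedContinuousFunction.star_apply]
      simp
      ring
    · simp
    · intro g g' _ _ hg hg'
      have hb : ∀ (g : Cfg m n N →ᵇ ℂ), Integrable (fun x => g x * ((Gs c x : ℂ) * h x)) volume := fun g =>
        hInt.bdd_mul (c := ‖g‖) g.continuous.aestronglyMeasurable (Eventually.of_forall fun x => g.norm_coe_le_norm x)
      simp only [BoundedContinuousFunction.add_apply, add_mul]
      rw [integral_add (hb g) (hb g'), hg, hg', add_zero]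
    · intro a g _ hg
      simp only [BoundedContinuousFunction.smul_apply, smul_eq_mul, mul_assoc]
      rw [integral_const_mul, hg, mul_zero]
  refine Lp.ext ?_
  filter_upwards [hz, Lp.coeFn_zero ℂ 2 (volume : Measure (Cfg m n N))] with x hx h0
  rw [h0]
  have : (Gs c x : ℂ) ≠ 0 := by exact_mod_cast (Gs_pos c x).ne'
  simpa [this] using hx

theorem gch_approx {c : Fin N × Fin m → ℝ} (hc : ∀ p, 0 < c p) (f : L2 m n N) {ε : ℝ} (hε : 0 < ε) :
    ∃ (s : Finset ((Fin N × Fin m → ℝ) × (Fin N × Fin n → ℤ))) (a : (Fin N × Fin m → ℝ) × (Fin N × Fin n → ℤ) → ℂ),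
      ‖f - toL volume (fun x => ∑ p ∈ s, a p * gch c p x)‖ < ε := by
  have hf : f ∈ (Submodule.span ℂ (range fun p : (Fin N × Fin m → ℝ) × (Fin N × Fin n → ℤ) =>
      toL (volume : Measure (Cfg m n N)) (gch c p))).topologicalClosure := by
    rw [gch_dense hc]; trivial
  obtain ⟨g, hg, hgd⟩ := Metric.mem_closure_iff.1 hf ε hε
  obtain ⟨a, rfl⟩ := (Finsupp.mem_span_range_iff_exists_finsupp).1 hg
  refine ⟨a.support, a, ?_⟩
  rw [dist_eq_norm] at hgd
  refine lt_of_eq_of_lt (congrArg (fun u => ‖f - u‖) ?_) hgd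
  rw [toL_sum a.support (f := fun p x => a p * gch c p x) fun p _ => (gch_memLp hc p).const_mul _]
  exact Finset.sum_congr rfl fun p _ => toL_smul (gch_memLp hc p) _

end KT

namespace KT
open Set Filter Topology ManyBodyWaveguide

variable {m n N : ℕ}

lemma psi0_sq (t y : ℝ) : ‖psi 0 t y‖ ^ 2 = (1 + 16 * t ^ 2) ^ (-(1/2) : ℝ) * Real.exp (-(2 / (1 + 16 * t ^ 2)) * y ^ 2) := by
  have hp : 0 < 1 + 16 * t ^ 2 := by positivity
  unfold psi
  rw [norm_mul, mul_pow]
  congr 1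
  · rw [← norm_pow, ← Complex.cpow_nat_mul]
    have : ((2:ℕ):ℂ) * (-(1/2)) = -1 := by norm_num
    rw [this, Complex.cpow_neg_one, norm_inv, Complex.norm_def, wd_normSq, Real.sqrt_eq_rpow, Real.rpow_neg hp.le]
  · rw [Complex.norm_exp, ← Real.exp_nat_mul]
    congr 1
    have e : (-(wd t)⁻¹ * ((y:ℂ) - Complex.I * ((0:ℝ):ℂ)) ^ 2).re = -((wd t)⁻¹).re * y ^ 2 := by
      have : (-(wd t)⁻¹ * ((y:ℂ) - Complex.I * ((0:ℝ):ℂ)) ^ 2) = (-(wd t)⁻¹) * ((y ^ 2 : ℝ) : ℂ) := by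
        push_cast; ring
      rw [this, Complex.re_mul_ofReal, Complex.neg_re]
    rw [e, Complex.inv_re, wd_re, wd_normSq]
    push_cast
    ring

lemma psi0_int (t : ℝ) : Integrable (fun y => ‖psi 0 t y‖ ^ 2) ∧ ∫ y, ‖psi 0 t y‖ ^ 2 = Real.sqrt (Real.pi / 2) := by
  have hp : 0 < 1 + 16 * t ^ 2 := by positivity
  simp_rw [psi0_sq]
  refine ⟨(integrable_exp_neg_mul_sq (by positivity)).const_mul _, ?_⟩
  rw [integral_const_mul, integral_gaussian, Real.rpow_neg hp.le, ← Real.sqrt_eq_rpow]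
  rw [show Real.pi / (2 / (1 + 16 * t ^ 2)) = (1 + 16 * t ^ 2) * (Real.pi / 2) by field_simp,
    Real.sqrt_mul hp.le, ← mul_assoc, inv_mul_cancel₀ (Real.sqrt_pos.2 hp).ne', one_mul]

/-- Euclidean factor of particle α -/
def Af (ζ : Fin m → ℝ) (t : ℝ) (y : Fin m → ℝ) : ℂ := ∏ i, psi (ζ i) t (y i)

lemma Af_cont (ζ : Fin m → ℝ) (t : ℝ) : Continuous (Af ζ t) :=
  continuous_finsetProd _ fun i _ => (psi_smooth _ _).continuous.comp (continuous_apply i)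

lemma Af0_int (t : ℝ) : ∫⁻ y : Fin m → ℝ, ‖Af 0 t y‖ₑ ^ 2 = ENNReal.ofReal (Real.sqrt (Real.pi / 2) ^ m) := by
  have e : ∀ y : Fin m → ℝ, ‖Af 0 t y‖ₑ ^ 2 = ENNReal.ofReal (∏ i, ‖psi 0 t (y i)‖ ^ 2) := by
    intro y
    rw [← ofReal_norm, ← ENNReal.ofReal_pow (norm_nonneg _), Finset.prod_pow, Af, norm_prod]
    rfl
  simp_rw [e]
  rw [← ofReal_integral_eq_lintegral_ofReal]
  · rw [integral_fintype_prod_volume_eq_prod (f := fun (_ : Fin m) (s : ℝ) => ‖psi 0 t s‖ ^ 2)]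
    simp_rw [(psi0_int t).2]
    rw [Finset.prod_const, Finset.card_univ, Fintype.card_fin]
  · rw [volume_pi]
    exact Integrable.fintype_prod (f := fun (_ : Fin m) (s : ℝ) => ‖psi 0 t s‖ ^ 2) fun _ => (psi0_int t).1
  · exact Eventually.of_forall fun y => Finset.prod_nonneg fun _ _ => by positivity

/-- Schroedinger kernel -/
def Kf (t : ℝ) (y y' : Fin m → ℝ) : ℂ := ∏ i, kap t (y i) (y' i)

lemma Kf_norm {t : ℝ} (ht : t ≠ 0) (y y' : Fin m → ℝ) :
    ‖Kf t y y'‖ = (4 * Real.pi * |t|) ^ (-((m:ℝ)/2)) := by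
  unfold Kf
  rw [norm_prod]
  simp_rw [kap_norm ht]
  rw [Finset.prod_const, Finset.card_univ, Fintype.card_fin, ← Real.rpow_natCast, ← Real.rpow_mul (by positivity)]
  congr 1; ring

lemma Kf_int {t : ℝ} (ht : t ≠ 0) (ζ : Fin m → ℝ) (y : Fin m → ℝ) :
    Integrable (fun y' => Kf t y y' * Af ζ 0 y') ∧ ∫ y', Kf t y y' * Af ζ 0 y' = Af ζ t y := by
  have e : (fun y' => Kf t y y' * Af ζ 0 y') = fun y' : Fin m → ℝ => ∏ i, kap t (y i) (y' i) * psi (ζ i) 0 (y' i) := by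
    funext y'
    rw [Kf, Af, ← Finset.prod_mul_distrib]
  rw [e]
  constructor
  · rw [volume_pi]
    exact Integrable.fintype_prod (f := fun (i : Fin m) (s : ℝ) => kap t (y i) s * psi (ζ i) 0 s)
      fun i => (kap_int ht (ζ i) (y i)).1
  · rw [integral_fintype_prod_volume_eq_prod (f := fun (i : Fin m) (s : ℝ) => kap t (y i) s * psi (ζ i) 0 s)]
    exact Finset.prod_congr rfl fun i _ => (kap_int ht (ζ i) (y i)).2

/-- index type of wave packets -/
abbrev Ix (m n N : ℕ) := (Fin N × Fin m → ℝ) × (Fin N × Fin n → ℤ)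

/-- remaining factor -/
def Bf (α : Fin N) (p : Ix m n N) (t : ℝ) (w : Torus n × Hat m n N α) : ℂ :=
  ph p.2 t * ((∏ q ∈ Finset.univ.filter (fun q : Fin N × Fin m => q.1 ≠ α), psi (p.1 q) t ((gl α (0, w) q.1).1 q.2)) *
    ∏ q : Fin N × Fin n, fourier (p.2 q) ((gl α (0, w) q.1).2 q.2))

lemma gl_slice_meas (α : Fin N) (y : Fin m → ℝ) : Measurable fun w : Torus n × Hat m n N α => gl α (y, w) :=
  (gl_meas α).comp (measurable_const.prodMk measurable_id)

lemma Bf_meas (α : Fin N) (p : Ix m n N) (t : ℝ) : Measurable (Bf α p t) := by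
  have h := gl_slice_meas (n := n) α (0 : Fin m → ℝ)
  have h1 : ∀ β, Measurable fun w : Torus n × Hat m n N α => gl α ((0 : Fin m → ℝ), w) β := fun β =>
    (measurable_pi_apply β).comp h
  unfold Bf
  refine Measurable.const_mul (Measurable.mul ?_ ?_) _
  · exact Finset.measurable_fun_prod _ fun q _ => (psi_smooth _ _).continuous.measurable.comp
      ((measurable_pi_apply q.2).comp (measurable_fst.comp (h1 q.1)))
  · exact Finset.measurable_fun_prod _ fun q _ => (fourier (p.2 q)).continuous.measurable.comp
      ((measurable_pi_apply q.2).comp (measurable_snd.comp (h1 q.1)))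

lemma WP_fac (α : Fin N) (p : Ix m n N) (t : ℝ) (y : Fin m → ℝ) (w : Torus n × Hat m n N α) :
    WP p.1 p.2 t (gl α (y, w)) = Af (fun i => p.1 (α, i)) t y * Bf α p t w := by
  unfold WP Ten Bf
  rw [← Finset.prod_filter_mul_prod_filter_not Finset.univ (fun q : Fin N × Fin m => q.1 ≠ α)]
  have e1 : ∏ q ∈ Finset.univ.filter (fun q : Fin N × Fin m => ¬ q.1 ≠ α), psi (p.1 q) t ((gl α (y, w) q.1).1 q.2)
      = Af (fun i => p.1 (α, i)) t y := by
    unfold Af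
    symm
    refine Finset.prod_bij (fun i _ => (α, i)) ?_ ?_ ?_ ?_
    · simp
    · intro a _ b _ h; simpa using h
    · rintro ⟨a, i⟩ h
      simp only [ne_eq, not_not, Finset.mem_filter_univ] at h
      exact ⟨i, Finset.mem_univ _, by rw [h]⟩
    · intro i _
      simp only
      rw [gl_alpha]
  have e2 : ∏ q ∈ Finset.univ.filter (fun q : Fin N × Fin m => q.1 ≠ α), psi (p.1 q) t ((gl α (y, w) q.1).1 q.2)
      = ∏ q ∈ Finset.univ.filter (fun q : Fin N × Fin m => q.1 ≠ α), psi (p.1 q) t ((gl α (0, w) q.1).1 q.2) := by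
    refine Finset.prod_congr rfl fun q hq => ?_
    rw [Finset.mem_filter_univ] at hq
    rw [gl_ne α _ _ hq, gl_ne α _ _ hq]
  have e3 : ∏ q : Fin N × Fin n, fourier (p.2 q) ((gl α (y, w) q.1).2 q.2) =
      ∏ q : Fin N × Fin n, fourier (p.2 q) ((gl α (0, w) q.1).2 q.2) := by
    refine Finset.prod_congr rfl fun q _ => ?_
    by_cases hq : q.1 = α
    · rw [hq, gl_alpha, gl_alpha]
    · rw [gl_ne α _ _ hq, gl_ne α _ _ hq]
  rw [e1, e2, e3]
  ring

/-- freeze the frequency of particle α -/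
def fz (α : Fin N) (p : Ix m n N) : Ix m n N := (fun q => if q.1 = α then 0 else p.1 q, p.2)

lemma Bf_fz (α : Fin N) (p : Ix m n N) (t : ℝ) (w : Torus n × Hat m n N α) : Bf α (fz α p) t w = Bf α p t w := by
  unfold Bf fz
  congr 2
  refine Finset.prod_congr rfl fun q hq => ?_
  rw [Finset.mem_filter_univ] at hq
  simp [hq]

lemma WP_fz (α : Fin N) (p : Ix m n N) (t : ℝ) (y : Fin m → ℝ) (w : Torus n × Hat m n N α) :
    WP (fz α p).1 (fz α p).2 t (gl α (y, w)) = Af 0 t y * Bf α p t w := by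
  rw [WP_fac, Bf_fz]
  congr 2
  funext i
  simp [fz]

lemma fz_norm (α : Fin N) (s : Finset (Ix m n N)) (c : Ix m n N → ℂ) (t : ℝ) :
    ‖toL volume (fun x : Cfg m n N => ∑ p ∈ s, c p * WP (fz α p).1 (fz α p).2 t x)‖ₑ ^ 2 =
      ENNReal.ofReal (Real.sqrt (Real.pi / 2) ^ m) * ∫⁻ w, ‖∑ p ∈ s, c p * Bf α p t w‖ₑ ^ 2 := by
  have hm : MemLp (fun x : Cfg m n N => ∑ p ∈ s, c p * WP (fz α p).1 (fz α p).2 t x) 2 volume :=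
    memLp_finsetSum s fun p _ => (WP_memLp _ _ t).const_mul _
  rw [toL_enorm hm, lint_gl α]
  · have e : ∀ (y : Fin m → ℝ) (w : Torus n × Hat m n N α), ‖∑ p ∈ s, c p * WP (fz α p).1 (fz α p).2 t (gl α (y, w))‖ₑ ^ 2
        = ‖Af 0 t y‖ₑ ^ 2 * ‖∑ p ∈ s, c p * Bf α p t w‖ₑ ^ 2 := by
      intro y w
      rw [← mul_pow, ← enorm_mul, Finset.mul_sum]
      congr 2
      refine Finset.sum_congr rfl fun p _ => ?_
      rw [WP_fz]; ring
    simp_rw [e]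
    have hB : Measurable fun w : Torus n × Hat m n N α => ‖∑ p ∈ s, c p * Bf α p t w‖ₑ ^ 2 :=
      (Finset.measurable_fun_sum s fun p _ => (Bf_meas α p t).const_mul _).enorm.pow_const 2
    simp_rw [lintegral_const_mul _ hB]
    rw [lintegral_mul_const _ ((Af_cont 0 t).measurable.enorm.pow_const 2), Af0_int]
  · exact (Finset.measurable_fun_sum s fun p _ => ((WP_cont _ _ t).measurable).const_mul _).enorm.pow_const 2

lemma gi_pos : ENNReal.ofReal (Real.sqrt (Real.pi / 2) ^ m) ≠ 0 := by
  have : 0 < Real.sqrt (Real.pi / 2) ^ m := pow_pos (Real.sqrt_pos.2 (by positivity)) m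
  simpa using this

lemma Bf_memLp (α : Fin N) (p : Ix m n N) (t : ℝ) : MemLp (Bf α p t) 2 volume := by
  refine ⟨(Bf_meas α p t).aestronglyMeasurable, ?_⟩
  have h := fz_norm α {p} (fun _ => 1) t
  simp only [Finset.sum_singleton, one_mul] at h
  rw [eLpNorm_lt_top_iff_lintegral_rpow_enorm_lt_top two_ne_zero ENNReal.ofNat_ne_top]
  have h2 : ∫⁻ w, ‖Bf α p t w‖ₑ ^ 2 ≠ ∞ := by
    intro hcon
    rw [hcon, ENNReal.mul_top gi_pos] at h
    simp at h
  rw [lt_top_iff_ne_top]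
  simpa using h2

lemma U_comb {U : ℝ → L2 m n N →L[ℂ] L2 m n N} (hU : IsPropagator m n N 0 U)
    (s : Finset (Ix m n N)) (c : Ix m n N → ℂ) (φ : Ix m n N → Ix m n N) (t : ℝ) :
    U t (toL volume fun x => ∑ p ∈ s, c p * WP (φ p).1 (φ p).2 0 x) =
      toL volume fun x => ∑ p ∈ s, c p * WP (φ p).1 (φ p).2 t x := by
  have h : ∀ t, toL volume (fun x => ∑ p ∈ s, c p * WP (φ p).1 (φ p).2 t x) = ∑ p ∈ s, c p • toL volume (WP (φ p).1 (φ p).2 t) := by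
    intro t
    rw [toL_sum s (f := fun p x => c p * WP (φ p).1 (φ p).2 t x) fun p _ => (WP_memLp _ _ t).const_mul _]
    exact Finset.sum_congr rfl fun p _ => toL_smul (WP_memLp _ _ t) _
  rw [h, h, map_sum]
  refine Finset.sum_congr rfl fun p _ => ?_
  rw [map_smul, WP_prop hU, zero_add]

lemma comb_iso {U : ℝ → L2 m n N →L[ℂ] L2 m n N} (hU : IsPropagator m n N 0 U) (α : Fin N)
    (s : Finset (Ix m n N)) (c : Ix m n N → ℂ) (t : ℝ) :
    ∫⁻ w, ‖∑ p ∈ s, c p * Bf α p t w‖ₑ ^ 2 = ∫⁻ w, ‖∑ p ∈ s, c p * Bf α p 0 w‖ₑ ^ 2 := by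
  have h : ‖toL volume (fun x : Cfg m n N => ∑ p ∈ s, c p * WP (fz α p).1 (fz α p).2 t x)‖ₑ =
      ‖toL volume (fun x : Cfg m n N => ∑ p ∈ s, c p * WP (fz α p).1 (fz α p).2 0 x)‖ₑ := by
    rw [← U_comb hU s c (fz α) t, ← ofReal_norm, hU.unitary, ofReal_norm]
  have h2 := congrArg (· ^ 2) h
  rw [fz_norm, fz_norm] at h2
  exact (ENNReal.mul_right_inj gi_pos ENNReal.ofReal_ne_top).1 h2

lemma comb_norm (α : Fin N) (s : Finset (Ix m n N)) (c : Ix m n N → ℂ) (t : ℝ) :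
    ‖∑ p ∈ s, c p • toL volume (Bf α p t)‖ₑ ^ 2 = ∫⁻ w, ‖∑ p ∈ s, c p * Bf α p t w‖ₑ ^ 2 := by
  rw [← toL_enorm (f := fun w => ∑ p ∈ s, c p * Bf α p t w) (memLp_finsetSum s fun p _ => (Bf_memLp α p t).const_mul _),
    toL_sum s (f := fun p w => c p * Bf α p t w) fun p _ => (Bf_memLp α p t).const_mul _]
  congr 2
  exact Finset.sum_congr rfl fun p _ => (toL_smul (Bf_memLp α p t) _).symm

lemma amp_comb (α : Fin N) (s : Finset (Ix m n N)) (c : Ix m n N → ℂ) (t : ℝ) (y : Fin m → ℝ) :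
    amp α (fun x => ∑ p ∈ s, c p * WP p.1 p.2 t x) y =
      ‖∑ p ∈ s, (c p * Af (fun i => p.1 (α, i)) t y) • toL volume (Bf α p t)‖ₑ := by
  have : amp α (fun x => ∑ p ∈ s, c p * WP p.1 p.2 t x) y ^ 2 =
      ‖∑ p ∈ s, (c p * Af (fun i => p.1 (α, i)) t y) • toL volume (Bf α p t)‖ₑ ^ 2 := by
    rw [amp_sq, comb_norm]
    simp_rw [WP_fac, mul_assoc]
  exact (ENNReal.pow_right_strictMono two_ne_zero).injective this

theorem amp_disp {U : ℝ → L2 m n N →L[ℂ] L2 m n N} (hU : IsPropagator m n N 0 U) (α : Fin N)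
    (s : Finset (Ix m n N)) (c : Ix m n N → ℂ) {t : ℝ} (ht : t ≠ 0) (y : Fin m → ℝ) :
    amp α (fun x => ∑ p ∈ s, c p * WP p.1 p.2 t x) y ≤ ENNReal.ofReal ((4 * Real.pi * |t|) ^ (-((m:ℝ)/2))) *
      ∫⁻ y', amp α (fun x => ∑ p ∈ s, c p * WP p.1 p.2 0 x) y' := by
  rw [amp_comb]
  have e : ∑ p ∈ s, (c p * Af (fun i => p.1 (α, i)) t y) • toL volume (Bf α p t) =
      ∫ y', ∑ p ∈ s, (c p * (Kf t y y' * Af (fun i => p.1 (α, i)) 0 y')) • toL volume (Bf α p t) := by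
    rw [integral_finsetSum]
    · refine Finset.sum_congr rfl fun p _ => ?_
      rw [integral_smul_const, integral_const_mul, (Kf_int ht _ y).2]
    · intro p _
      exact ((Kf_int ht _ y).1.const_mul _).smul_const _
  rw [e]
  refine (enorm_integral_le_lintegral_enorm _).trans ?_
  rw [← lintegral_const_mul']
  · refine le_of_eq (lintegral_congr fun y' => ?_)
    rw [amp_comb]
    have e2 : ∑ p ∈ s, (c p * (Kf t y y' * Af (fun i => p.1 (α, i)) 0 y')) • toL volume (Bf α p t) =
        Kf t y y' • ∑ p ∈ s, (c p * Af (fun i => p.1 (α, i)) 0 y') • toL volume (Bf α p t) := by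
      rw [Finset.smul_sum]
      refine Finset.sum_congr rfl fun p _ => ?_
      rw [smul_smul]; congr 1; ring
    rw [e2, enorm_smul, ← ofReal_norm (Kf t y y'), Kf_norm ht]
    congr 1
    have : ‖∑ p ∈ s, (c p * Af (fun i => p.1 (α, i)) 0 y') • toL volume (Bf α p t)‖ₑ ^ 2 =
        ‖∑ p ∈ s, (c p * Af (fun i => p.1 (α, i)) 0 y') • toL volume (Bf α p 0)‖ₑ ^ 2 := by
      rw [comb_norm, comb_norm, comb_iso hU]
    exact (ENNReal.pow_right_strictMono two_ne_zero).injective this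
  · exact ENNReal.ofReal_ne_top

theorem span_disp {U : ℝ → L2 m n N →L[ℂ] L2 m n N} (hU : IsPropagator m n N 0 U) (α : Fin N)
    (s : Finset (Ix m n N)) (c : Ix m n N → ℂ) {t : ℝ} (ht : t ≠ 0) (g : L2 m n N) {f : L2 m n N}
    (hf : f = toL volume fun x => ∑ p ∈ s, c p * WP p.1 p.2 0 x) :
    ‖inner ℂ (U t f) g‖ₑ ≤ ENNReal.ofReal ((4 * Real.pi * |t|) ^ (-((m:ℝ)/2))) * (N1 α f * N1 α g) := by
  have hml : ∀ t, MemLp (fun x : Cfg m n N => ∑ p ∈ s, c p * WP p.1 p.2 t x) 2 volume := fun t =>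
    memLp_finsetSum s fun p _ => (WP_memLp _ _ t).const_mul _
  have hN : N1 α f = ∫⁻ y', amp α (fun x => ∑ p ∈ s, c p * WP p.1 p.2 0 x) y' := by
    rw [hf]; exact N1_congr α (toL_coe (hml 0))
  have hUf : U t f = toL volume fun x => ∑ p ∈ s, c p * WP p.1 p.2 t x := by
    rw [hf]; exact U_comb hU s c id t
  refine (inner_amp α _ _).trans ?_
  rw [← mul_assoc, hN, N1, ← lintegral_const_mul _ (amp_meas α (l2_meas g))]
  refine lintegral_mono_ae ?_
  rw [hUf]
  filter_upwards [amp_congr α (toL_coe (hml t))] with y hy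
  rw [hy]
  gcongr
  exact amp_disp hU α s c ht y

end KT

namespace KT
open Set Filter Topology ManyBodyWaveguide

variable {m n N : ℕ}

lemma psi_zero (ξ y : ℝ) : psi ξ 0 y = Complex.exp (ξ ^ 2) * ((Real.exp (-1 * y ^ 2) : ℝ) : ℂ) * pw ξ y := by
  unfold psi pw wd
  rw [Complex.ofReal_exp, ← Complex.exp_add, ← Complex.exp_add]
  have : (1 + 4 * Complex.I * ((0:ℝ):ℂ)) = 1 := by simp
  rw [this, Complex.one_cpow, one_mul]
  congr 1
  push_cast
  ring_nf
  rw [Complex.I_sq]; ring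

lemma WP_zero (p : Ix m n N) (x : Cfg m n N) :
    WP p.1 p.2 0 x = (∏ q, Complex.exp ((p.1 q : ℂ) ^ 2)) * gch (fun _ => 1) p x := by
  unfold WP gch Gs
  rw [ph_zero, one_mul, chi_apply]
  unfold Ten
  simp_rw [psi_zero]
  rw [Finset.prod_mul_distrib, Finset.prod_mul_distrib]
  push_cast
  ring

lemma amp_add_le (α : Fin N) {f g : Cfg m n N → ℂ} (hf : Measurable f) (hg : Measurable g) (y : Fin m → ℝ) :
    amp α (fun x => f x + g x) y ≤ amp α f y + amp α g y := by
  have hf' : Measurable fun w => ‖f (gl α (y, w))‖ₑ := (hf.comp (gl_slice_meas α y)).enorm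
  have hg' : Measurable fun w => ‖g (gl α (y, w))‖ₑ := (hg.comp (gl_slice_meas α y)).enorm
  have h := ENNReal.lintegral_Lp_add_le (μ := volume) (p := 2) hf'.aemeasurable hg'.aemeasurable (by norm_num)
  simp only [ENNReal.rpow_two] at h
  refine le_trans ?_ h
  unfold amp
  gcongr
  exact enorm_add_le _ _

lemma N1_add_le (α : Fin N) (f g : L2 m n N) : N1 α (f + g) ≤ N1 α f + N1 α g := by
  rw [N1_congr α (Lp.coeFn_add f g)]
  unfold N1
  rw [← lintegral_add_left (amp_meas α (l2_meas f))]
  exact lintegral_mono fun y => amp_add_le α (l2_meas f) (l2_meas g) y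

lemma N1_neg (α : Fin N) (f : L2 m n N) : N1 α (-f) = N1 α f := by
  have := N1_smul α (-1) f
  simpa using this

/-- Gaussian in one particle -/
def gd (y : Fin m → ℝ) : ℝ := ∏ i, Real.exp (-(1/2) * (y i) ^ 2)

lemma gd_pos (y : Fin m → ℝ) : 0 < gd y := Finset.prod_pos fun _ _ => Real.exp_pos _
lemma gd_le (y : Fin m → ℝ) : gd y ≤ 1 := by
  refine Finset.prod_le_one (fun _ _ => (Real.exp_pos _).le) fun i _ => ?_
  rw [Real.exp_le_one_iff]
  nlinarith [sq_nonneg (y i)]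
lemma gd_meas : Measurable (gd (m := m)) := by
  unfold gd
  exact Finset.measurable_fun_prod _ fun i _ => ((((measurable_pi_apply i).pow_const 2).const_mul _).exp)

lemma gd_int : ∫⁻ y : Fin m → ℝ, ‖(gd y : ℂ)‖ₑ ^ (2:ℝ) ≠ ∞ := by
  have hi : Integrable (fun y : Fin m → ℝ => ∏ i, Real.exp (-1 * (y i) ^ 2)) := by
    rw [volume_pi]
    exact Integrable.fintype_prod (f := fun (_ : Fin m) (s : ℝ) => Real.exp (-1 * s ^ 2))
      fun i => integrable_exp_neg_mul_sq one_pos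
  have e : ∀ y : Fin m → ℝ, ‖(gd y : ℂ)‖ₑ ^ (2:ℝ) = ‖∏ i, Real.exp (-1 * (y i) ^ 2)‖ₑ := by
    intro y
    rw [ENNReal.rpow_two, ← enorm_pow, ← ofReal_norm, ← ofReal_norm, ← Complex.ofReal_pow, Complex.norm_real]
    congr 2
    unfold gd
    rw [← Finset.prod_pow]
    refine Finset.prod_congr rfl fun i _ => ?_
    rw [← Real.exp_nat_mul]; congr 1; push_cast; ring
  simp_rw [e]
  exact hi.2.ne

/-- exponent supported on particle α -/
def dal (α : Fin N) : Fin N × Fin m → ℝ := fun p => if p.1 = α then 1/2 else 0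

lemma Gs_dal (α : Fin N) (x : Cfg m n N) : Gs (dal α) x = gd (x α).1 := by
  unfold Gs gd
  rw [Fintype.prod_prod_type, Finset.prod_eq_single α]
  · simp [dal]
  · intro b _ hb
    simp [dal, hb]
  · simp

lemma gch_split (α : Fin N) (p : Ix m n N) (x : Cfg m n N) :
    gch (fun _ => 1) p x = (gd (x α).1 : ℂ) * gch (fun q => 1 - dal α q) p x := by
  unfold gch
  rw [← mul_assoc, ← Gs_dal, ← Complex.ofReal_mul, Gs_mul]
  congr 3
  funext q
  simp

/-- multiplication by gd -/
lemma D_bounds (α : Fin N) (v : L2 m n N) :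
    MemLp (fun x : Cfg m n N => (gd (x α).1 : ℂ) * v x) 2 volume ∧
    ‖toL volume (fun x : Cfg m n N => (gd (x α).1 : ℂ) * v x)‖ ≤ ‖v‖ ∧
    N1 α (toL volume (fun x : Cfg m n N => (gd (x α).1 : ℂ) * v x)) ≤
      (∫⁻ y : Fin m → ℝ, ‖(gd y : ℂ)‖ₑ ^ (2:ℝ)) ^ (1/(2:ℝ)) * ‖v‖ₑ := by
  have hm : Measurable fun x : Cfg m n N => (gd (x α).1 : ℂ) * v x :=
    (Complex.measurable_ofReal.comp (gd_meas.comp (measurable_fst.comp (measurable_pi_apply α)))).mul (l2_meas v)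
  have hb : ∀ x : Cfg m n N, ‖(gd (x α).1 : ℂ) * v x‖ ≤ ‖v x‖ := by
    intro x
    rw [norm_mul, Complex.norm_real, Real.norm_of_nonneg (gd_pos _).le]
    exact mul_le_of_le_one_left (norm_nonneg _) (gd_le _)
  have hml : MemLp (fun x : Cfg m n N => (gd (x α).1 : ℂ) * v x) 2 volume :=
    memLp_dom (Lp.memLp v).norm hm.aestronglyMeasurable hb
  refine ⟨hml, ?_, ?_⟩
  · refine Lp.norm_le_norm_of_ae_le ?_
    filter_upwards [toL_coe hml] with x hx
    rw [hx]; exact hb x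
  · rw [N1_congr α (toL_coe hml)]
    have e : ∀ y, amp α (fun x : Cfg m n N => (gd (x α).1 : ℂ) * v x) y = ‖(gd y : ℂ)‖ₑ * amp α v y :=
      amp_mul α (fun y => (gd y : ℂ)) v (l2_meas v)
    simp_rw [e]
    have hh := ENNReal.lintegral_mul_le_Lp_mul_Lq (volume : Measure (Fin m → ℝ)) (p := 2) (q := 2)
      (Real.HolderConjugate.two_two) (f := fun y => ‖(gd y : ℂ)‖ₑ) (g := amp α v)
      (Complex.measurable_ofReal.comp gd_meas).enorm.aemeasurable (amp_meas α (l2_meas v)).aemeasurable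
    refine hh.trans (le_of_eq ?_)
    congr 1
    simp only [ENNReal.rpow_two]
    rw [amp_norm, ← ENNReal.rpow_two, ← ENNReal.rpow_mul]
    norm_num

theorem approx (α : Fin N) (f : L2 m n N) {ε : ℝ} (hε : 0 < ε) :
    ∃ (s : Finset (Ix m n N)) (c : Ix m n N → ℂ) (g : L2 m n N),
      g = toL volume (fun x => ∑ p ∈ s, c p * WP p.1 p.2 0 x) ∧ ‖f - g‖ ≤ ε ∧ N1 α g ≤ N1 α f + ENNReal.ofReal ε := by
  set S : ℕ → Set (Cfg m n N) := fun k => {x | ((k:ℝ) + 1)⁻¹ ≤ gd (x α).1} with hS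
  have hgm : Measurable fun x : Cfg m n N => gd (x α).1 :=
    gd_meas.comp (measurable_fst.comp (measurable_pi_apply α))
  have hSm : ∀ k, MeasurableSet (S k) := fun k => measurableSet_le measurable_const hgm
  have hfm := l2_meas f
  have hbk : ∀ k x, ‖(S k).indicator f x‖ ≤ ‖f x‖ := fun k x => norm_indicator_le_norm_self _ _
  have hlim : Tendsto (fun k => toL volume ((S k).indicator f)) atTop (𝓝 (toL volume f)) := by
    refine dct (Lp.memLp f).norm (fun k => hfm.indicator (hSm k)) hfm (Eventually.of_forall hbk)
      (fun x => le_rfl) fun x => ?_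
    refine tendsto_const_nhds.congr' ?_
    have h1 : Tendsto (fun k : ℕ => ((k:ℝ) + 1)⁻¹) atTop (𝓝 0) := by
      simpa using tendsto_one_div_add_atTop_nhds_zero_nat (𝕜 := ℝ)
    filter_upwards [h1.eventually_le_const (gd_pos (x α).1)] with k hk
    rw [indicator_of_mem]
    exact hk
  rw [toL_self] at hlim
  obtain ⟨k, hk⟩ := ((tendsto_iff_norm_sub_tendsto_zero.1 hlim).eventually_lt_const (half_pos hε)).exists
  have hfk : MemLp ((S k).indicator f) 2 volume :=
    memLp_dom (Lp.memLp f).norm (hfm.indicator (hSm k)).aestronglyMeasurable (hbk k)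
  have hNk : N1 α (toL volume ((S k).indicator f)) ≤ N1 α f := by
    rw [N1_congr α (toL_coe hfk)]
    unfold N1 amp
    gcongr
    exact enorm_indicator_le_enorm_self _ _
  -- divide by the Gaussian
  set u : Cfg m n N → ℂ := fun x => ((gd (x α).1)⁻¹ : ℝ) * (S k).indicator f x with hu
  have hum : MemLp u 2 volume := by
    refine memLp_dom ((Lp.memLp f).norm.const_mul ((k:ℝ) + 1))
      ((Complex.measurable_ofReal.comp hgm.inv).mul (hfm.indicator (hSm k))).aestronglyMeasurable fun x => ?_
    rw [hu]
    simp only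
    by_cases hx : x ∈ S k
    · rw [norm_mul, Complex.norm_real, Real.norm_of_nonneg (inv_nonneg.2 (gd_pos _).le), indicator_of_mem hx]
      gcongr
      have : ((k:ℝ) + 1)⁻¹ ≤ gd (x α).1 := hx
      exact inv_le_of_inv_le₀ (by positivity) this
    · rw [indicator_of_notMem hx]; simp; positivity
  set G := (∫⁻ y : Fin m → ℝ, ‖(gd y : ℂ)‖ₑ ^ (2:ℝ)) ^ (1/(2:ℝ)) with hG
  have hGt : G ≠ ∞ := ENNReal.rpow_ne_top_of_nonneg (by norm_num) gd_int
  set δ := min (ε / 2) (ε / (G.toReal + 1)) with hδ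
  have hδ0 : 0 < δ := lt_min (half_pos hε) (div_pos hε (by positivity))
  obtain ⟨s, a, hsa⟩ := gch_approx (c := fun q => 1 - dal α q) (fun q => by
    unfold dal; split_ifs <;> norm_num) (toL volume u) hδ0
  have hc1 : ∀ q, 0 < (fun q : Fin N × Fin m => 1 - dal α q) q := fun q => by
    unfold dal; simp only; split_ifs <;> norm_num
  have hg1 : MemLp (fun x : Cfg m n N => ∑ p ∈ s, a p * gch (fun q => 1 - dal α q) p x) 2 volume :=
    memLp_finsetSum s fun p _ => (gch_memLp hc1 p).const_mul _
  set v : L2 m n N := toL volume u - toL volume (fun x => ∑ p ∈ s, a p * gch (fun q => 1 - dal α q) p x) with hv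
  obtain ⟨hD1, hD2, hD3⟩ := D_bounds α v
  set c : Ix m n N → ℂ := fun p => a p * (∏ q, Complex.exp ((p.1 q : ℂ) ^ 2))⁻¹ with hc
  have hsum : ∀ x : Cfg m n N, ∑ p ∈ s, c p * WP p.1 p.2 0 x =
      (gd (x α).1 : ℂ) * ∑ p ∈ s, a p * gch (fun q => 1 - dal α q) p x := by
    intro x
    rw [Finset.mul_sum]
    refine Finset.sum_congr rfl fun p _ => ?_
    have hne : (∏ q, Complex.exp ((p.1 q : ℂ) ^ 2)) ≠ 0 := Finset.prod_ne_zero_iff.2 fun q _ => Complex.exp_ne_zero _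
    rw [WP_zero, gch_split α, hc]
    field_simp
  have hgm2 : MemLp (fun x : Cfg m n N => ∑ p ∈ s, c p * WP p.1 p.2 0 x) 2 volume :=
    memLp_finsetSum s fun p _ => (WP_memLp _ _ 0).const_mul _
  have hid : toL volume (fun x : Cfg m n N => ∑ p ∈ s, c p * WP p.1 p.2 0 x) =
      toL volume ((S k).indicator f) + -toL volume (fun x : Cfg m n N => (gd (x α).1 : ℂ) * v x) := by
    rw [← sub_eq_add_neg, ← toL_sub hfk hD1]
    refine toL_congr hgm2 ?_
    filter_upwards [Lp.coeFn_sub (toL volume u) (toL volume (fun x => ∑ p ∈ s, a p * gch (fun q => 1 - dal α q) p x)),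
      toL_coe hum, toL_coe hg1] with x h1 h2 h3
    rw [hsum, hv, h1, Pi.sub_apply, h2, h3, hu]
    have : (gd (x α).1 : ℂ) ≠ 0 := by exact_mod_cast (gd_pos _).ne'
    push_cast
    field_simp
    ring
  refine ⟨s, c, _, rfl, ?_, ?_⟩
  · rw [hid]
    calc ‖f - (toL volume ((S k).indicator f) + -toL volume (fun x : Cfg m n N => (gd (x α).1 : ℂ) * v x))‖
        = ‖-(toL volume ((S k).indicator f) - f) + toL volume (fun x : Cfg m n N => (gd (x α).1 : ℂ) * v x)‖ := by
          congr 1; abel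
      _ ≤ ‖toL volume ((S k).indicator f) - f‖ + ‖toL volume (fun x : Cfg m n N => (gd (x α).1 : ℂ) * v x)‖ := by
          refine (norm_add_le _ _).trans ?_
          rw [norm_neg]
      _ ≤ ε / 2 + ε / 2 := by
          refine add_le_add hk.le (hD2.trans (hsa.le.trans (min_le_left _ _)))
      _ = ε := by ring
  · rw [hid]
    refine (N1_add_le α _ _).trans (add_le_add hNk ?_)
    rw [N1_neg]
    refine hD3.trans ?_
    have hGv : G * ‖v‖ₑ = ENNReal.ofReal (G.toReal * ‖v‖) := by
      rw [ENNReal.ofReal_mul ENNReal.toReal_nonneg, ENNReal.ofReal_toReal hGt, ofReal_norm]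
    refine hGv.le.trans ?_
    refine ENNReal.ofReal_le_ofReal ?_
    have h1 : ‖v‖ ≤ ε / (G.toReal + 1) := hsa.le.trans (min_le_right _ _)
    have h0 : 0 ≤ G.toReal := ENNReal.toReal_nonneg
    calc G.toReal * ‖v‖ ≤ (G.toReal + 1) * (ε / (G.toReal + 1)) := by gcongr; linarith
      _ = ε := by field_simp

theorem disp_of_propagator (hm : 3 ≤ m) {U : ℝ → L2 m n N →L[ℂ] L2 m n N} (hU : IsPropagator m n N 0 U) (α : Fin N) :
    Disp U (N1 α) ((4 * Real.pi) ^ (-((m:ℝ)/2))) ((m:ℝ)/2) where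
  norm := hU.unitary
  zero := fun f => by rw [hU.init]; rfl
  add := fun s t f => by rw [hU.group]; rfl
  cont := by
    intro f
    refine continuous_of_uniform_approx_of_continuous fun u hu => ?_
    obtain ⟨ε, hε, hεu⟩ := Metric.mem_uniformity_dist.1 hu
    obtain ⟨s, c, g, hg, hfg, -⟩ := approx α f (half_pos hε)
    refine ⟨fun t => U t g, ?_, fun t => hεu ?_⟩
    · have : (fun t => U t g) = fun t => ∑ p ∈ s, c p • toL volume (WP p.1 p.2 t) := by
        funext t
        rw [hg]
        refine (U_comb hU s c id t).trans ?_
        change toL volume (fun x => ∑ p ∈ s, c p * WP p.1 p.2 t x) = _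
        rw [toL_sum s (f := fun p x => c p * WP p.1 p.2 t x) fun p _ => (WP_memLp _ _ t).const_mul _]
        exact Finset.sum_congr rfl fun p _ => toL_smul (WP_memLp _ _ t) _
      rw [this]
      exact continuous_finsetSum _ fun p _ => (continuous_const_smul (c p)).comp (WP_curve_cont p.1 p.2)
    · rw [dist_eq_norm, ← map_sub, hU.unitary]
      linarith
  smul := fun z f hz => by
    rw [N1_smul]
    refine mul_le_of_le_one_left zero_le ?_
    rw [← ofReal_norm, ← ENNReal.ofReal_one]
    exact ENNReal.ofReal_le_ofReal hz
  zeroN := N1_zero α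
  K0 := by positivity
  mu := by
    have : (3:ℝ) ≤ m := by exact_mod_cast hm
    linarith
  disp := by
    intro t f g ht hf hg
    set C := ENNReal.ofReal ((4 * Real.pi * |t|) ^ (-((m:ℝ)/2))) with hC
    have hCe : ENNReal.ofReal ((4 * Real.pi) ^ (-((m:ℝ)/2)) * |t| ^ (-((m:ℝ)/2))) = C := by
      rw [hC, Real.mul_rpow (by positivity) (abs_nonneg _)]
    rw [hCe]
    have key : ∀ ε : ℝ, 0 < ε → ‖inner ℂ (U t f) g‖ₑ ≤ C * ((N1 α f + ENNReal.ofReal ε) * N1 α g) + ENNReal.ofReal ε * ‖g‖ₑ := by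
      intro ε hε
      obtain ⟨s, c, h, hh, hfh, hN⟩ := approx α f hε
      have e : inner ℂ (U t f) g = inner ℂ (U t h) g + inner ℂ (U t (f - h)) g := by
        rw [← inner_add_left, ← map_add]; congr 2; abel
      rw [e]
      refine (enorm_add_le _ _).trans (add_le_add ?_ ?_)
      · refine (span_disp hU α s c ht g hh).trans ?_
        gcongr
      · rw [← ofReal_norm, ← ofReal_norm g, ← ENNReal.ofReal_mul hε.le]
        refine ENNReal.ofReal_le_ofReal ((norm_inner_le_norm _ _).trans ?_)
        rw [hU.unitary]
        gcongr
    have h0 : Tendsto (fun ε : ℝ => ENNReal.ofReal ε) (𝓝[>] 0) (𝓝 0) := by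
      have := (ENNReal.continuous_ofReal.tendsto 0)
      rw [ENNReal.ofReal_zero] at this
      exact this.mono_left nhdsWithin_le_nhds
    have h1 : Tendsto (fun ε : ℝ => C * ((N1 α f + ENNReal.ofReal ε) * N1 α g) + ENNReal.ofReal ε * ‖g‖ₑ) (𝓝[>] 0)
        (𝓝 (C * ((N1 α f + 0) * N1 α g) + 0 * ‖g‖ₑ)) := by
      refine Tendsto.add (ENNReal.Tendsto.const_mul (ENNReal.Tendsto.mul_const (tendsto_const_nhds.add h0) (Or.inr hg))
        (Or.inr ENNReal.ofReal_ne_top)) (ENNReal.Tendsto.mul_const h0 (Or.inr enorm_ne_top))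
    rw [add_zero, zero_mul, add_zero] at h1
    refine ge_of_tendsto h1 ?_
    filter_upwards [self_mem_nhdsWithin] with ε hε
    exact key ε hε

end KT

namespace ManyBodyWaveguide

/-- **Retarded (inhomogeneous) Strichartz estimate with frozen spatial
variables** (Proposition 2.3, retarded part).  For `m ≥ 3`, `n ≥ 1`, all
`m`-admissible pairs `(q,r)`, `(q̃,r̃)` with conjugates `(q̃',r̃')` and every
index `α`:
`‖∫_0^t e^{i(t-s)Δ_x}F(s)ds‖_{L^q_t L^{r,2}_{y_α} L^2_{z_α} L^2_{x̂_α}} ≲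
  ‖F‖_{L^{q̃'}_t L^{r̃',2}_{y_α} L^2_{z_α} L^2_{x̂_α}}`. -/
theorem strichartz_frozen_retarded (m n N : ℕ) (hm : 3 ≤ m) (hn : 1 ≤ n)
    (hN : 1 ≤ N) (q r qt rt qd rd : ℝ≥0∞)
    (hqr : Admissible m q r) (hqtrt : Admissible m qt rt)
    (hqd : 1 / qt + 1 / qd = 1) (hrd : 1 / rt + 1 / rd = 1) (α : Fin N) :
    ∃ C : ℝ, 0 < C ∧
      ∀ U0 : ℝ → L2 m n N →L[ℂ] L2 m n N, IsPropagator m n N 0 U0 →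
        ∀ F : ℝ → L2 m n N, AEStronglyMeasurable F (volume : Measure ℝ) →
          frozenNormL q r 2 α (duhamel U0 F) ≤
            ENNReal.ofReal C * frozenNormL qd rd 2 α (fun t x => (F t) x) := by
  obtain ⟨C, hC, h⟩ := KT.final hm q r qt rt qd rd hqr hqtrt hqd hrd α
    ((4 * Real.pi) ^ (-((m : ℝ) / 2)))
  exact ⟨C, hC, fun U0 hU F hF => h U0 (KT.disp_of_propagator hm hU α) F hF⟩

end ManyBodyWaveguide
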